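/- Suppose Assumption (V) and Assumption (φ) hold. Then for any μ ∈ ℂ \ ℝ, the operator norm ‖P_h*(H_h − μ)⁻¹P_h − (H − μ)⁻¹‖ on B(L²(ℝ^d)) tends to 0 as h → 0. -/

import Mathlib

open MeasureTheory Complex Real
open scoped FourierTransform InnerProductSpace ENNReal ComplexConjugate

noncomputable section

abbrev Euc (d : ℕ) : Type := EuclideanSpace ℝ (Fin d)
abbrev Zd (d : ℕ) : Type := Fin d → ℤ

instance (d : ℕ) : MeasurableSingletonClass (Zd d) := by
  constructor
  intro f
  have : ({f} : Set (Zd d)) = Set.univ.pi fun j => {f j} := by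
    ext g; simp [Set.eq_univ_iff_forall, funext_iff, Set.mem_pi, eq_comm]
  rw [this]
  exact MeasurableSet.univ_pi fun j => measurableSet_singleton _

/-- The measure on `ℤ^d` giving mass `h^d` to each point, so that `L²` of this measure is
`ℓ²(hℤ^d)` with norm `‖v‖_h² = h^d ∑_z |v(hz)|²`. -/
def latMeas (d : ℕ) (h : ℝ) : Measure (Zd d) := (ENNReal.ofReal (h ^ d)) • Measure.count

/-- `L²(ℝ^d)`. -/
abbrev L2 (d : ℕ) := Lp ℂ 2 (volume : Measure (Euc d))

/-- `ℓ²(hℤ^d)`. -/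
abbrev l2h (d : ℕ) (h : ℝ) := Lp ℂ 2 (latMeas d h)

/-- The lattice point `hz ∈ ℝ^d` associated to `z ∈ ℤ^d`. -/
def latPt (d : ℕ) (h : ℝ) (z : Zd d) : Euc d :=
  (EuclideanSpace.equiv (Fin d) ℝ).symm fun j => h * (z j : ℝ)

/-- The vector in `ℝ^d` associated to `n ∈ ℤ^d`. -/
def latVec (d : ℕ) (n : Zd d) : Euc d :=
  (EuclideanSpace.equiv (Fin d) ℝ).symm fun j => (n j : ℝ)

/-- `P_h : L²(ℝ^d) → ℓ²(hℤ^d)`, `P_h u (z) = h^{−d} ∫ conj(φ(h⁻¹(x−z))) u(x) dx`. -/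
def IsProjOp (d : ℕ) (h : ℝ) (φ : SchwartzMap (Euc d) ℂ)
    (Ph : L2 d →L[ℂ] l2h d h) : Prop :=
  ∀ u : L2 d, ∀ z : Zd d,
    (Ph u : Zd d → ℂ) z =
      (h ^ d : ℂ)⁻¹ * ∫ x, conj (φ (h⁻¹ • (x - latPt d h z))) * (u : Euc d → ℂ) x

/-- The Laplacian `Δu(x) = ∑_j ∂²u/∂x_j²(x)` of a function on `ℝ^d`. -/
def lapl (d : ℕ) (u : Euc d → ℂ) (x : Euc d) : ℂ :=
  ∑ j : Fin d, fderiv ℝ (fun y => fderiv ℝ u y (EuclideanSpace.single j (1 : ℝ))) x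
      (EuclideanSpace.single j (1 : ℝ))

/-- `H` is the continuum Schrödinger operator `−Δ + V`:  a self-adjoint operator on
`L²(ℝ^d)` whose action on every smooth compactly supported function is `−Δu + Vu`.
(Under Assumption (V), `−Δ + V` is essentially self-adjoint on `C_c^∞(ℝ^d)`, so these
conditions uniquely determine `H` as its self-adjoint closure.) -/
def IsSchrodingerOp (d : ℕ) (V : Euc d → ℝ) (H : L2 d →ₗ.[ℂ] L2 d) : Prop :=
  IsSelfAdjoint H ∧
  ∀ (u : Euc d → ℂ) (_ : ContDiff ℝ (⊤ : ℕ∞) u) (_ : HasCompactSupport u)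
    (hu2 : MemLp u 2 (volume : Measure (Euc d)))
    (hHu2 : MemLp (fun x => -(lapl d u x) + (V x : ℂ) * u x) 2 (volume : Measure (Euc d))),
    ∃ hdom : hu2.toLp u ∈ H.domain,
      H ⟨hu2.toLp u, hdom⟩ = hHu2.toLp (fun x => -(lapl d u x) + (V x : ℂ) * u x)

/-- The pointwise action of the discrete Schrödinger operator `H_h = H_{0,h} + V`:
`(H_h v)(hz) = h⁻² ∑_j (2v(hz) − v(hz+he_j) − v(hz−he_j)) + V(hz) v(hz)`. -/
def discAct (d : ℕ) (h : ℝ) (V : Euc d → ℝ) (v : Zd d → ℂ) (z : Zd d) : ℂ :=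
  (h ^ 2 : ℂ)⁻¹ * ∑ j : Fin d, (2 * v z - v (z + Pi.single j 1) - v (z - Pi.single j 1))
    + (V (latPt d h z) : ℂ) * v z

/-- `H_h` is the (self-adjoint) discrete Schrödinger operator `H_{0,h} + V` on `ℓ²(hℤ^d)`,
with its natural (maximal) domain. -/
def IsDiscreteHam (d : ℕ) (h : ℝ) (V : Euc d → ℝ)
    (Hh : l2h d h →ₗ.[ℂ] l2h d h) : Prop :=
  (∀ v : l2h d h,
    MemLp (discAct d h V (v : Zd d → ℂ)) 2 (latMeas d h) → v ∈ Hh.domain) ∧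
  (∀ v : Hh.domain, ∀ z : Zd d,
    (Hh v : Zd d → ℂ) z = discAct d h V ((v : l2h d h) : Zd d → ℂ) z)

/-- `R` is the resolvent `(H − μ)⁻¹` of the (possibly unbounded) operator `H`:  a bounded
operator which is a two-sided inverse of `H − μ`. -/
def IsResolventAt {E : Type*} [NormedAddCommGroup E] [NormedSpace ℂ E]
    (H : E →ₗ.[ℂ] E) (μ : ℂ) (R : E →L[ℂ] E) : Prop :=
  (∀ w : E, ∃ hd : R w ∈ H.domain, H ⟨R w, hd⟩ - μ • R w = w) ∧
  (∀ u : H.domain, R (H u - μ • (u : E)) = u)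

section TorusSampling

/-- The circle `ℝ / ℤ` carries its Haar probability measure. -/
local instance circleMeasureSpace : MeasureSpace UnitAddCircle := ⟨AddCircle.haarAddCircle⟩

/-- The half-open unit cube centred at the origin. -/
def unitCube (d : ℕ) : Set (Fin d → ℝ) :=
  {x | ∀ i, x i ∈ Set.Ioc (-(1 / 2) : ℝ) (-(1 / 2) + 1)}

/-- The lattice points of the unit sup-norm ball. -/
def nearShifts (d : ℕ) : Finset (Zd d) := Fintype.piFinset fun _ => {-1, 0, 1}

/-- An integer vector as a real vector. -/
def intVec {d : ℕ} (n : Zd d) : Fin d → ℝ := fun j => (n j : ℝ)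

/-- The character `x ↦ exp (2πi z·x)`. -/
def latChar {d : ℕ} (z : Zd d) (x : Fin d → ℝ) : ℂ :=
  Complex.exp (2 * π * Complex.I * ∑ j, (z j : ℂ) * (x j : ℂ))

lemma latChar_add_intVec {d : ℕ} (z n : Zd d) (x : Fin d → ℝ) :
    latChar z (x + intVec n) = latChar z x := by
  unfold latChar intVec
  rw [Complex.exp_eq_exp_iff_exists_int]
  refine ⟨∑ j, z j * n j, ?_⟩
  push_cast [Pi.add_apply]
  simp only [mul_add, Finset.sum_add_distrib]
  ring

lemma norm_latChar {d : ℕ} (z : Zd d) (x : Fin d → ℝ) : ‖latChar z x‖ = 1 := by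
  unfold latChar
  have : (2 * π * Complex.I * ∑ j, (z j : ℂ) * (x j : ℂ) : ℂ)
      = ((2 * π * ∑ j, (z j : ℝ) * x j : ℝ) : ℂ) * Complex.I := by
    push_cast; ring
  rw [this, Complex.norm_exp_ofReal_mul_I]

lemma continuous_latChar {d : ℕ} (z : Zd d) : Continuous (latChar z) := by
  unfold latChar; fun_prop

lemma mFourier_coe_eq_latChar {d : ℕ} (z : Zd d) (x : Fin d → ℝ) :
    UnitAddTorus.mFourier z (fun i => (x i : UnitAddCircle)) = latChar z x := by
  simp only [UnitAddTorus.mFourier, ContinuousMap.coe_mk, latChar, fourier_coe_apply,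
    Finset.mul_sum, Complex.exp_sum]
  refine Finset.prod_congr rfl fun i _ => ?_
  congr 1
  simp; ring

lemma measurableSet_unitCube (d : ℕ) : MeasurableSet (unitCube d) :=
  MeasurableSet.univ_pi' (fun _ => measurableSet_Ioc)

/-- The translate of the unit cube centred at a lattice point. -/
def shiftedCube {d : ℕ} (n : Zd d) : Set (Fin d → ℝ) := (fun x => x - intVec n) ⁻¹' unitCube d

lemma measurableSet_shiftedCube {d : ℕ} (n : Zd d) : MeasurableSet (shiftedCube n) :=
  (measurableSet_unitCube d).preimage (measurable_sub_const _)

lemma pairwise_disjoint_shiftedCube (d : ℕ) :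
    Pairwise (Function.onFun Disjoint (shiftedCube (d := d))) := by
  intro m n hmn
  refine Set.disjoint_left.2 fun x hm hn => hmn ?_
  funext i
  have h1 := hm i
  have h2 := hn i
  simp only [intVec, Pi.sub_apply, Set.mem_Ioc] at h1 h2
  have h3 : ((m i : ℝ)) < n i + 1 := by linarith
  have h4 : ((n i : ℝ)) < m i + 1 := by linarith
  have h5 : m i < n i + 1 := by exact_mod_cast h3
  have h6 : n i < m i + 1 := by exact_mod_cast h4
  omega

lemma setIntegral_unitCube_comp_add {E : Type*} [NormedAddCommGroup E] [NormedSpace ℝ E]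
    {d : ℕ} (n : Zd d) (g : (Fin d → ℝ) → E) :
    ∫ x in unitCube d, g (x + intVec n) = ∫ x in shiftedCube n, g x := by
  have h := (measurePreserving_sub_right (volume : Measure (Fin d → ℝ)) (intVec n)
    ).setIntegral_preimage_emb (MeasurableEquiv.subRight (intVec n)).measurableEmbedding
      (fun x => g (x + intVec n)) (unitCube d)
  rw [← h]
  simp [shiftedCube]

lemma integrableOn_unitCube_comp_add {E : Type*} [NormedAddCommGroup E]
    {d : ℕ} (n : Zd d) {g : (Fin d → ℝ) → E} (hg : Integrable g) :
    IntegrableOn (fun x => g (x + intVec n)) (unitCube d) :=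
  (hg.comp_add_right (intVec n)).integrableOn

lemma sum_setIntegral_unitCube {E : Type*} [NormedAddCommGroup E] [NormedSpace ℝ E]
    {d : ℕ} (S : Finset (Zd d)) {g : (Fin d → ℝ) → E} (hg : Integrable g) :
    ∑ n ∈ S, ∫ x in unitCube d, g (x + intVec n) = ∫ x in ⋃ n ∈ S, shiftedCube n, g x := by
  rw [integral_biUnion_finset S (fun n _ => measurableSet_shiftedCube n)
    ((pairwise_disjoint_shiftedCube d).set_pairwise _) (fun n _ => hg.integrableOn)]
  exact Finset.sum_congr rfl fun n _ => setIntegral_unitCube_comp_add n g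

lemma mem_biUnion_shiftedCube {d : ℕ} {x : Fin d → ℝ} (hx : ∀ j, |x j| ≤ 1) :
    x ∈ ⋃ n ∈ nearShifts d, shiftedCube n := by
  have key : ∀ j, ∃ k : ℤ, k ∈ ({-1, 0, 1} : Finset ℤ) ∧
      x j - k ∈ Set.Ioc (-(1 / 2) : ℝ) (-(1 / 2) + 1) := by
    intro j
    have h := abs_le.1 (hx j)
    by_cases h1 : x j ≤ -(1 / 2)
    · exact ⟨-1, by simp, by push_cast; constructor <;> linarith⟩
    by_cases h2 : x j ≤ 1 / 2
    · exact ⟨0, by simp, by push_cast; constructor <;> linarith⟩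
    · exact ⟨1, by simp, by push_cast; constructor <;> linarith⟩
  choose k hk1 hk2 using key
  simp only [Set.mem_iUnion]
  exact ⟨k, Fintype.mem_piFinset.2 hk1, fun j => hk2 j⟩

/-- Periodization over the near shifts. -/
def periodize {d : ℕ} (B : (Fin d → ℝ) → ℂ) (x : Fin d → ℝ) : ℂ :=
  ∑ n ∈ nearShifts d, B (x + intVec n)

lemma memLp_periodize {d : ℕ} {B : (Fin d → ℝ) → ℂ} (hB : MemLp B 2) :
    MemLp (periodize B) 2 :=
  memLp_finsetSum _ fun n _ =>
    hB.comp_measurePreserving (measurePreserving_add_right volume (intVec n))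

theorem hasSum_sq_integral_latChar_mul {d : ℕ} {B : (Fin d → ℝ) → ℂ} (hB : MemLp B 2)
    (hB1 : Integrable B) (hsupp : ∀ x, B x ≠ 0 → ∀ j, |x j| ≤ 1) :
    HasSum (fun z : Zd d => ‖∫ x, latChar z x * B x‖ ^ 2)
      (∫ x in unitCube d, ‖periodize B x‖ ^ 2) := by
  set a : Fin d → ℝ := fun _ => -(1 / 2) with ha
  set f : UnitAddTorus (Fin d) → ℂ :=
    fun t => periodize B (UnitAddTorus.measurableEquivPiIoc a t).1 with hf
  have hfx : ∀ x ∈ unitCube d, f (fun i => (x i : UnitAddCircle)) = periodize B x := by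
    intro x hx
    have : (UnitAddTorus.measurableEquivPiIoc a (fun i => (x i : UnitAddCircle)))
        = ⟨x, fun i => hx i⟩ := by
      rw [← UnitAddTorus.coe_symm_measurableEquivPiIoc_apply a ⟨x, fun i => hx i⟩]
      exact (UnitAddTorus.measurableEquivPiIoc a).apply_symm_apply _
    simp only [hf, this]
  have hcube : MeasurableSet {x : Fin d → ℝ | ∀ i, x i ∈ Set.Ioc (a i) (a i + 1)} :=
    measurableSet_unitCube d
  have hfL : MemLp f 2 (volume : Measure (UnitAddTorus (Fin d))) := by
    have h1 : MemLp (fun y : {x : Fin d → ℝ // ∀ i, x i ∈ Set.Ioc (a i) (a i + 1)} =>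
        periodize B y.1) 2 (Measure.comap Subtype.val volume) := by
      have h2 := (memLp_periodize hB).restrict {x : Fin d → ℝ | ∀ i, x i ∈ Set.Ioc (a i) (a i + 1)}
      rw [← map_comap_subtype_coe hcube] at h2
      exact h2.comp_of_map measurable_subtype_coe.aemeasurable
    exact h1.comp_measurePreserving (UnitAddTorus.measurePreserving_equivPiIoc a)
  have key := UnitAddTorus.hasSum_sq_mFourierCoeff hfL.toLp
  have e1 : ∫ t : UnitAddTorus (Fin d), ‖hfL.toLp f t‖ ^ 2 
      = ∫ x in unitCube d, ‖periodize B x‖ ^ 2 := by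
    rw [integral_congr_ae (g := fun t => ‖f t‖ ^ 2)
      (by filter_upwards [hfL.coeFn_toLp] with t ht; rw [ht])]
    rw [UnitAddTorus.integral_preimage _ a]
    exact setIntegral_congr_fun hcube fun x hx => by simp only [hfx x hx]
  have e2 : ∀ z : Zd d, UnitAddTorus.mFourierCoeff (hfL.toLp f) z
      = ∫ x, latChar (-z) x * B x := by
    intro z
    have : UnitAddTorus.mFourierCoeff (hfL.toLp f) z = UnitAddTorus.mFourierCoeff f z := by
      unfold UnitAddTorus.mFourierCoeff
      refine integral_congr_ae ?_
      filter_upwards [hfL.coeFn_toLp] with t ht; rw [ht]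
    rw [this, UnitAddTorus.mFourierCoeff_eq_integral f z a]
    have hInt : Integrable (fun x => latChar (-z) x * B x) :=
      hB1.bdd_mul (continuous_latChar _).aestronglyMeasurable
        (Filter.Eventually.of_forall fun x => (norm_latChar _ x).le)
    calc _ = ∫ x in unitCube d, ∑ n ∈ nearShifts d,
              latChar (-z) (x + intVec n) * B (x + intVec n) := by
            refine setIntegral_congr_fun hcube fun x hx => ?_
            simp only [hfx x hx, mFourier_coe_eq_latChar, latChar_add_intVec, smul_eq_mul,
              periodize, Finset.mul_sum]
      _ = _ := by
            rw [integral_finsetSum _ fun n _ => integrableOn_unitCube_comp_add n hInt,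
              sum_setIntegral_unitCube _ hInt]
            refine setIntegral_eq_integral_of_forall_compl_eq_zero fun x hx => ?_
            by_contra h
            exact hx (mem_biUnion_shiftedCube (hsupp x (right_ne_zero_of_mul h)))
  rw [e1] at key
  simp only [e2] at key
  exact ((Equiv.neg (Zd d)).hasSum_iff (f := fun z : Zd d => ‖∫ x, latChar z x * B x‖ ^ 2)).1 key

/-- The samples of a band-limited function: their `ℓ²` norm is controlled from above by the `L²`
norm of the spectrum `U`, and from below by its low-frequency part. -/
theorem hasSum_sq_integral_latChar_conj_mul {d : ℕ} {ψ : (Fin d → ℝ) → ℂ} (hψ : Continuous ψ)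
    {δ : ℝ} (hδ0 : 0 < δ) (hδ : δ ≤ 1 / 2)
    (hψs : ∀ x, ψ x ≠ 0 → ∀ j, |x j| ≤ 1 - δ)
    (hψ1 : ∀ x, ∑' n : Zd d, ‖ψ (x + intVec n)‖ ^ 2 = 1)
    {U : (Fin d → ℝ) → ℂ} (hU : MemLp U 2) :
    ∃ s : ℝ, HasSum (fun z : Zd d => ‖∫ x, latChar z x * (conj (ψ x) * U x)‖ ^ 2) s ∧
      s ≤ ∫ x, ‖U x‖ ^ 2 ∧ ∫ x in {x | ∀ j, |x j| < δ}, ‖U x‖ ^ 2 ≤ s := by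
  have hfin : ∀ x (S : Finset (Zd d)), ∑ n ∈ S, ‖ψ (x + intVec n)‖ ^ 2 ≤ 1 := by
    intro x S
    rw [← hψ1 x]
    refine Summable.sum_le_tsum _ (fun _ _ => by positivity) ?_
    by_contra h
    have := hψ1 x
    rw [tsum_eq_zero_of_not_summable h] at this
    norm_num at this
  have hb : ∀ x, ‖ψ x‖ ≤ 1 := by
    intro x
    have := hfin x {0}
    have h0 : intVec (0 : Zd d) = 0 := by ext; simp [intVec]
    simp only [Finset.sum_singleton, h0, add_zero] at this
    nlinarith [norm_nonneg (ψ x)]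
  have hcs : HasCompactSupport ψ := by
    refine HasCompactSupport.intro (K := Metric.closedBall 0 1) (isCompact_closedBall _ _) ?_
    intro x hx
    by_contra h
    refine hx (mem_closedBall_zero_iff.2 ((pi_norm_le_iff_of_nonneg zero_le_one).2 fun j => ?_))
    rw [Real.norm_eq_abs]
    linarith [hψs x h j]
  have hB : MemLp (fun x => conj (ψ x) * U x) 2 := by
    refine MemLp.of_le hU ?_ (Filter.Eventually.of_forall fun x => ?_)
    · exact (by fun_prop : Continuous fun x => conj (ψ x)).aestronglyMeasurable.mul hU.1
    · rw [norm_mul, RCLike.norm_conj]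
      exact mul_le_of_le_one_left (norm_nonneg _) (hb x)
  have hψ2 : MemLp (fun x => conj (ψ x)) 2 :=
    Continuous.memLp_of_hasCompactSupport (by fun_prop) (hcs.comp_left (g := conj) (by simp))
  have hB1 : Integrable (fun x => conj (ψ x) * U x) := hψ2.integrable_mul hU
  have hU2 : Integrable (fun x => ‖U x‖ ^ 2) := hU.integrable_norm_pow (by norm_num)
  refine ⟨_, hasSum_sq_integral_latChar_mul hB hB1 ?_, ?_, ?_⟩
  · intro x hx j
    have : ψ x ≠ 0 := fun h => hx (by simp [h])
    linarith [hψs x this j]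
  · have hpt : ∀ x, ‖periodize (fun x => conj (ψ x) * U x) x‖ ^ 2
        ≤ ∑ n ∈ nearShifts d, ‖U (x + intVec n)‖ ^ 2 := by
      intro x
      calc _ ≤ (∑ n ∈ nearShifts d, ‖ψ (x + intVec n)‖ * ‖U (x + intVec n)‖) ^ 2 := by
            gcongr
            refine (norm_sum_le _ _).trans (le_of_eq ?_)
            simp
        _ ≤ (∑ n ∈ nearShifts d, ‖ψ (x + intVec n)‖ ^ 2)
              * ∑ n ∈ nearShifts d, ‖U (x + intVec n)‖ ^ 2 := Finset.sum_mul_sq_le_sq_mul_sq _ _ _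
        _ ≤ _ := mul_le_of_le_one_left (Finset.sum_nonneg fun _ _ => by positivity) (hfin x _)
    calc _ ≤ ∫ x in unitCube d, ∑ n ∈ nearShifts d, ‖U (x + intVec n)‖ ^ 2 :=
          integral_mono_of_nonneg (Filter.Eventually.of_forall fun x => by positivity)
            (integrable_finsetSum _ fun n _ =>
              integrableOn_unitCube_comp_add n (g := fun x => ‖U x‖ ^ 2) hU2)
            (Filter.Eventually.of_forall hpt)
      _ = ∫ x in ⋃ n ∈ nearShifts d, shiftedCube n, ‖U x‖ ^ 2 := by
          rw [integral_finsetSum _ fun n _ =>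
            integrableOn_unitCube_comp_add n (g := fun x => ‖U x‖ ^ 2) hU2]
          exact sum_setIntegral_unitCube _ (g := fun x => ‖U x‖ ^ 2) hU2
      _ ≤ _ := setIntegral_le_integral hU2 (Filter.Eventually.of_forall fun x => by positivity)
  · have hmeas : MeasurableSet {x : Fin d → ℝ | ∀ j, |x j| < δ} := by
      rw [Set.ofPred_forall]
      exact MeasurableSet.iInter fun j =>
        measurableSet_lt (by fun_prop) measurable_const
    have hvan : ∀ x : Fin d → ℝ, (∀ j, |x j| < δ) → ∀ n : Zd d, n ≠ 0 → ψ (x + intVec n) = 0 := by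
      intro x hx n hn
      by_contra h
      obtain ⟨j, hj⟩ := Function.ne_iff.1 hn
      have h1 := hψs _ h j
      have h2 := hx j
      simp only [Pi.zero_apply] at hj
      have h3 : (1 : ℝ) ≤ |(n j : ℝ)| := by exact_mod_cast Int.one_le_abs hj
      simp only [Pi.add_apply, intVec] at h1
      have h4 := abs_sub_abs_le_abs_add (n j : ℝ) (x j)
      rw [add_comm] at h1
      linarith
    have h0 : intVec (0 : Zd d) = 0 := by ext; simp [intVec]
    have hone : ∀ x : Fin d → ℝ, (∀ j, |x j| < δ) → ‖ψ x‖ = 1 := by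
      intro x hx
      have := hψ1 x
      rw [tsum_eq_single 0 (fun n hn => by rw [hvan x hx n hn]; simp), h0, add_zero] at this
      nlinarith [norm_nonneg (ψ x)]
    have hsub : {x : Fin d → ℝ | ∀ j, |x j| < δ} ⊆ unitCube d := by
      intro x hx j
      have := abs_lt.1 (hx j)
      constructor <;> linarith
    calc _ = ∫ x in {x : Fin d → ℝ | ∀ j, |x j| < δ},
              ‖periodize (fun x => conj (ψ x) * U x) x‖ ^ 2 := by
          refine setIntegral_congr_fun hmeas fun x hx => ?_
          have : periodize (fun x => conj (ψ x) * U x) x = conj (ψ x) * U x := by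
            unfold periodize
            rw [Finset.sum_eq_single 0]
            · simp [h0]
            · intro n _ hn; simp [hvan x hx n hn]
            · intro h; exact absurd (Fintype.mem_piFinset.2 fun _ => by simp) h
          simp only [this, norm_mul, RCLike.norm_conj, hone x hx, one_mul]
      _ ≤ _ := setIntegral_mono_set
          ((memLp_periodize hB).integrable_norm_pow (by norm_num)).integrableOn
          (Filter.Eventually.of_forall fun x => by positivity)
          (Filter.Eventually.of_forall fun x hx => hsub hx)

end TorusSampling

section LatticeSpace

variable {d : ℕ} {h : ℝ}

lemma ae_latMeas_iff (hh : 0 < h) {p : Zd d → Prop} :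
    (∀ᵐ z ∂latMeas d h, p z) ↔ ∀ z, p z := by
  have h0 : ENNReal.ofReal (h ^ d) ≠ 0 := by
    simpa [ENNReal.ofReal_eq_zero] using pow_pos hh d
  rw [latMeas, Measure.ae_ennreal_smul_measure_iff h0]
  simp [Measure.count, Filter.eventually_top]

lemma aestronglyMeasurable_latMeas (f : Zd d → ℂ) : AEStronglyMeasurable f (latMeas d h) :=
  StronglyMeasurable.of_discrete.aestronglyMeasurable

lemma integrable_latMeas_iff {E : Type*} [NormedAddCommGroup E] (hh : 0 < h) {f : Zd d → E} :
    Integrable f (latMeas d h) ↔ Summable fun z => ‖f z‖ := by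
  have h0 : ENNReal.ofReal (h ^ d) ≠ 0 := by
    simpa [ENNReal.ofReal_eq_zero] using pow_pos hh d
  rw [latMeas, integrable_smul_measure h0 ENNReal.ofReal_ne_top, integrable_count_iff]

lemma memLp_latMeas_iff (hh : 0 < h) {f : Zd d → ℂ} :
    MemLp f 2 (latMeas d h) ↔ Summable fun z => ‖f z‖ ^ 2 := by
  rw [memLp_two_iff_integrable_sq_norm (aestronglyMeasurable_latMeas f), integrable_latMeas_iff hh]
  simp

lemma hasSum_integral_latMeas (hh : 0 < h) {f : Zd d → ℂ} (hf : Integrable f (latMeas d h)) :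
    HasSum (fun z => (h ^ d : ℂ) * f z) (∫ z, f z ∂latMeas d h) := by
  have h0 : ENNReal.ofReal (h ^ d) ≠ 0 := by
    simpa [ENNReal.ofReal_eq_zero] using pow_pos hh d
  have hf' : Integrable f Measure.count := by
    rwa [latMeas, integrable_smul_measure h0 ENNReal.ofReal_ne_top] at hf
  rw [latMeas, integral_smul_measure, ENNReal.toReal_ofReal (pow_pos hh d).le]
  have := hasSum_integral_measure (f := f) (μ := fun z : Zd d => Measure.dirac z) hf'
  have h2 := this.const_smul (h ^ d : ℝ)
  have e : (fun z => (h ^ d : ℂ) * f z) =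
      fun z => (h ^ d : ℝ) • ∫ x, f x ∂Measure.dirac z := by
    ext z
    rw [integral_dirac]
    simp
  rw [e]
  exact h2

lemma hasSum_inner_latMeas (hh : 0 < h) (a b : l2h d h) :
    HasSum (fun z => (h ^ d : ℂ) * (conj (a z) * b z)) ⟪a, b⟫_ℂ := by
  have := hasSum_integral_latMeas hh (L2.integrable_inner a b (𝕜 := ℂ))
  rw [← L2.inner_def] at this
  simpa [mul_comm] using this

lemma hasSum_norm_sq_latMeas (hh : 0 < h) (a : l2h d h) :
    HasSum (fun z => h ^ d * ‖a z‖ ^ 2) (‖a‖ ^ 2) := by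
  have := hasSum_inner_latMeas hh a a
  rw [inner_self_eq_norm_sq_to_K] at this
  have h2 := Complex.hasSum_re this
  convert h2 using 1
  · ext z
    rw [Complex.conj_mul', ← Complex.ofReal_pow, ← Complex.ofReal_pow, ← Complex.ofReal_mul,
      Complex.ofReal_re]
  · rw [RCLike.ofReal_eq_complex_ofReal, ← Complex.ofReal_pow, Complex.ofReal_re]

lemma coeFn_toLp_latMeas (hh : 0 < h) {f : Zd d → ℂ} (hf : MemLp f 2 (latMeas d h)) :
    ⇑(hf.toLp f) = f := by
  funext z
  exact (ae_latMeas_iff hh).1 hf.coeFn_toLp z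

lemma ext_latMeas (hh : 0 < h) {a b : l2h d h} (hab : ∀ z, a z = b z) : a = b :=
  Lp.ext ((ae_latMeas_iff hh).2 hab)

lemma coeFn_add_latMeas (hh : 0 < h) (a b : l2h d h) : ⇑(a + b) = a + b :=
  funext <| (ae_latMeas_iff hh).1 (Lp.coeFn_add a b)

lemma coeFn_sub_latMeas (hh : 0 < h) (a b : l2h d h) : ⇑(a - b) = a - b :=
  funext <| (ae_latMeas_iff hh).1 (Lp.coeFn_sub a b)

lemma coeFn_smul_latMeas (hh : 0 < h) (c : ℂ) (a : l2h d h) : ⇑(c • a) = c • ⇑a :=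
  funext <| (ae_latMeas_iff hh).1 (Lp.coeFn_smul c a)

lemma memLp_latMeas_of_finite_support (hh : 0 < h) {g : Zd d → ℂ} (hg : g.support.Finite) :
    MemLp g 2 (latMeas d h) := by
  rw [memLp_latMeas_iff hh]
  refine (hasSum_sum_of_ne_finset_zero (s := hg.toFinset) fun z hz => ?_).summable
  simpa using hz

/-- The element of `ℓ²(hℤ^d)` given by a finitely supported function. -/
def finLat (hh : 0 < h) (g : Zd d →₀ ℂ) : l2h d h :=
  (memLp_latMeas_of_finite_support hh (g := ⇑g) g.hasFiniteSupport).toLp ⇑g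

lemma coeFn_finLat (hh : 0 < h) (g : Zd d →₀ ℂ) : ⇑(finLat hh g) = g :=
  coeFn_toLp_latMeas hh _

lemma inner_finLat (hh : 0 < h) (g : Zd d →₀ ℂ) (v : l2h d h) :
    ⟪finLat hh g, v⟫_ℂ = (h ^ d : ℂ) * ∑ z ∈ g.support, conj (g z) * v z := by
  rw [Finset.mul_sum]
  refine (hasSum_inner_latMeas hh _ v).unique ?_
  rw [coeFn_finLat]
  refine hasSum_sum_of_ne_finset_zero fun z hz => ?_
  simp [Finsupp.notMem_support_iff.1 hz]

lemma norm_sq_finLat (hh : 0 < h) (g : Zd d →₀ ℂ) :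
    ‖finLat hh g‖ ^ 2 = h ^ d * ∑ z ∈ g.support, ‖g z‖ ^ 2 := by
  rw [Finset.mul_sum]
  refine (hasSum_norm_sq_latMeas hh _).unique ?_
  rw [coeFn_finLat]
  refine hasSum_sum_of_ne_finset_zero fun z hz => ?_
  simp [Finsupp.notMem_support_iff.1 hz]

lemma finLat_add (hh : 0 < h) (f g : Zd d →₀ ℂ) :
    finLat hh (f + g) = finLat hh f + finLat hh g := by
  refine ext_latMeas hh fun z => ?_
  rw [coeFn_add_latMeas hh]
  simp only [coeFn_finLat]
  rfl

lemma finLat_sub (hh : 0 < h) (f g : Zd d →₀ ℂ) :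
    finLat hh (f - g) = finLat hh f - finLat hh g := by
  refine ext_latMeas hh fun z => ?_
  rw [coeFn_sub_latMeas hh]
  simp only [coeFn_finLat]
  rfl

lemma finLat_smul (hh : 0 < h) (c : ℂ) (f : Zd d →₀ ℂ) :
    finLat hh (c • f) = c • finLat hh f := by
  refine ext_latMeas hh fun z => ?_
  rw [coeFn_smul_latMeas hh]
  simp only [coeFn_finLat]
  rfl

end LatticeSpace

section LatticeFourier

variable {d : ℕ} {h : ℝ}

lemma measurableEmbedding_toLp : MeasurableEmbedding (WithLp.toLp 2 : (Fin d → ℝ) → Euc d) :=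
  (MeasurableEquiv.toLp 2 (Fin d → ℝ)).measurableEmbedding

lemma integral_comp_inv_smul_toLp {E : Type*} [NormedAddCommGroup E] [NormedSpace ℝ E]
    (hh : 0 < h) (G : Euc d → E) :
    ∫ x : Fin d → ℝ, G (h⁻¹ • WithLp.toLp 2 x) = h ^ d • ∫ ξ, G ξ := by
  rw [(PiLp.volume_preserving_toLp (Fin d)).integral_comp measurableEmbedding_toLp
    (fun y => G (h⁻¹ • y)), Measure.integral_comp_inv_smul_of_nonneg _ _ hh.le]
  simp

/-- The character `ξ ↦ e^{2πi⟨p, ξ⟩}`. -/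
def planeWave (p ξ : Euc d) : ℂ := cexp (2 * π * I * (⟪p, ξ⟫_ℝ : ℝ))

lemma norm_planeWave (p ξ : Euc d) : ‖planeWave p ξ‖ = 1 := by
  rw [planeWave, show (2 * π * I * (⟪p, ξ⟫_ℝ : ℝ) : ℂ) = ((2 * π * ⟪p, ξ⟫_ℝ : ℝ) : ℂ) * I by
    push_cast; ring]
  exact Complex.norm_exp_ofReal_mul_I _

lemma continuous_planeWave (p : Euc d) : Continuous (planeWave p) := by
  unfold planeWave
  fun_prop

lemma latPt_apply (z : Zd d) (j : Fin d) : latPt d h z j = h * z j := rfl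

lemma planeWave_latPt (hh : 0 < h) (z : Zd d) (x : Fin d → ℝ) :
    planeWave (latPt d h z) (h⁻¹ • WithLp.toLp 2 x) = latChar z x := by
  unfold planeWave latChar
  congr 2
  rw [PiLp.inner_apply]
  push_cast
  refine Finset.sum_congr rfl fun j _ => ?_
  simp only [latPt_apply, PiLp.smul_apply, smul_eq_mul, RCLike.inner_apply, conj_trivial]
  have : (h : ℂ) ≠ 0 := by exact_mod_cast hh.ne'
  push_cast
  field_simp

/-- The structural hypotheses on the symbol `ψ = 𝓕 φ`. -/
structure IsSamplingSymbol (ψ : Euc d → ℂ) (δ : ℝ) : Prop where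
  cont : Continuous ψ
  pos : 0 < δ
  le_half : δ ≤ 1 / 2
  support_le : ∀ x, ψ x ≠ 0 → ∀ j, |x j| ≤ 1 - δ
  tsum_sq : ∀ x, ∑' n : Zd d, ‖ψ (x + latVec d n)‖ ^ 2 = 1

theorem IsSamplingSymbol.hasSum_sq {ψ : Euc d → ℂ} {δ : ℝ} (H : IsSamplingSymbol ψ δ)
    (hh : 0 < h) {U : Euc d → ℂ} (hUm : Measurable U) (hU : MemLp U 2) :
    ∃ s : ℝ, HasSum (fun z : Zd d => h ^ d *
        ‖∫ ξ, planeWave (latPt d h z) ξ * (conj (ψ (h • ξ)) * U ξ)‖ ^ 2) s ∧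
      s ≤ ∫ ξ, ‖U ξ‖ ^ 2 ∧ ∫ ξ in {ξ | ∀ j, |h * ξ j| < δ}, ‖U ξ‖ ^ 2 ≤ s := by
  have hd : 0 < h ^ d := pow_pos hh d
  have hU' : MemLp (fun x : Fin d → ℝ => U (h⁻¹ • WithLp.toLp 2 x)) 2 := by
    rw [memLp_two_iff_integrable_sq_norm]
    · have h1 := (memLp_two_iff_integrable_sq_norm hU.1).1 hU
      have h2 := h1.comp_smul (inv_ne_zero hh.ne')
      exact ((PiLp.volume_preserving_toLp (Fin d)).integrable_comp_emb
        measurableEmbedding_toLp).2 h2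
    · refine Measurable.aestronglyMeasurable (hUm.comp ?_)
      exact (measurableEmbedding_toLp.measurable).const_smul h⁻¹
  have hψ' : Continuous fun x : Fin d → ℝ => ψ (WithLp.toLp 2 x) :=
    H.cont.comp (PiLp.continuous_toLp 2 _)
  obtain ⟨s, hs, hle, hge⟩ := hasSum_sq_integral_latChar_conj_mul (d := d)
    (ψ := fun x => ψ (WithLp.toLp 2 x)) hψ' H.pos H.le_half (fun x hx => H.support_le _ hx)
    (fun x => H.tsum_sq (WithLp.toLp 2 x)) hU'
  rw [integral_comp_inv_smul_toLp hh (fun ξ => ‖U ξ‖ ^ 2), smul_eq_mul] at hle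
  have e1 : ∫ x in {x : Fin d → ℝ | ∀ j, |x j| < δ}, ‖U (h⁻¹ • WithLp.toLp 2 x)‖ ^ 2 =
      h ^ d * ∫ ξ in {ξ : Euc d | ∀ j, |h * ξ j| < δ}, ‖U ξ‖ ^ 2 := by
    have m2 : MeasurableSet {ξ : Euc d | ∀ j, |h * ξ j| < δ} := by
      rw [Set.ofPred_forall]
      exact MeasurableSet.iInter fun j => measurableSet_lt (by fun_prop) (by fun_prop)
    have m1 : MeasurableSet {x : Fin d → ℝ | ∀ j, |x j| < δ} := by
      rw [Set.ofPred_forall]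
      exact MeasurableSet.iInter fun j => measurableSet_lt (by fun_prop) (by fun_prop)
    rw [← integral_indicator m1, ← integral_indicator m2, ← smul_eq_mul,
      ← integral_comp_inv_smul_toLp hh]
    refine integral_congr_ae (Filter.Eventually.of_forall fun x => ?_)
    simp [Set.indicator, hh.ne']
  rw [e1] at hge
  refine ⟨(h ^ d)⁻¹ * s, ?_, ?_, ?_⟩
  · have e2 : (fun z : Zd d => h ^ d *
        ‖∫ ξ, planeWave (latPt d h z) ξ * (conj (ψ (h • ξ)) * U ξ)‖ ^ 2) =
        fun z => (h ^ d)⁻¹ * ‖∫ x : Fin d → ℝ, latChar z x *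
          (conj (ψ (WithLp.toLp 2 x)) * U (h⁻¹ • WithLp.toLp 2 x))‖ ^ 2 := by
      funext z
      have e2 : ∫ x : Fin d → ℝ, latChar z x *
          (conj (ψ (WithLp.toLp 2 x)) * U (h⁻¹ • WithLp.toLp 2 x)) =
          h ^ d • ∫ ξ, planeWave (latPt d h z) ξ * (conj (ψ (h • ξ)) * U ξ) := by
        rw [← integral_comp_inv_smul_toLp hh]
        refine integral_congr_ae (Filter.Eventually.of_forall fun x => ?_)
        simp only [planeWave_latPt hh, smul_smul, mul_inv_cancel₀ hh.ne', one_smul]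
      rw [e2, norm_smul, Real.norm_of_nonneg hd.le]
      field_simp
    rw [e2]
    exact hs.mul_left _
  · rw [inv_mul_le_iff₀ hd]; exact hle
  · rw [le_inv_mul_iff₀ hd]; exact hge

lemma exists_isSamplingSymbol {φ : SchwartzMap (Euc d) ℂ}
    (hφ1 : ∀ ξ : Euc d, ∑' n : Zd d, ‖𝓕 ⇑φ (ξ + latVec d n)‖ ^ 2 = 1)
    (hφ2 : tsupport (𝓕 ⇑φ) ⊆ {ξ : Euc d | ∀ j, ξ j ∈ Set.Ioo (-1 : ℝ) 1}) :
    ∃ δ, IsSamplingSymbol (𝓕 ⇑φ) δ := by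
  have hcont : Continuous (𝓕 ⇑φ) := (𝓕 φ).continuous
  set N : Euc d → ℝ := fun ξ => ‖(WithLp.ofLp ξ : Fin d → ℝ)‖ with hN
  have hNc : Continuous N := (PiLp.continuous_ofLp 2 _).norm
  have hN1 : ∀ ξ ∈ tsupport (𝓕 ⇑φ), N ξ < 1 := fun ξ hξ => by
    rw [hN, pi_norm_lt_iff one_pos]
    intro j
    rw [Real.norm_eq_abs, abs_lt]
    exact hφ2 hξ j
  have hcomp : IsCompact (tsupport (𝓕 ⇑φ)) := by
    refine Metric.isCompact_of_isClosed_isBounded (isClosed_tsupport _) ?_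
    have hb := (Metric.isBounded_ball (x := (0 : Fin d → ℝ)) (r := 1))
    refine ((PiLp.lipschitzWith_toLp 2 _).isBounded_image hb).subset fun ξ hξ => ?_
    exact ⟨WithLp.ofLp ξ, by simpa using hN1 ξ hξ, rfl⟩
  obtain ⟨m, hm1, hm⟩ : ∃ m < 1, ∀ ξ ∈ tsupport (𝓕 ⇑φ), N ξ ≤ m := by
    rcases (tsupport (𝓕 ⇑φ)).eq_empty_or_nonempty with he | hne
    · exact ⟨0, one_pos, by simp [he]⟩
    · obtain ⟨ξ, hξ, hmax⟩ := hcomp.exists_isMaxOn hne hNc.continuousOn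
      exact ⟨N ξ, hN1 ξ hξ, fun η hη => hmax hη⟩
  refine ⟨min (1 / 2) (1 - m), hcont, lt_min (by norm_num) (by linarith), min_le_left _ _,
    fun x hx j => ?_, hφ1⟩
  have h1 := hm x (subset_tsupport _ hx)
  have h2 : |x j| ≤ N x := norm_le_pi_norm (WithLp.ofLp x : Fin d → ℝ) j
  linarith [min_le_right (1 / 2 : ℝ) (1 - m)]

/-- The translated and rescaled generating function `x ↦ φ(h⁻¹(x - p))`. -/
def rescale (φ : SchwartzMap (Euc d) ℂ) (hh : h ≠ 0) (p : Euc d) : SchwartzMap (Euc d) ℂ :=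
  SchwartzMap.compSubConstCLM ℂ p (SchwartzMap.compCLMOfContinuousLinearEquiv ℂ
    (ContinuousLinearEquiv.smulLeft (Units.mk0 h hh)⁻¹) φ)

lemma rescale_apply (φ : SchwartzMap (Euc d) ℂ) (hh : h ≠ 0) (p x : Euc d) :
    rescale φ hh p x = φ (h⁻¹ • (x - p)) := rfl

lemma fourier_rescale (φ : SchwartzMap (Euc d) ℂ) (hh : 0 < h) (p ξ : Euc d) :
    𝓕 (rescale φ hh.ne' p) ξ = h ^ d * (conj (planeWave p ξ) * 𝓕 ⇑φ (h • ξ)) := by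
  rw [SchwartzMap.fourier_coe, Real.fourier_eq', Real.fourier_eq']
  rw [← integral_add_right_eq_self _ p]
  simp only [rescale_apply, add_sub_cancel_right]
  have := Measure.integral_comp_inv_smul_of_nonneg volume
    (fun v : Euc d => cexp (↑(-2 * π * ⟪v, h • ξ⟫_ℝ) * I) • φ v) hh.le
  rw [finrank_euclideanSpace_fin] at this
  have e : (∫ x : Euc d, cexp (↑(-2 * π * ⟪x + p, ξ⟫_ℝ) * I) • φ (h⁻¹ • x)) =
      conj (planeWave p ξ) * ∫ x : Euc d,
        cexp (↑(-2 * π * ⟪h⁻¹ • x, h • ξ⟫_ℝ) * I) • φ (h⁻¹ • x) := by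
    rw [← integral_const_mul]
    refine integral_congr_ae (Filter.Eventually.of_forall fun x => ?_)
    simp only [planeWave, ← Complex.exp_conj, smul_eq_mul, ← mul_assoc, ← Complex.exp_add]
    congr 2
    rw [inner_smul_left, inner_smul_right, inner_add_left]
    simp only [conj_trivial, map_mul, Complex.conj_I, Complex.conj_ofReal, map_ofNat]
    rw [inv_mul_cancel_left₀ hh.ne']
    push_cast
    ring
  rw [e, this]
  simp only [real_smul]
  push_cast
  ring

/-- Fourier representation of the projections of a Schwartz function. -/
lemma integral_conj_rescale_mul (φ u : SchwartzMap (Euc d) ℂ) (hh : 0 < h) (p : Euc d) :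
    (h ^ d : ℂ)⁻¹ * ∫ x, conj (φ (h⁻¹ • (x - p))) * u x =
      ∫ ξ, planeWave p ξ * (conj (𝓕 ⇑φ (h • ξ)) * 𝓕 u ξ) := by
  have hd : (h ^ d : ℂ) ≠ 0 := pow_ne_zero _ (by exact_mod_cast hh.ne')
  have := SchwartzMap.integral_inner_fourier_fourier (rescale φ hh.ne' p) u
  simp only [RCLike.inner_apply, rescale_apply] at this
  rw [inv_mul_eq_iff_eq_mul₀ hd, ← integral_const_mul]
  simp only [mul_comm (conj _) (u _)]
  rw [← this]
  refine integral_congr_ae (Filter.Eventually.of_forall fun x => ?_)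
  have e := fourier_rescale φ hh p x
  simp only [e, map_mul, Complex.conj_conj, map_pow, Complex.conj_ofReal]
  ring

end LatticeFourier

section Symbols

variable {d : ℕ} {h : ℝ}

/-- The symbol `4π²|ξ|²` of `-Δ`. -/
def contSymbol (ξ : Euc d) : ℝ := 4 * π ^ 2 * ‖ξ‖ ^ 2

/-- The symbol `h⁻² ∑ (2 - 2 cos (2πhξ_j))` of the discrete Laplacian. -/
def discSymbol (h : ℝ) (ξ : Euc d) : ℝ := (h ^ 2)⁻¹ * ∑ j, (2 - 2 * Real.cos (2 * π * (h * ξ j)))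

lemma contSymbol_nonneg (ξ : Euc d) : 0 ≤ contSymbol ξ := by unfold contSymbol; positivity

lemma discSymbol_nonneg (ξ : Euc d) : 0 ≤ discSymbol h ξ := by
  unfold discSymbol
  have : ∀ j : Fin d, 0 ≤ 2 - 2 * Real.cos (2 * π * (h * ξ j)) := fun j => by
    linarith [Real.cos_le_one (2 * π * (h * ξ j))]
  exact mul_nonneg (by positivity) (Finset.sum_nonneg fun j _ => this j)

lemma continuous_contSymbol : Continuous (contSymbol : Euc d → ℝ) := by
  unfold contSymbol; fun_prop

lemma continuous_discSymbol : Continuous (discSymbol h : Euc d → ℝ) := by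
  unfold discSymbol; fun_prop

lemma discSymbol_le (ξ : Euc d) : discSymbol h ξ ≤ (h ^ 2)⁻¹ * (4 * d) := by
  unfold discSymbol
  refine mul_le_mul_of_nonneg_left ?_ (by positivity)
  refine (Finset.sum_le_sum (g := fun _ => (4 : ℝ)) fun j _ => ?_).trans (by simp [mul_comm])
  linarith [Real.neg_one_le_cos (2 * π * (h * ξ j))]

lemma contSymbol_eq (hh : 0 < h) (ξ : Euc d) :
    contSymbol ξ = (h ^ 2)⁻¹ * ∑ j, (2 * π * (h * ξ j)) ^ 2 := by
  unfold contSymbol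
  rw [EuclideanSpace.real_norm_sq_eq, Finset.mul_sum, Finset.mul_sum]
  refine Finset.sum_congr rfl fun j _ => ?_
  field_simp
  ring

lemma sq_sub_cos_nonneg (x : ℝ) : 0 ≤ x ^ 2 - (2 - 2 * Real.cos x) := by
  linarith [Real.one_sub_sq_div_two_le_cos (x := x)]

lemma sq_sub_cos_le (x : ℝ) : x ^ 2 - (2 - 2 * Real.cos x) ≤ (x ^ 2) ^ 2 := by
  rcases le_or_gt |x| 1 with hx | hx
  · have h1 := (abs_le.1 (Real.cos_bound hx)).2
    have h2 : |x| ^ 4 = (x ^ 2) ^ 2 := by rw [← sq_abs x]; ring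
    rw [h2] at h1
    nlinarith [sq_nonneg (x ^ 2)]
  · have h1 : 1 ≤ x ^ 2 := by rw [← sq_abs]; nlinarith
    nlinarith [Real.cos_le_one x]

lemma abs_contSymbol_sub_discSymbol_le (hh : 0 < h) (ξ : Euc d) :
    |contSymbol ξ - discSymbol h ξ| ≤ h ^ 2 * contSymbol ξ ^ 2 := by
  have e : contSymbol ξ - discSymbol h ξ = (h ^ 2)⁻¹ * ∑ j,
      ((2 * π * (h * ξ j)) ^ 2 - (2 - 2 * Real.cos (2 * π * (h * ξ j)))) := by
    rw [contSymbol_eq hh, discSymbol, ← mul_sub, ← Finset.sum_sub_distrib]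
  rw [e, abs_of_nonneg (mul_nonneg (by positivity)
    (Finset.sum_nonneg fun j _ => sq_sub_cos_nonneg _)), contSymbol_eq hh]
  have h1 : ∑ j, ((2 * π * (h * ξ j)) ^ 2 - (2 - 2 * Real.cos (2 * π * (h * ξ j)))) ≤
      (∑ j, (2 * π * (h * ξ j)) ^ 2) ^ 2 :=
    (Finset.sum_le_sum fun j _ => sq_sub_cos_le _).trans
      (Finset.sum_sq_le_sq_sum_of_nonneg fun j _ => sq_nonneg _)
  calc _ ≤ (h ^ 2)⁻¹ * (∑ j, (2 * π * (h * ξ j)) ^ 2) ^ 2 := by gcongr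
    _ = _ := by field_simp

lemma mul_sq_le_two_sub_cos {δ : ℝ} (hδ : 0 < δ) (hδ2 : δ ≤ 1 / 2) {t : ℝ} (ht : |t| ≤ 1 - δ) :
    4 * δ ^ 2 / π ^ 2 * (2 * π * t) ^ 2 ≤ 2 - 2 * Real.cos (2 * π * t) := by
  have hs : 2 * δ * |t| ≤ Real.sin (π * |t|) := by
    have ht0 := abs_nonneg t
    rcases le_or_gt |t| (1 / 2) with h1 | h1
    · have := Real.mul_le_sin (x := π * |t|) (by positivity) (by nlinarith [Real.pi_pos])
      have e : 2 / π * (π * |t|) = 2 * |t| := by field_simp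
      rw [e] at this
      nlinarith
    · have := Real.mul_le_sin (x := π * (1 - |t|))
        (mul_nonneg Real.pi_pos.le (by linarith)) (by nlinarith [Real.pi_pos])
      have e : 2 / π * (π * (1 - |t|)) = 2 * (1 - |t|) := by field_simp
      rw [e, show π * (1 - |t|) = π - π * |t| by ring, Real.sin_pi_sub] at this
      nlinarith
  have hc : 2 - 2 * Real.cos (2 * π * t) = 4 * Real.sin (π * |t|) ^ 2 := by
    have h1 : Real.cos (2 * π * t) = Real.cos (2 * (π * |t|)) := by
      rw [← Real.cos_abs, abs_mul, abs_of_pos (by positivity : 0 < 2 * π)]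
      ring_nf
    rw [h1, Real.cos_two_mul, Real.sin_sq]
    ring
  rw [hc]
  have h2 : (2 * δ * |t|) ^ 2 ≤ Real.sin (π * |t|) ^ 2 := by gcongr
  have h3 : 4 * δ ^ 2 / π ^ 2 * (2 * π * t) ^ 2 = 4 * (2 * δ * |t|) ^ 2 := by
    rw [mul_pow (2 * δ) |t|, sq_abs]
    field_simp
  rw [h3]
  linarith

lemma mul_contSymbol_le_discSymbol (hh : 0 < h) {δ : ℝ} (hδ : 0 < δ) (hδ2 : δ ≤ 1 / 2)
    {ξ : Euc d} (hξ : ∀ j, |h * ξ j| ≤ 1 - δ) :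
    4 * δ ^ 2 / π ^ 2 * contSymbol ξ ≤ discSymbol h ξ := by
  rw [contSymbol_eq hh, discSymbol, mul_left_comm, Finset.mul_sum]
  gcongr with j
  exact mul_sq_le_two_sub_cos hδ hδ2 (hξ j)

/-- Consistency of the discrete and the continuous symbol. -/
lemma abs_symbol_sub_div_le (hh : 0 < h) {δ : ℝ} (hδ : 0 < δ) (hδ2 : δ ≤ 1 / 2)
    {ξ : Euc d} (hξ : ∀ j, |h * ξ j| ≤ 1 - δ) :
    |(contSymbol ξ - discSymbol h ξ) / (1 + discSymbol h ξ)| ≤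
      π ^ 2 / (4 * δ ^ 2) * h ^ 2 * (1 + contSymbol ξ) := by
  have hs := discSymbol_nonneg (h := h) ξ
  have ha := contSymbol_nonneg ξ
  rw [abs_div, abs_of_pos (by linarith : 0 < 1 + discSymbol h ξ), div_le_iff₀ (by linarith)]
  refine (abs_contSymbol_sub_discSymbol_le hh ξ).trans ?_
  set κ := 4 * δ ^ 2 / π ^ 2 with hκ
  have hκ0 : 0 < κ := by positivity
  have hκ1 : κ ≤ 1 := by
    rw [hκ, div_le_one (by positivity)]
    nlinarith [Real.pi_gt_three]
  have e : π ^ 2 / (4 * δ ^ 2) = κ⁻¹ := by rw [hκ, inv_div]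
  rw [e]
  have h1 : κ * (1 + contSymbol ξ) ≤ 1 + discSymbol h ξ := by
    linarith [mul_contSymbol_le_discSymbol hh hδ hδ2 hξ]
  calc h ^ 2 * contSymbol ξ ^ 2 ≤ h ^ 2 * (1 + contSymbol ξ) ^ 2 := by gcongr; linarith
    _ = κ⁻¹ * h ^ 2 * (1 + contSymbol ξ) * (κ * (1 + contSymbol ξ)) := by field_simp
    _ ≤ _ := by gcongr

end Symbols

section DiscreteLaplacian

variable {d : ℕ} {h : ℝ}

/-- The discrete Laplacian `H_{0,h}` acting on functions. -/
def discLap (h : ℝ) (v : Zd d → ℂ) (z : Zd d) : ℂ :=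
  (h ^ 2 : ℂ)⁻¹ * ∑ j : Fin d, (2 * v z - v (z + Pi.single j 1) - v (z - Pi.single j 1))

lemma discAct_eq (V : Euc d → ℝ) (v : Zd d → ℂ) (z : Zd d) :
    discAct d h V v z = discLap h v z + V (latPt d h z) * v z := rfl

lemma planeWave_latPt_add (z n : Zd d) (ξ : Euc d) :
    planeWave (latPt d h (z + n)) ξ = planeWave (latPt d h z) ξ * planeWave (latPt d h n) ξ := by
  have : latPt d h (z + n) = latPt d h z + latPt d h n := by
    ext j
    simp [latPt_apply, mul_add]
  unfold planeWave
  rw [← Complex.exp_add, this, inner_add_left]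
  congr 1
  push_cast
  ring

lemma planeWave_latPt_single (j : Fin d) (ξ : Euc d) (s : ℤ) :
    planeWave (latPt d h (Pi.single j s)) ξ = cexp ((2 * π * (h * ξ j) * s : ℝ) * I) := by
  have : ⟪latPt d h (Pi.single j s), ξ⟫_ℝ = s * (h * ξ j) := by
    rw [PiLp.inner_apply, Finset.sum_eq_single j]
    · simp [latPt_apply]; ring
    · intro i _ hi
      simp [latPt_apply, hi]
    · simp
  unfold planeWave
  rw [this]
  congr 1
  push_cast
  ring

lemma discLap_integral_planeWave {B : Euc d → ℂ} (hB : Integrable B) (z : Zd d) :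
    discLap h (fun z => ∫ ξ, planeWave (latPt d h z) ξ * B ξ) z =
      ∫ ξ, planeWave (latPt d h z) ξ * (discSymbol h ξ * B ξ) := by
  have hInt : ∀ z, Integrable fun ξ => planeWave (latPt d h z) ξ * B ξ := fun z =>
    hB.bdd_mul (continuous_planeWave _).aestronglyMeasurable
      (Filter.Eventually.of_forall fun ξ => (norm_planeWave _ ξ).le)
  have h2 : ∀ z z', Integrable fun ξ =>
      2 * (planeWave (latPt d h z) ξ * B ξ) - planeWave (latPt d h z') ξ * B ξ :=
    fun z z' => ((hInt z).const_mul 2).sub (hInt z')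
  have h3 : ∀ z z' z'', Integrable fun ξ => 2 * (planeWave (latPt d h z) ξ * B ξ) -
      planeWave (latPt d h z') ξ * B ξ - planeWave (latPt d h z'') ξ * B ξ :=
    fun z z' z'' => (h2 z z').sub (hInt z'')
  unfold discLap
  simp only [← integral_const_mul]
  have e : ∀ j : Fin d, (∫ ξ, 2 * (planeWave (latPt d h z) ξ * B ξ)) -
      (∫ ξ, planeWave (latPt d h (z + Pi.single j 1)) ξ * B ξ) -
      (∫ ξ, planeWave (latPt d h (z - Pi.single j 1)) ξ * B ξ) =
      ∫ ξ, (2 * (planeWave (latPt d h z) ξ * B ξ) -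
        planeWave (latPt d h (z + Pi.single j 1)) ξ * B ξ -
        planeWave (latPt d h (z - Pi.single j 1)) ξ * B ξ) := fun j => by
    rw [integral_sub (h2 _ _) (hInt _),
      integral_sub ((hInt z).const_mul 2) (hInt _)]
  simp only [e]
  rw [← integral_finsetSum _ fun j _ => h3 _ _ _,
    ← integral_const_mul]
  refine integral_congr_ae (Filter.Eventually.of_forall fun ξ => ?_)
  have e2 : ∀ j : Fin d, 2 * (planeWave (latPt d h z) ξ * B ξ) -
        planeWave (latPt d h (z + Pi.single j 1)) ξ * B ξ -
        planeWave (latPt d h (z - Pi.single j 1)) ξ * B ξ =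
      (planeWave (latPt d h z) ξ * B ξ) * ((2 - 2 * Real.cos (2 * π * (h * ξ j)) : ℝ) : ℂ) := by
    intro j
    rw [sub_eq_add_neg z, ← Pi.single_neg, planeWave_latPt_add, planeWave_latPt_add,
      planeWave_latPt_single, planeWave_latPt_single]
    push_cast
    rw [Complex.cos]
    simp only [mul_one, mul_neg, neg_mul]
    ring
  simp only [e2, discSymbol]
  rw [← Finset.mul_sum]
  push_cast
  ring

end DiscreteLaplacian

section FiniteLattice

variable {d : ℕ} {h : ℝ}

/-- The discrete Laplacian of a finitely supported function. -/
def discLapFin (h : ℝ) (g : Zd d →₀ ℂ) : Zd d →₀ ℂ :=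
  Finsupp.ofSupportFinite (discLap h g) <| by
    have hf : Set.Finite (⋃ j : Fin d, ((g.support : Set (Zd d)) ∪
        ((fun z => z - Pi.single j 1) '' (g.support : Set (Zd d))) ∪
        ((fun z => z + Pi.single j 1) '' (g.support : Set (Zd d))))) :=
      Set.finite_iUnion fun j => ((g.support.finite_toSet).union
        ((g.support.finite_toSet).image _)).union ((g.support.finite_toSet).image _)
    refine hf.subset fun z hz => ?_
    by_contra hc
    simp only [Set.mem_iUnion, not_exists, Set.mem_union, not_or, Set.mem_image, Finset.mem_coe,
      not_and] at hc
    refine hz ?_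
    unfold discLap
    rw [Finset.sum_eq_zero, mul_zero]
    intro j _
    obtain ⟨⟨h1, h2⟩, h3⟩ := hc j
    have e1 : g z = 0 := Finsupp.notMem_support_iff.1 h1
    have e2 : g (z + Pi.single j 1) = 0 := by
      by_contra hne
      exact h2 _ (Finsupp.mem_support_iff.2 hne) (by simp)
    have e3 : g (z - Pi.single j 1) = 0 := by
      by_contra hne
      exact h3 _ (Finsupp.mem_support_iff.2 hne) (by simp)
    simp [e1, e2, e3]

lemma discLapFin_apply (g : Zd d →₀ ℂ) (z : Zd d) : discLapFin h g z = discLap h g z := rfl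

/-- Pointwise multiplication of a finitely supported function by an arbitrary function. -/
def mulFin (w : Zd d → ℂ) (g : Zd d →₀ ℂ) : Zd d →₀ ℂ :=
  Finsupp.ofSupportFinite (fun z => w z * g z) <| by
    refine g.hasFiniteSupport.subset fun z hz => ?_
    simp only [Function.mem_support] at hz ⊢
    exact right_ne_zero_of_mul hz

lemma mulFin_apply (w : Zd d → ℂ) (g : Zd d →₀ ℂ) (z : Zd d) : mulFin w g z = w z * g z := rfl

lemma summable_conj_mul (g : Zd d →₀ ℂ) (v : Zd d → ℂ) : Summable fun z => conj (g z) * v z := by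
  refine (hasSum_sum_of_ne_finset_zero (s := g.support) fun z hz => ?_).summable
  simp [Finsupp.notMem_support_iff.1 hz]

lemma inner_finLat_tsum (hh : 0 < h) (g : Zd d →₀ ℂ) (v : l2h d h) :
    ⟪finLat hh g, v⟫_ℂ = (h ^ d : ℂ) * ∑' z, conj (g z) * v z := by
  rw [inner_finLat, tsum_eq_sum]
  intro z hz
  simp [Finsupp.notMem_support_iff.1 hz]

lemma tsum_conj_discLapFin_mul (g : Zd d →₀ ℂ) (v : Zd d → ℂ) :
    ∑' z, conj (discLapFin h g z) * v z = ∑' z, conj (g z) * discLap h v z := by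
  have s0 := summable_conj_mul g v
  have s1 : ∀ n : Zd d, Summable fun z => conj (g z) * v (z + n) := fun n =>
    summable_conj_mul g _
  have s2 : ∀ n : Zd d, Summable fun z => conj (g (z + n)) * v z := fun n => by
    have := (Equiv.addRight n).summable_iff.2 (s1 (-n))
    refine this.congr fun z => ?_
    simp
  have e2 : ∀ n : Zd d, ∑' z, conj (g (z + n)) * v z = ∑' z, conj (g z) * v (z + -n) :=
    fun n => by
    rw [← (Equiv.addRight n).tsum_eq fun z => conj (g z) * v (z + -n)]
    simp
  have L : ∀ z, conj (discLapFin h g z) * v z = (h ^ 2 : ℂ)⁻¹ * ∑ j : Fin d,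
      (2 * (conj (g z) * v z) - conj (g (z + Pi.single j 1)) * v z -
        conj (g (z + -Pi.single j 1)) * v z) := fun z => by
    rw [discLapFin_apply, discLap, map_mul, map_sum, mul_assoc, Finset.sum_mul]
    congr 1
    · simp
    · refine Finset.sum_congr rfl fun j _ => ?_
      simp only [map_sub, map_mul, map_ofNat, sub_eq_add_neg z]
      ring
  have R : ∀ z, conj (g z) * discLap h v z = (h ^ 2 : ℂ)⁻¹ * ∑ j : Fin d,
      (2 * (conj (g z) * v z) - conj (g z) * v (z + Pi.single j 1) -
        conj (g z) * v (z + -Pi.single j 1)) := fun z => by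
    rw [discLap, mul_left_comm, Finset.mul_sum]
    congr 1
    refine Finset.sum_congr rfl fun j _ => ?_
    simp only [sub_eq_add_neg z]
    ring
  simp only [L, R]
  rw [tsum_mul_left, tsum_mul_left]
  congr 1
  rw [Summable.tsum_finsetSum fun j _ => ((s0.mul_left 2).sub (s2 _)).sub (s2 _),
    Summable.tsum_finsetSum fun j _ => ((s0.mul_left 2).sub (s1 _)).sub (s1 _)]
  refine Finset.sum_congr rfl fun j _ => ?_
  rw [((s0.mul_left 2).sub (s2 _)).tsum_sub (s2 _), (s0.mul_left 2).tsum_sub (s2 _),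
    ((s0.mul_left 2).sub (s1 _)).tsum_sub (s1 _), (s0.mul_left 2).tsum_sub (s1 _), e2, e2, neg_neg]
  ring

lemma inner_finLat_discLapFin (hh : 0 < h) (g : Zd d →₀ ℂ) (v : l2h d h) :
    ⟪finLat hh (discLapFin h g), v⟫_ℂ = (h ^ d : ℂ) * ∑' z, conj (g z) * discLap h v z := by
  rw [inner_finLat_tsum, tsum_conj_discLapFin_mul]

end FiniteLattice

section Projection

variable {d : ℕ} {h : ℝ}

open LineDeriv in
/-- `-Δ` on Schwartz functions. -/
def negLap (u : SchwartzMap (Euc d) ℂ) : SchwartzMap (Euc d) ℂ :=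
  -∑ j : Fin d, lineDerivOp (EuclideanSpace.single j (1 : ℝ))
    (lineDerivOp (EuclideanSpace.single j (1 : ℝ)) u)

lemma negLap_apply (u : SchwartzMap (Euc d) ℂ) (x : Euc d) : negLap u x = -lapl d u x := by
  unfold negLap lapl
  rw [_root_.neg_apply, _root_.sum_apply]
  simp only [SchwartzMap.lineDerivOp_apply_eq_fderiv]
  rfl

lemma fourier_negLap (u : SchwartzMap (Euc d) ℂ) (ξ : Euc d) :
    𝓕 (negLap u) ξ = contSymbol ξ * 𝓕 u ξ := by
  have key : ∀ (m : Euc d) (f : SchwartzMap (Euc d) ℂ) (ξ : Euc d),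
      𝓕 (LineDeriv.lineDerivOp m f : SchwartzMap (Euc d) ℂ) ξ =
        (2 * π * I) * ((⟪ξ, m⟫_ℝ : ℝ) * 𝓕 f ξ) := fun m f ξ => by
    have : (inner ℝ · m : Euc d → ℝ).HasTemperateGrowth :=
      ((innerSL ℝ).flip m).hasTemperateGrowth
    rw [SchwartzMap.fourier_lineDerivOp_eq]
    simp [this]
  unfold negLap
  have e : 𝓕 (-∑ j : Fin d, LineDeriv.lineDerivOp (EuclideanSpace.single j (1 : ℝ))
      (LineDeriv.lineDerivOp (EuclideanSpace.single j (1 : ℝ)) u)) =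
      -∑ j : Fin d, 𝓕 (LineDeriv.lineDerivOp (EuclideanSpace.single j (1 : ℝ))
      (LineDeriv.lineDerivOp (EuclideanSpace.single j (1 : ℝ)) u) : SchwartzMap (Euc d) ℂ) := by
    simp only [← SchwartzMap.fourierTransformCLM_apply (𝕜 := ℂ), map_neg, map_sum]
  rw [e, _root_.neg_apply, _root_.sum_apply]
  simp only [key]
  rw [contSymbol, EuclideanSpace.real_norm_sq_eq]
  push_cast
  rw [Finset.mul_sum, Finset.sum_mul, ← Finset.sum_neg_distrib]
  refine Finset.sum_congr rfl fun j _ => ?_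
  have : ⟪ξ, EuclideanSpace.single j (1 : ℝ)⟫_ℝ = ξ j := by
    simp [EuclideanSpace.inner_single_right]
  rw [this]
  linear_combination -(4 * π ^ 2 * ξ j ^ 2 * 𝓕 u ξ : ℂ) * Complex.I_sq

variable {φ : SchwartzMap (Euc d) ℂ} {Ph : L2 d →L[ℂ] l2h d h} {δ : ℝ}

lemma norm_sq_toLp_schwartz (u : SchwartzMap (Euc d) ℂ) :
    ‖(u.toLp 2 volume : L2 d)‖ ^ 2 = ∫ x, ‖u x‖ ^ 2 := by
  have h1 := SchwartzMap.inner_toL2_toL2_eq u u (μ := (volume : Measure (Euc d)))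
  rw [inner_self_eq_norm_sq_to_K] at h1
  have h2 : ∀ x, ⟪u x, u x⟫_ℂ = ((‖u x‖ ^ 2 : ℝ) : ℂ) := fun x => by
    rw [inner_self_eq_norm_sq_to_K]; norm_cast
  simp only [h2] at h1
  rw [integral_complex_ofReal, RCLike.ofReal_eq_complex_ofReal] at h1
  exact_mod_cast h1

lemma IsProjOp.apply_schwartz (hP : IsProjOp d h φ Ph) (hh : 0 < h)
    (u : SchwartzMap (Euc d) ℂ) (z : Zd d) :
    Ph (u.toLp 2 volume) z =
      ∫ ξ, planeWave (latPt d h z) ξ * (conj (𝓕 ⇑φ (h • ξ)) * 𝓕 u ξ) := by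
  rw [hP, ← integral_conj_rescale_mul φ u hh]
  congr 1
  refine integral_congr_ae ?_
  filter_upwards [u.coeFn_toLp 2 volume] with x hx
  rw [hx]

lemma IsProjOp.norm_sq_schwartz (hP : IsProjOp d h φ Ph) (hψ : IsSamplingSymbol (𝓕 ⇑φ) δ)
    (hh : 0 < h) (u : SchwartzMap (Euc d) ℂ) :
    ‖Ph (u.toLp 2 volume)‖ ^ 2 ≤ ‖(u.toLp 2 volume : L2 d)‖ ^ 2 ∧
      ∫ ξ in {ξ | ∀ j, |h * ξ j| < δ}, ‖𝓕 u ξ‖ ^ 2 ≤ ‖Ph (u.toLp 2 volume)‖ ^ 2 := by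
  obtain ⟨s, hs, h1, h2⟩ := hψ.hasSum_sq hh (U := ⇑(𝓕 u : SchwartzMap (Euc d) ℂ))
    (SchwartzMap.continuous _).measurable (SchwartzMap.memLp (𝓕 u : SchwartzMap (Euc d) ℂ) 2 volume)
  have h3 := hasSum_norm_sq_latMeas hh (Ph (u.toLp 2 volume))
  simp only [hP.apply_schwartz hh] at h3
  rw [h3.unique hs, norm_sq_toLp_schwartz, ← SchwartzMap.integral_norm_sq_fourier]
  exact ⟨h1, h2⟩

lemma IsProjOp.norm_apply_le (hP : IsProjOp d h φ Ph) (hψ : IsSamplingSymbol (𝓕 ⇑φ) δ)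
    (hh : 0 < h) (v : L2 d) : ‖Ph v‖ ≤ ‖v‖ := by
  have hd : DenseRange (SchwartzMap.toLpCLM ℝ ℂ 2 (volume : Measure (Euc d))) :=
    SchwartzMap.denseRange_toLpCLM (by simp)
  refine hd.induction_on (p := fun v => ‖Ph v‖ ≤ ‖v‖) v
    (isClosed_le (by fun_prop) continuous_norm) fun u => ?_
  exact (sq_le_sq₀ (norm_nonneg _) (norm_nonneg _)).1 (hP.norm_sq_schwartz hψ hh u).1

lemma IsProjOp.norm_adjoint_apply_le (hP : IsProjOp d h φ Ph) (hψ : IsSamplingSymbol (𝓕 ⇑φ) δ)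
    (hh : 0 < h) (v : l2h d h) : ‖ContinuousLinearMap.adjoint Ph v‖ ≤ ‖v‖ := by
  have h1 : ‖ContinuousLinearMap.adjoint Ph‖ ≤ 1 := by
    rw [LinearIsometryEquiv.norm_map]
    exact Ph.opNorm_le_bound zero_le_one fun v => by simpa using hP.norm_apply_le hψ hh v
  simpa using (ContinuousLinearMap.adjoint Ph).le_of_opNorm_le h1 v

/-- Low-frequency functions are almost reproduced by `Ph* Ph`. -/
lemma IsProjOp.norm_adjoint_comp_sub_le (hP : IsProjOp d h φ Ph)
    (hψ : IsSamplingSymbol (𝓕 ⇑φ) δ) (hh : 0 < h) (u : SchwartzMap (Euc d) ℂ) :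
    ‖ContinuousLinearMap.adjoint Ph (Ph (u.toLp 2 volume)) - u.toLp 2 volume‖ ≤
      h ^ 2 / (4 * π ^ 2 * δ ^ 2) * ‖((negLap u).toLp 2 volume : L2 d)‖ := by
  set x : L2 d := u.toLp 2 volume
  have hδ := hψ.pos
  set A : Set (Euc d) := {ξ | ∀ j, |h * ξ j| < δ}
  have hA : MeasurableSet A := by
    rw [show A = _ from Set.ofPred_forall _]
    exact MeasurableSet.iInter fun j => measurableSet_lt (by fun_prop) (by fun_prop)
  have hInt : Integrable fun ξ => ‖𝓕 u ξ‖ ^ 2 := ((𝓕 u).memLp 2).integrable_norm_pow (by simp)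
  have hint2 : Integrable fun ξ => ‖𝓕 (negLap u) ξ‖ ^ 2 :=
    ((𝓕 (negLap u)).memLp 2).integrable_norm_pow (by simp)
  have h1 : ‖ContinuousLinearMap.adjoint Ph (Ph x) - x‖ ^ 2 ≤ ‖x‖ ^ 2 - ‖Ph x‖ ^ 2 := by
    rw [@norm_sub_sq ℂ, ContinuousLinearMap.adjoint_inner_left, inner_self_eq_norm_sq_to_K]
    have h2 := hP.norm_adjoint_apply_le hψ hh (Ph x)
    have h3 : ‖ContinuousLinearMap.adjoint Ph (Ph x)‖ ^ 2 ≤ ‖Ph x‖ ^ 2 := by gcongr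
    have h4 : RCLike.re ((‖Ph x‖ : ℂ) ^ 2) = ‖Ph x‖ ^ 2 := by norm_cast
    simp only [RCLike.ofReal_eq_complex_ofReal, h4]
    linarith
  have h2 : ‖x‖ ^ 2 - ‖Ph x‖ ^ 2 ≤ ∫ ξ in Aᶜ, ‖𝓕 u ξ‖ ^ 2 := by
    have := integral_add_compl hA hInt
    rw [SchwartzMap.integral_norm_sq_fourier, ← norm_sq_toLp_schwartz] at this
    linarith [(hP.norm_sq_schwartz hψ hh u).2]
  have h3 : ∫ ξ in Aᶜ, ‖𝓕 u ξ‖ ^ 2 ≤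
      ∫ ξ in Aᶜ, (h ^ 2 / (4 * π ^ 2 * δ ^ 2)) ^ 2 * ‖𝓕 (negLap u) ξ‖ ^ 2 := by
    refine setIntegral_mono_on hInt.integrableOn (hint2.const_mul _).integrableOn hA.compl
      fun ξ hξ => ?_
    obtain ⟨j, hj⟩ : ∃ j, δ ≤ |h * ξ j| := by
      by_contra hc
      push Not at hc
      exact hξ hc
    rw [fourier_negLap, norm_mul, ← mul_pow, ← mul_assoc]
    refine pow_le_pow_left₀ (norm_nonneg _) (le_mul_of_one_le_left (norm_nonneg _) ?_) 2
    rw [Complex.norm_real, Real.norm_of_nonneg (contSymbol_nonneg _), contSymbol]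
    have h5 : |ξ j| ≤ ‖ξ‖ := PiLp.norm_apply_le ξ j
    have h6 : δ ≤ h * ‖ξ‖ := by
      rw [abs_mul, abs_of_pos hh] at hj
      nlinarith
    rw [div_mul_eq_mul_div, le_div_iff₀ (by positivity)]
    have h7 : δ ^ 2 ≤ (h * ‖ξ‖) ^ 2 := by gcongr
    have := Real.pi_pos
    nlinarith [sq_nonneg π, mul_le_mul_of_nonneg_left h7 (by positivity : 0 ≤ 4 * π ^ 2)]
  have h4 : ∫ ξ in Aᶜ, (h ^ 2 / (4 * π ^ 2 * δ ^ 2)) ^ 2 * ‖𝓕 (negLap u) ξ‖ ^ 2 ≤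
      (h ^ 2 / (4 * π ^ 2 * δ ^ 2) * ‖((negLap u).toLp 2 volume : L2 d)‖) ^ 2 := by
    rw [mul_pow, norm_sq_toLp_schwartz, ← SchwartzMap.integral_norm_sq_fourier,
      ← integral_const_mul]
    exact setIntegral_le_integral (hint2.const_mul _)
      (Filter.Eventually.of_forall fun ξ => by positivity)
  exact (sq_le_sq₀ (norm_nonneg _) (by positivity)).1
    (h1.trans (h2.trans (h3.trans h4)))

/-- Consistency of the discrete and the continuous Laplacian in weak form. -/
lemma IsProjOp.norm_inner_laplacian_sub_le (hP : IsProjOp d h φ Ph)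
    (hψ : IsSamplingSymbol (𝓕 ⇑φ) δ) (hh : 0 < h) (u : SchwartzMap (Euc d) ℂ) (g : Zd d →₀ ℂ) :
    ‖⟪finLat hh g, Ph ((negLap u).toLp 2 volume)⟫_ℂ -
        ⟪finLat hh (discLapFin h g), Ph (u.toLp 2 volume)⟫_ℂ‖ ≤
      π ^ 2 / (4 * δ ^ 2) * h ^ 2 * ‖finLat hh (g + discLapFin h g)‖ *
        ‖(u.toLp 2 volume + (negLap u).toLp 2 volume : L2 d)‖ := by
  set ψ := 𝓕 ⇑φ
  set C := π ^ 2 / (4 * δ ^ 2) * h ^ 2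
  have hC : 0 ≤ C := by positivity
  set A : Set (Euc d) := {ξ | ∀ j, |h * ξ j| ≤ 1 - δ}
  have hA : MeasurableSet A := by
    rw [show A = _ from Set.ofPred_forall _]
    exact MeasurableSet.iInter fun j => measurableSet_le (by fun_prop) (by fun_prop)
  set U : Euc d → ℂ := ⇑(𝓕 u : SchwartzMap (Euc d) ℂ)
  set W : Euc d → ℂ := ⇑(𝓕 (u + negLap u) : SchwartzMap (Euc d) ℂ)
  have hW : ∀ ξ, W ξ = (1 + contSymbol ξ) * U ξ := fun ξ => by
    have e : 𝓕 (u + negLap u) = 𝓕 u + 𝓕 (negLap u) := by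
      simp only [← SchwartzMap.fourierTransformCLM_apply (𝕜 := ℂ), map_add]
    change 𝓕 (u + negLap u) ξ = _
    rw [e, _root_.add_apply, fourier_negLap, one_add_mul]
  have hW2 : MemLp W 2 := (𝓕 (u + negLap u)).memLp 2
  set Y : Euc d → ℂ := A.indicator fun ξ =>
    (((contSymbol ξ - discSymbol h ξ) / (1 + discSymbol h ξ) : ℝ) : ℂ) * U ξ
  have hYm : Measurable Y := by
    refine Measurable.indicator ?_ hA
    refine Measurable.mul (Complex.measurable_ofReal.comp ?_) (𝓕 u).continuous.measurable
    exact (continuous_contSymbol.measurable.sub continuous_discSymbol.measurable).div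
      (measurable_const.add continuous_discSymbol.measurable)
  have hYW : ∀ ξ, ‖Y ξ‖ ≤ C * ‖W ξ‖ := fun ξ => by
    by_cases hξ : ξ ∈ A
    · have e0 : Y ξ = (((contSymbol ξ - discSymbol h ξ) / (1 + discSymbol h ξ) : ℝ) : ℂ) * U ξ :=
        Set.indicator_of_mem hξ _
      rw [e0, norm_mul, Complex.norm_real, Real.norm_eq_abs, hW, norm_mul,
        ← mul_assoc]
      have e : ‖(1 + contSymbol ξ : ℂ)‖ = 1 + contSymbol ξ := by
        rw [← Complex.ofReal_one, ← Complex.ofReal_add, Complex.norm_real,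
          Real.norm_of_nonneg (by linarith [contSymbol_nonneg ξ])]
      rw [e]
      gcongr
      exact abs_symbol_sub_div_le hh hψ.pos hψ.le_half hξ
    · have e0 : Y ξ = 0 := Set.indicator_of_notMem hξ _
      rw [e0, norm_zero]
      positivity
  have hY2 : MemLp Y 2 := hW2.of_le_mul hYm.aestronglyMeasurable
    (Filter.Eventually.of_forall hYW)
  have hψL : MemLp (fun ξ => conj (ψ (h • ξ))) 2 := by
    have : MemLp (fun ξ => rescale (𝓕 φ) (inv_ne_zero hh.ne') 0 ξ) 2 :=
      SchwartzMap.memLp (rescale (𝓕 φ) (inv_ne_zero hh.ne') 0) 2 volume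
    have := this.star
    refine this.ae_eq (Filter.Eventually.of_forall fun ξ => ?_)
    simp [rescale_apply, ψ, SchwartzMap.fourier_coe]
  have hB : ∀ {G : Euc d → ℂ}, MemLp G 2 → Integrable fun ξ => conj (ψ (h • ξ)) * G ξ :=
    fun hG => hψL.integrable_mul hG
  have key : ∀ z, ∫ ξ, planeWave (latPt d h z) ξ * (conj (ψ (h • ξ)) * 𝓕 (negLap u) ξ) =
      discLap h (fun z => ∫ ξ, planeWave (latPt d h z) ξ * (conj (ψ (h • ξ)) * U ξ)) z +
      ((∫ ξ, planeWave (latPt d h z) ξ * (conj (ψ (h • ξ)) * Y ξ)) +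
      discLap h (fun z => ∫ ξ, planeWave (latPt d h z) ξ * (conj (ψ (h • ξ)) * Y ξ)) z) := by
    intro z
    have hpw : ∀ {G : Euc d → ℂ}, Integrable G →
        Integrable fun ξ => planeWave (latPt d h z) ξ * G ξ := fun hG =>
      hG.bdd_mul (continuous_planeWave _).aestronglyMeasurable
        (Filter.Eventually.of_forall fun ξ => (norm_planeWave _ ξ).le)
    have hds : ∀ {G : Euc d → ℂ}, Integrable G →
        Integrable fun ξ => (discSymbol h ξ : ℂ) * G ξ := fun hG =>
      hG.bdd_mul (c := (h ^ 2)⁻¹ * (4 * d))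
        (Complex.continuous_ofReal.comp continuous_discSymbol).aestronglyMeasurable
        (Filter.Eventually.of_forall fun ξ => by
          rw [Complex.norm_real, Real.norm_of_nonneg (discSymbol_nonneg _)]
          exact discSymbol_le ξ)
    have h12 : Integrable fun ξ => planeWave (latPt d h z) ξ * (conj (ψ (h • ξ)) * Y ξ) +
        planeWave (latPt d h z) ξ * (discSymbol h ξ * (conj (ψ (h • ξ)) * Y ξ)) :=
      (hpw (hB hY2)).add (hpw (hds (hB hY2)))
    rw [discLap_integral_planeWave (hB ((𝓕 u).memLp 2)), discLap_integral_planeWave (hB hY2),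
      ← integral_add (hpw (hB hY2)) (hpw (hds (hB hY2))),
      ← integral_add (hpw (hds (hB ((𝓕 u).memLp 2)))) h12]
    refine integral_congr_ae (Filter.Eventually.of_forall fun ξ => ?_)
    simp only [fourier_negLap]
    by_cases h0 : ψ (h • ξ) = 0
    · simp [h0]
    · have hξ : ξ ∈ A := fun j => by simpa using hψ.support_le _ h0 j
      have hs : (1 + discSymbol h ξ : ℂ) ≠ 0 := by
        have := discSymbol_nonneg (h := h) ξ
        exact_mod_cast (by linarith : (1 + discSymbol h ξ : ℝ) ≠ 0)
      simp only [Y, Set.indicator_of_mem hξ]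
      push_cast
      field_simp
      ring
  obtain ⟨s, hs, h1, -⟩ := hψ.hasSum_sq hh hYm hY2
  have hy : MemLp (fun z : Zd d => ∫ ξ, planeWave (latPt d h z) ξ * (conj (ψ (h • ξ)) * Y ξ)) 2
      (latMeas d h) := by
    rw [memLp_latMeas_iff hh]
    refine (hs.summable.mul_left (h ^ d)⁻¹).congr fun z => ?_
    have := pow_pos hh d
    field_simp
  set y : l2h d h := hy.toLp _
  have hyz : ∀ z, y z = ∫ ξ, planeWave (latPt d h z) ξ * (conj (ψ (h • ξ)) * Y ξ) := fun z =>
    congrFun (coeFn_toLp_latMeas hh hy) z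
  have e1 : ⟪finLat hh g, Ph ((negLap u).toLp 2 volume)⟫_ℂ -
      ⟪finLat hh (discLapFin h g), Ph (u.toLp 2 volume)⟫_ℂ = ⟪finLat hh (g + discLapFin h g), y⟫_ℂ := by
    rw [finLat_add, inner_add_left, inner_finLat_discLapFin, inner_finLat_discLapFin,
      inner_finLat_tsum, inner_finLat_tsum, ← mul_sub, ← mul_add]
    congr 1
    rw [← (summable_conj_mul g _).tsum_sub (summable_conj_mul g _),
      ← (summable_conj_mul g _).tsum_add (summable_conj_mul g _)]
    refine tsum_congr fun z => ?_
    rw [← mul_sub, ← mul_add]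
    congr 1
    rw [show ⇑(Ph (u.toLp 2 volume)) = _ from funext (hP.apply_schwartz hh u),
      show ⇑y = _ from funext hyz, hP.apply_schwartz hh, key]
    ring
  rw [e1]
  refine (norm_inner_le_norm _ _).trans ?_
  rw [mul_right_comm, mul_comm]
  gcongr
  have e2 : (u.toLp 2 volume + (negLap u).toLp 2 volume : L2 d) = (u + negLap u).toLp 2 volume := by
    simp only [← SchwartzMap.toLpCLM_apply (𝕜 := ℂ), map_add]
  rw [e2]
  refine (sq_le_sq₀ (norm_nonneg _) (by positivity)).1 ?_
  have h3 := hasSum_norm_sq_latMeas hh y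
  simp only [hyz] at h3
  rw [h3.unique hs, mul_pow, norm_sq_toLp_schwartz, ← SchwartzMap.integral_norm_sq_fourier]
  refine h1.trans ?_
  rw [← integral_const_mul]
  refine integral_mono (hY2.integrable_norm_pow (by simp))
    ((hW2.integrable_norm_pow (by simp)).const_mul _) fun ξ => ?_
  simp only
  rw [← mul_pow]
  exact pow_le_pow_left₀ (norm_nonneg _) (hYW ξ) 2

end Projection

section APriori

/-- The constant in the abstract graph norm estimate `norm_le_graphConst_mul`. -/
def graphConst (c C : ℝ) (ν : ℂ) : ℝ :=
  2 + c ^ 2 + c ^ 2 * (C + ‖ν‖) * (|ν.im|⁻¹ + ‖ν‖ * |ν.im|⁻¹ ^ 2) + (‖ν‖ + 1) * |ν.im|⁻¹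

lemma graphConst_pos {c C : ℝ} (hC : 0 ≤ C) (ν : ℂ) : 0 < graphConst c C ν := by
  unfold graphConst
  positivity

/-- Separation of kinetic term `y` and potential term `w` in `k = y + w - ν x`, given a multiplier
`q` whose pairing with the kinetic term is bounded below. -/
lemma norm_le_graphConst_mul {E : Type*} [NormedAddCommGroup E] [InnerProductSpace ℂ E]
    {c C : ℝ} (hc : 1 ≤ c) (hC : 0 ≤ C) {ν : ℂ} (hν : ν.im ≠ 0) {x y w q : E}
    (hxy : (⟪x, y⟫_ℂ).im = 0) (hxy' : 0 ≤ (⟪x, y⟫_ℂ).re)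
    (hqy : -(C * (⟪q, x⟫_ℂ).re) ≤ (⟪q, y⟫_ℂ).re)
    (hxw : (⟪x, w⟫_ℂ).im = 0)
    (hqw : c⁻¹ * ‖w‖ ^ 2 ≤ (⟪q, w⟫_ℂ).re) (hq : ‖q‖ ≤ c * ‖w‖)
    (hqx : (⟪q, x⟫_ℂ).im = 0) (hqx' : 0 ≤ (⟪q, x⟫_ℂ).re)
    (hqxw : (⟪q, x⟫_ℂ).re ≤ c * (⟪x, w⟫_ℂ).re) :
    ‖x‖ ≤ graphConst c C ν * ‖y + w - ν • x‖ ∧ ‖y‖ ≤ graphConst c C ν * ‖y + w - ν • x‖ ∧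
      ‖w‖ ≤ graphConst c C ν * ‖y + w - ν • x‖ := by
  set k := y + w - ν • x with hk
  set a := |ν.im|⁻¹ with ha
  have ha0 : 0 < a := by positivity
  set N := ‖ν‖
  have hN : 0 ≤ N := norm_nonneg _
  have hre : |ν.re| ≤ N := Complex.abs_re_le_norm ν
  have hxx : ⟪x, x⟫_ℂ = ((‖x‖ ^ 2 : ℝ) : ℂ) := by
    rw [inner_self_eq_norm_sq_to_K]; norm_cast
  have hxk : ⟪x, k⟫_ℂ = ⟪x, y⟫_ℂ + ⟪x, w⟫_ℂ - ν * ((‖x‖ ^ 2 : ℝ) : ℂ) := by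
    rw [hk, inner_sub_right, inner_add_right, inner_smul_right, hxx]
  have hqk : ⟪q, k⟫_ℂ = ⟪q, y⟫_ℂ + ⟪q, w⟫_ℂ - ν * ⟪q, x⟫_ℂ := by
    rw [hk, inner_sub_right, inner_add_right, inner_smul_right]
  have hxk_le : ‖⟪x, k⟫_ℂ‖ ≤ ‖x‖ * ‖k‖ := norm_inner_le_norm _ _
  have hqk_le : ‖⟪q, k⟫_ℂ‖ ≤ ‖q‖ * ‖k‖ := norm_inner_le_norm _ _
  have hx : ‖x‖ ≤ a * ‖k‖ := by
    have h1 : (⟪x, k⟫_ℂ).im = -(ν.im * ‖x‖ ^ 2) := by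
      rw [hxk, Complex.sub_im, Complex.add_im, hxy, hxw, Complex.mul_im, Complex.ofReal_re,
        Complex.ofReal_im]
      ring
    have h2 : |ν.im| * ‖x‖ ^ 2 ≤ ‖x‖ * ‖k‖ := by
      have := (Complex.abs_im_le_norm ⟪x, k⟫_ℂ).trans hxk_le
      rwa [h1, abs_neg, abs_mul, abs_of_nonneg (sq_nonneg ‖x‖)] at this
    rw [ha, inv_mul_eq_div, le_div_iff₀ (abs_pos.2 hν)]
    rcases (norm_nonneg x).eq_or_lt with h0 | h0
    · rw [← h0]; simp
    · refine le_of_mul_le_mul_left ?_ h0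
      linarith
  have hxw_le : (⟪x, w⟫_ℂ).re ≤ (a + N * a ^ 2) * ‖k‖ ^ 2 := by
    have h1 : (⟪x, k⟫_ℂ).re = (⟪x, y⟫_ℂ).re + (⟪x, w⟫_ℂ).re - ν.re * ‖x‖ ^ 2 := by
      rw [hxk, Complex.sub_re, Complex.add_re, Complex.mul_re, Complex.ofReal_re,
        Complex.ofReal_im]
      ring
    have h2 := (Complex.re_le_norm ⟪x, k⟫_ℂ).trans hxk_le
    have h3 : ν.re * ‖x‖ ^ 2 ≤ N * ‖x‖ ^ 2 := by
      gcongr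
      exact (le_abs_self _).trans hre
    have h4 : ‖x‖ ^ 2 ≤ (a * ‖k‖) ^ 2 := by gcongr
    have h5 : ‖x‖ * ‖k‖ ≤ a * ‖k‖ * ‖k‖ := by gcongr
    have h6 := mul_le_mul_of_nonneg_left h4 hN
    nlinarith
  set B := c ^ 2 * (C + N) * (a + N * a ^ 2)
  have hB : 0 ≤ B := by positivity
  have hw_sq : ‖w‖ ^ 2 ≤ c ^ 2 * ‖w‖ * ‖k‖ + B * ‖k‖ ^ 2 := by
    have h1 : (⟪q, k⟫_ℂ).re = (⟪q, y⟫_ℂ).re + (⟪q, w⟫_ℂ).re - ν.re * (⟪q, x⟫_ℂ).re := by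
      rw [hqk, Complex.sub_re, Complex.add_re, Complex.mul_re, hqx]
      ring
    have h2 := (Complex.re_le_norm ⟪q, k⟫_ℂ).trans hqk_le
    have h3 : ν.re * (⟪q, x⟫_ℂ).re ≤ N * (⟪q, x⟫_ℂ).re := by
      gcongr
      exact (le_abs_self _).trans hre
    have h4 : ‖q‖ * ‖k‖ ≤ c * ‖w‖ * ‖k‖ := by gcongr
    have h5 : (C + N) * (⟪q, x⟫_ℂ).re ≤ (C + N) * (c * ((a + N * a ^ 2) * ‖k‖ ^ 2)) := by
      gcongr
      exact hqxw.trans (by gcongr)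
    have h6 : c⁻¹ * ‖w‖ ^ 2 ≤ c * ‖w‖ * ‖k‖ + (C + N) * (c * ((a + N * a ^ 2) * ‖k‖ ^ 2)) := by
      linarith
    rw [inv_mul_eq_div, div_le_iff₀ (by positivity)] at h6
    calc _ ≤ _ := h6
      _ = _ := by simp only [B]; ring
  have hw : ‖w‖ ≤ (c ^ 2 + B + 1) * ‖k‖ := by
    refine (sq_le_sq₀ (norm_nonneg _) (by positivity)).1 ?_
    have h1 := sq_nonneg (‖w‖ - c ^ 2 * ‖k‖)
    have h2 : 0 ≤ (B ^ 2 + 1 + 2 * c ^ 2 * B + 2 * c ^ 2) * ‖k‖ ^ 2 := by positivity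
    nlinarith
  have hy : ‖y‖ ≤ ‖k‖ + ‖w‖ + N * ‖x‖ := by
    have : y = k - w + ν • x := by rw [hk]; abel
    calc ‖y‖ = ‖k - w + ν • x‖ := by rw [← this]
      _ ≤ ‖k‖ + ‖w‖ + ‖ν • x‖ := (norm_add_le _ _).trans (by gcongr; exact norm_sub_le _ _)
      _ = _ := by rw [norm_smul]
  have hK : graphConst c C ν = 2 + c ^ 2 + B + (N + 1) * a := rfl
  have hk0 := norm_nonneg k
  have hNx : N * ‖x‖ ≤ N * (a * ‖k‖) := by gcongr
  have hNa : 0 ≤ N * a := by positivity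
  have hc2 : 0 ≤ c ^ 2 := sq_nonneg c
  have hNa' : (N + 1) * a = N * a + a := by ring
  rw [hK, hNa']
  refine ⟨hx.trans (mul_le_mul_of_nonneg_right (by linarith) hk0), ?_, hw.trans (mul_le_mul_of_nonneg_right (by linarith) hk0)⟩
  calc ‖y‖ ≤ ‖k‖ + (c ^ 2 + B + 1) * ‖k‖ + N * (a * ‖k‖) := by linarith
    _ = (2 + c ^ 2 + B + N * a) * ‖k‖ := by ring
    _ ≤ _ := mul_le_mul_of_nonneg_right (by linarith) hk0

end APriori

section Weight

variable {d : ℕ}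

/-- `θ` is a smooth positive function, locally comparable to the square root of `W`. -/
structure IsSqrtWeight (W θ : Euc d → ℝ) (c C : ℝ) : Prop where
  smooth : ContDiff ℝ (⊤ : ℕ∞) θ
  pos : ∀ x, 0 < θ x
  one_le : 1 ≤ c
  nonneg : 0 ≤ C
  le_sq : ∀ x, c⁻¹ * W x ≤ θ x ^ 2
  sq_le : ∀ x, θ x ^ 2 ≤ c * W x
  abs_sub_le : ∀ x y, dist x y ≤ 1 → |θ x - θ y| ≤ C * dist x y * θ x

lemma exists_isSqrtWeight {W : Euc d → ℝ} (hW : Continuous W) (hpos : ∀ x, 0 < W x) {c : ℝ}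
    (hcomp : ∀ x y, dist x y ≤ 1 → W y ≤ c * W x) :
    ∃ θ c' C, IsSqrtWeight W θ c' C := by
  have hc : 1 ≤ c := by
    have := hcomp 0 0 (by simp)
    exact (le_mul_iff_one_le_left (hpos 0)).1 this
  set η : ContDiffBump (0 : Euc d) := ⟨1 / 4, 1 / 2, by norm_num, by norm_num⟩ with hη
  set s : Euc d → ℝ := fun x => √(W x) with hs
  have hsc : Continuous s := hW.sqrt
  have hspos : ∀ x, 0 < s x := fun x => Real.sqrt_pos.2 (hpos x)
  set ρ : Euc d → ℝ := η.normed volume with hρ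
  set θ : Euc d → ℝ := convolution ρ s (ContinuousLinearMap.lsmul ℝ ℝ) volume with hθ
  have hρc : HasCompactSupport ρ := η.hasCompactSupport_normed
  have hρd : ContDiff ℝ (⊤ : ℕ∞) ρ := η.contDiff_normed
  have hθd : ContDiff ℝ (⊤ : ℕ∞) θ :=
    hρc.contDiff_convolution_left _ hρd hsc.locallyIntegrable
  have hθe : ∀ x, θ x = ∫ t, ρ (x - t) * s t := fun x => by
    rw [hθ, convolution_eq_swap]
    rfl
  have hscomp : ∀ x y, dist x y ≤ 1 → s y ≤ √c * s x := fun x y h => by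
    rw [hs, ← Real.sqrt_mul (by linarith)]
    exact Real.sqrt_le_sqrt (hcomp x y h)
  have hρ0 : ∀ x, 0 ≤ ρ x := fun x => η.nonneg_normed x
  have hρs : ∀ x, ρ x ≠ 0 → ‖x‖ < 1 / 2 := fun x hx => by
    have : x ∈ Function.support ρ := hx
    rw [hρ, η.support_normed_eq] at this
    simpa [hη] using this
  have hρint : ∀ x, ∫ t, ρ (x - t) = 1 := fun x => by
    rw [integral_sub_left_eq_self ρ volume x]
    exact η.integral_normed
  have hInt : ∀ x, Integrable fun t => ρ (x - t) := fun x =>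
    (hρd.continuous.integrable_of_hasCompactSupport hρc).comp_sub_left x
  have hints : ∀ x, Integrable fun t => ρ (x - t) * s t := fun x =>
    Continuous.integrable_of_hasCompactSupport
      ((hρd.continuous.comp (continuous_const.sub continuous_id)).mul hsc)
      (HasCompactSupport.mul_right
        (hρc.comp_homeomorph (Homeomorph.subLeft x)))
  have hlow : ∀ x, s x ≤ √c * θ x := fun x => by
    rw [hθe, ← integral_const_mul, ← mul_one (s x), ← hρint x, ← integral_const_mul]
    refine integral_mono ((hInt x).const_mul _) ((hints x).const_mul _) fun t => ?_
    by_cases h0 : ρ (x - t) = 0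
    · simp [h0]
    · have := hscomp t x (by rw [dist_eq_norm, ← norm_neg, neg_sub]; linarith [hρs _ h0])
      have := mul_le_mul_of_nonneg_left this (hρ0 (x - t))
      simp only
      linarith
  have hup : ∀ x, θ x ≤ √c * s x := fun x => by
    rw [hθe, ← mul_one (√c * s x), ← hρint x, ← integral_const_mul]
    refine integral_mono (hints x) ((hInt x).const_mul _) fun t => ?_
    by_cases h0 : ρ (x - t) = 0
    · simp [h0]
    · have := hscomp x t (by rw [dist_eq_norm]; linarith [hρs _ h0])
      have := mul_le_mul_of_nonneg_left this (hρ0 (x - t))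
      simp only
      linarith
  obtain ⟨L, hL⟩ : ∃ L, LipschitzWith L ρ := by
    obtain ⟨L, hL⟩ := (hρd.of_le (m := 1) (by simp)).lipschitzWith_of_hasCompactSupport hρc
      (by simp)
    exact ⟨L, hL⟩
  set v := (volume (Metric.closedBall (0 : Euc d) 2)).toReal with hv
  have hv0 : 0 ≤ v := ENNReal.toReal_nonneg
  have hcs : 1 ≤ √c := Real.one_le_sqrt.2 hc
  have hθpos : ∀ x, 0 < θ x := fun x => by
    have h1 := hlow x
    have h2 := hspos x
    by_contra hn
    nlinarith
  have hdiff : ∀ x y, dist x y ≤ 1 → |θ x - θ y| ≤ L * v * c * √c * dist x y * θ x := by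
    intro x y hxy
    have e : θ x - θ y = ∫ t in Metric.closedBall x 2, (ρ (x - t) - ρ (y - t)) * s t := by
      rw [hθe, hθe, ← integral_sub (hints x) (hints y), setIntegral_eq_integral_of_forall_compl_eq_zero]
      · simp only [sub_mul]
      · intro t ht
        have h1 : 2 < dist t x := by simpa using ht
        have h2 : ρ (x - t) = 0 := by
          by_contra h
          have := hρs _ h
          rw [← dist_eq_norm, dist_comm] at this
          linarith
        have h3 : ρ (y - t) = 0 := by
          by_contra h
          have := hρs _ h
          rw [← dist_eq_norm, dist_comm] at this
          linarith [dist_triangle t y x, dist_comm x y]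
        simp [h2, h3]
    rw [e, ← Real.norm_eq_abs]
    have hb : ∀ t ∈ Metric.closedBall x 2, ‖(ρ (x - t) - ρ (y - t)) * s t‖ ≤
        L * dist x y * (c * s x) := fun t ht => by
      rw [norm_mul, Real.norm_of_nonneg (hspos t).le]
      have h1 : ‖ρ (x - t) - ρ (y - t)‖ ≤ L * dist x y := by
        have := hL.dist_le_mul (x - t) (y - t)
        rwa [dist_sub_right, dist_eq_norm] at this
      have h2 : s t ≤ c * s x := by
        set m := midpoint ℝ x t
        have h3 : dist x m ≤ 1 := by
          rw [dist_left_midpoint]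
          have : dist t x ≤ 2 := ht
          rw [dist_comm] at this
          norm_num
          linarith
        have h4 : dist m t ≤ 1 := by
          rw [dist_midpoint_right]
          have : dist t x ≤ 2 := ht
          rw [dist_comm] at this
          norm_num
          linarith
        calc s t ≤ √c * s m := hscomp m t h4
          _ ≤ √c * (√c * s x) := by gcongr; exact hscomp x m h3
          _ = c * s x := by rw [← mul_assoc, Real.mul_self_sqrt (by linarith)]
      gcongr
    refine (norm_setIntegral_le_of_norm_le_const measure_closedBall_lt_top hb).trans ?_
    have hvx : volume.real (Metric.closedBall x 2) = v := by
      rw [hv, Measure.real, Measure.addHaar_closedBall_center]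
    rw [hvx]
    calc L * dist x y * (c * s x) * v ≤ L * dist x y * (c * (√c * θ x)) * v := by
          gcongr
          exact hlow x
      _ = _ := by ring
  refine ⟨θ, c, L * v * c * √c, hθd, hθpos, hc, by positivity, fun x => ?_, fun x => ?_, hdiff⟩
  · have h1 : s x ^ 2 ≤ (√c * θ x) ^ 2 := pow_le_pow_left₀ (hspos x).le (hlow x) 2
    rw [mul_pow, Real.sq_sqrt (show 0 ≤ c by linarith), Real.sq_sqrt (hpos x).le] at h1
    rw [inv_mul_eq_div, div_le_iff₀ (by linarith)]
    linarith
  · have h1 : θ x ^ 2 ≤ (√c * s x) ^ 2 := pow_le_pow_left₀ (hθpos x).le (hup x) 2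
    rwa [mul_pow, Real.sq_sqrt (show 0 ≤ c by linarith), Real.sq_sqrt (hpos x).le] at h1

end Weight

section DiscreteEstimate

variable {d : ℕ} {h : ℝ}

lemma summable_conj_comp_add_mul (p : Zd d →₀ ℂ) (v : Zd d → ℂ) (n : Zd d) :
    Summable fun z => conj (p (z + n)) * v z := by
  refine ((Equiv.addRight n).summable_iff.2
    (summable_conj_mul p fun z => v (z - n))).congr fun z => ?_
  simp

/-- Summation by parts for the discrete Laplacian. -/
lemma tsum_conj_mul_discLap (p : Zd d →₀ ℂ) (v : Zd d → ℂ) :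
    ∑' z, conj (p z) * discLap h v z = (h ^ 2 : ℂ)⁻¹ * ∑ j : Fin d,
      ∑' z, conj (p (z + Pi.single j 1) - p z) * (v (z + Pi.single j 1) - v z) := by
  have s1 : ∀ w : Zd d → ℂ, Summable fun z => conj (p z) * w z := summable_conj_mul p
  have s2 : ∀ (w : Zd d → ℂ) n, Summable fun z => conj (p (z + n)) * w z :=
    summable_conj_comp_add_mul p
  have e : ∀ (w : Zd d → ℂ) n, ∑' z, conj (p (z + n)) * w z = ∑' z, conj (p z) * w (z - n) :=
    fun w n => by
    rw [← (Equiv.addRight n).tsum_eq fun z => conj (p z) * w (z - n)]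
    simp
  have e1 : ∀ z, conj (p z) * discLap h v z = (h ^ 2 : ℂ)⁻¹ * ∑ j : Fin d,
      conj (p z) * (2 * v z - v (z + Pi.single j 1) - v (z - Pi.single j 1)) := fun z => by
    rw [discLap, mul_left_comm, Finset.mul_sum]
  simp only [e1]
  rw [tsum_mul_left, Summable.tsum_finsetSum fun j _ => s1 _]
  congr 1
  refine Finset.sum_congr rfl fun j _ => ?_
  simp only [map_sub, sub_mul]
  rw [(s2 _ _).tsum_sub (s1 _), e, ← (s1 _).tsum_sub (s1 _)]
  refine tsum_congr fun z => ?_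
  simp only [sub_add_cancel]
  ring

lemma re_conj_sub_mul_sub_ge (a b : ℝ) (x y : ℂ) {t : ℝ} (ha : (a - b) ^ 2 ≤ t * a ^ 2)
    (hb : (a - b) ^ 2 ≤ t * b ^ 2) :
    -(t / 2 * (a ^ 2 * ‖x‖ ^ 2 + b ^ 2 * ‖y‖ ^ 2)) ≤
      (conj ((a ^ 2 : ℝ) * x - (b ^ 2 : ℝ) * y) * (x - y)).re := by
  have e : (conj ((a ^ 2 : ℝ) * x - (b ^ 2 : ℝ) * y) * (x - y)).re =
      (a * x.re - b * y.re) ^ 2 + (a * x.im - b * y.im) ^ 2 -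
        (a - b) ^ 2 * (x.re * y.re + x.im * y.im) := by
    simp only [map_sub, map_mul, Complex.conj_ofReal, Complex.mul_re, Complex.sub_re,
      Complex.sub_im, Complex.conj_re, Complex.conj_im, Complex.ofReal_re, Complex.ofReal_im,
      Complex.mul_im]
    ring
  rw [e, Complex.sq_norm, Complex.sq_norm, Complex.normSq_apply, Complex.normSq_apply]
  have h1 : (a - b) ^ 2 * (x.re * y.re + x.im * y.im) ≤
      (a - b) ^ 2 * ((x.re * x.re + x.im * x.im) / 2 + (y.re * y.re + y.im * y.im) / 2) := by
    refine mul_le_mul_of_nonneg_left ?_ (sq_nonneg _)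
    nlinarith [sq_nonneg (x.re - y.re), sq_nonneg (x.im - y.im)]
  have h2 : (a - b) ^ 2 * (x.re * x.re + x.im * x.im) ≤
      t * a ^ 2 * (x.re * x.re + x.im * x.im) :=
    mul_le_mul_of_nonneg_right ha (by nlinarith [sq_nonneg x.re, sq_nonneg x.im])
  have h3 : (a - b) ^ 2 * (y.re * y.re + y.im * y.im) ≤
      t * b ^ 2 * (y.re * y.re + y.im * y.im) :=
    mul_le_mul_of_nonneg_right hb (by nlinarith [sq_nonneg y.re, sq_nonneg y.im])
  nlinarith [sq_nonneg (a * x.re - b * y.re), sq_nonneg (a * x.im - b * y.im)]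

lemma dist_latPt_add_single (hh : 0 < h) (z : Zd d) (j : Fin d) :
    dist (latPt d h (z + Pi.single j 1)) (latPt d h z) = h := by
  have : latPt d h (z + Pi.single j 1) - latPt d h z = EuclideanSpace.single j h := by
    ext i
    rw [PiLp.sub_apply, latPt_apply, latPt_apply]
    by_cases hi : i = j
    · subst hi; simp; ring
    · simp [hi]
  rw [dist_eq_norm, this]
  simp [abs_of_pos hh]

lemma norm_finLat_le (hh : 0 < h) {f g : Zd d →₀ ℂ} {c : ℝ} (hfg : ∀ z, ‖f z‖ ≤ c * ‖g z‖) :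
    ‖finLat hh f‖ ≤ c * ‖finLat hh g‖ := by
  refine Lp.norm_le_mul_norm_of_ae_le_mul ((ae_latMeas_iff hh).2 fun z => ?_)
  simpa only [coeFn_finLat] using hfg z

lemma inner_finLat_mulFin (hh : 0 < h) (a b : Zd d → ℝ) (g : Zd d →₀ ℂ) :
    ⟪finLat hh (mulFin (fun z => a z) g), finLat hh (mulFin (fun z => b z) g)⟫_ℂ =
      ((h ^ d * ∑ z ∈ g.support, a z * b z * ‖g z‖ ^ 2 : ℝ) : ℂ) := by
  rw [inner_finLat_tsum, tsum_eq_sum (s := g.support)]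
  · push_cast
    congr 1
    refine Finset.sum_congr rfl fun z _ => ?_
    rw [coeFn_finLat, mulFin_apply, mulFin_apply, ← Complex.conj_mul', map_mul, Complex.conj_ofReal]
    ring
  · intro z hz
    rw [mulFin_apply]
    simp [Finsupp.notMem_support_iff.1 hz]

lemma inner_finLat_discLapFin_right (hh : 0 < h) (p g : Zd d →₀ ℂ) :
    ⟪finLat hh p, finLat hh (discLapFin h g)⟫_ℂ = (h ^ d : ℂ) * ((h ^ 2 : ℂ)⁻¹ * ∑ j : Fin d,
      ∑' z, conj (p (z + Pi.single j 1) - p z) * (g (z + Pi.single j 1) - g z)) := by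
  rw [inner_finLat_tsum, coeFn_finLat, ← tsum_conj_mul_discLap]
  rfl

lemma inner_finLat_discLapFin_self (hh : 0 < h) (g : Zd d →₀ ℂ) :
    (⟪finLat hh g, finLat hh (discLapFin h g)⟫_ℂ).im = 0 ∧
      0 ≤ (⟪finLat hh g, finLat hh (discLapFin h g)⟫_ℂ).re := by
  rw [inner_finLat_discLapFin_right]
  have e : ((h ^ d : ℂ) * ((h ^ 2 : ℂ)⁻¹ * ∑ j : Fin d,
      ∑' z, conj (g (z + Pi.single j 1) - g z) * (g (z + Pi.single j 1) - g z))) =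
      ((h ^ d * ((h ^ 2)⁻¹ * ∑ j : Fin d, ∑' z, ‖g (z + Pi.single j 1) - g z‖ ^ 2) : ℝ) : ℂ) := by
    push_cast
    simp only [Complex.conj_mul']
  rw [e, Complex.ofReal_im, Complex.ofReal_re]
  refine ⟨rfl, mul_nonneg (by positivity) (mul_nonneg (by positivity)
    (Finset.sum_nonneg fun j _ => tsum_nonneg fun z => by positivity))⟩

set_option maxHeartbeats 1000000 in
lemma re_inner_mulFin_discLapFin_ge (hh : 0 < h) (θ : Zd d → ℝ) {C : ℝ} (g : Zd d →₀ ℂ)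
    (hθ : ∀ z j, (θ (z + Pi.single j 1) - θ z) ^ 2 ≤ C * h ^ 2 * θ (z + Pi.single j 1) ^ 2)
    (hθ' : ∀ z j, (θ (z + Pi.single j 1) - θ z) ^ 2 ≤ C * h ^ 2 * θ z ^ 2) :
    -(d * C * (h ^ d * ∑ z ∈ g.support, θ z ^ 2 * ‖g z‖ ^ 2)) ≤
      (⟪finLat hh (mulFin (fun z => (θ z ^ 2 : ℝ)) g), finLat hh (discLapFin h g)⟫_ℂ).re := by
  set p := mulFin (fun z => ((θ z ^ 2 : ℝ) : ℂ)) g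
  set m : Zd d → ℝ := fun z => θ z ^ 2 * ‖g z‖ ^ 2
  have hm : HasSum m (∑ z ∈ g.support, m z) := hasSum_sum_of_ne_finset_zero fun z hz => by
    simp [m, Finsupp.notMem_support_iff.1 hz]
  have hm' : ∀ n, HasSum (fun z => m (z + n)) (∑ z ∈ g.support, m z) := fun n =>
    (Equiv.addRight n).hasSum_iff.2 hm
  have key : ∀ j : Fin d, -(C * h ^ 2 * ∑ z ∈ g.support, m z) ≤
      (∑' z, conj (p (z + Pi.single j 1) - p z) * (g (z + Pi.single j 1) - g z)).re := by
    intro j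
    have hs : Summable fun z => conj (p (z + Pi.single j 1) - p z) *
        (g (z + Pi.single j 1) - g z) := by
      simp only [map_sub, sub_mul]
      exact (summable_conj_comp_add_mul p _ _).sub (summable_conj_mul p _)
    have h1 := Complex.hasSum_re hs.hasSum
    have h2 := (((hm' (Pi.single j 1)).add hm).mul_left (C * h ^ 2 / 2)).neg
    have h3 : ∀ z, -(C * h ^ 2 / 2 * (m (z + Pi.single j 1) + m z)) ≤
        (conj (p (z + Pi.single j 1) - p z) * (g (z + Pi.single j 1) - g z)).re := fun z =>
      re_conj_sub_mul_sub_ge (θ (z + Pi.single j 1)) (θ z) (g (z + Pi.single j 1)) (g z)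
        (hθ z j) (hθ' z j)
    have h4 := hasSum_le h3 h2 h1
    linarith
  rw [inner_finLat_discLapFin_right]
  have e : ∀ s : ℂ, ((h ^ d : ℂ) * ((h ^ 2 : ℂ)⁻¹ * s)).re = h ^ d * ((h ^ 2)⁻¹ * s.re) :=
    fun s => by
    rw [← Complex.ofReal_pow, ← Complex.ofReal_pow, ← Complex.ofReal_inv, Complex.re_ofReal_mul,
      Complex.re_ofReal_mul]
  rw [e, Complex.re_sum]
  have h3 := Finset.sum_le_sum fun j (_ : j ∈ Finset.univ) => key j
  rw [Finset.sum_const, Finset.card_univ, Fintype.card_fin, nsmul_eq_mul] at h3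
  calc _ = h ^ d * ((h ^ 2)⁻¹ * (d * -(C * h ^ 2 * ∑ z ∈ g.support, m z))) := by
        have := hh.ne'
        field_simp
    _ ≤ _ := by gcongr

/-- Separation estimate for the discrete Schrödinger operator, uniform in the mesh. -/
lemma IsSqrtWeight.finLat_le {W θ : Euc d → ℝ} {c C : ℝ} (H : IsSqrtWeight W θ c C)
    (hW : ∀ x, 1 ≤ W x) (hh : 0 < h) (h1 : h ≤ 1) {ν : ℂ} (hν : ν.im ≠ 0) (g : Zd d →₀ ℂ) :
    letI k := finLat hh (discLapFin h g) +
      finLat hh (mulFin (fun z => (W (latPt d h z) : ℂ)) g) - ν • finLat hh g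
    ‖finLat hh g‖ ≤ graphConst c (d * C ^ 2) ν * ‖k‖ ∧
      ‖finLat hh (discLapFin h g)‖ ≤ graphConst c (d * C ^ 2) ν * ‖k‖ ∧
      ‖finLat hh (mulFin (fun z => (W (latPt d h z) : ℂ)) g)‖ ≤
        graphConst c (d * C ^ 2) ν * ‖k‖ := by
  have hc0 : 0 < c := by linarith [H.one_le]
  have hg : g = mulFin (fun _ => ((1 : ℝ) : ℂ)) g := by
    ext z; rw [mulFin_apply]; simp
  have inner_g : ∀ a : Zd d → ℝ, ⟪finLat hh (mulFin (fun z => (a z : ℂ)) g), finLat hh g⟫_ℂ =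
      ((h ^ d * ∑ z ∈ g.support, a z * ‖g z‖ ^ 2 : ℝ) : ℂ) := fun a => by
    have := inner_finLat_mulFin hh a (fun _ => 1) g
    rw [← hg] at this
    simpa only [mul_one] using this
  have inner_g' : ∀ a : Zd d → ℝ, ⟪finLat hh g, finLat hh (mulFin (fun z => (a z : ℂ)) g)⟫_ℂ =
      ((h ^ d * ∑ z ∈ g.support, a z * ‖g z‖ ^ 2 : ℝ) : ℂ) := fun a => by
    have := inner_finLat_mulFin hh (fun _ => 1) a g
    rw [← hg] at this
    simpa only [one_mul] using this
  have hsym := inner_finLat_discLapFin_self hh g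
  have hlip : ∀ (z : Zd d) (j : Fin d),
      |θ (latPt d h (z + Pi.single j 1)) - θ (latPt d h z)| ≤
        C * h * θ (latPt d h (z + Pi.single j 1)) ∧
      |θ (latPt d h (z + Pi.single j 1)) - θ (latPt d h z)| ≤ C * h * θ (latPt d h z) := by
    intro z j
    have hd := dist_latPt_add_single hh z j
    constructor
    · have := H.abs_sub_le _ _ (hd.le.trans h1)
      rwa [hd] at this
    · have := H.abs_sub_le _ _ ((dist_comm _ _).le.trans (hd.le.trans h1))
      rwa [dist_comm, hd, abs_sub_comm] at this
  have hsq : ∀ {a b : ℝ}, |a| ≤ C * h * b → a ^ 2 ≤ C ^ 2 * h ^ 2 * b ^ 2 := fun {a b} hab => by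
    rw [← sq_abs a, ← mul_pow, ← mul_pow]
    exact pow_le_pow_left₀ (abs_nonneg _) hab 2
  refine norm_le_graphConst_mul (q := finLat hh (mulFin (fun z => (θ (latPt d h z) ^ 2 : ℝ)) g))
    H.one_le (by positivity) hν hsym.1 hsym.2 ?_ ?_ ?_ ?_ ?_ ?_ ?_
  · rw [inner_g, Complex.ofReal_re]
    exact re_inner_mulFin_discLapFin_ge hh (fun z => θ (latPt d h z)) g
      (fun z j => hsq (hlip z j).1) (fun z j => hsq (hlip z j).2)
  · rw [inner_g', Complex.ofReal_im]
  · rw [inner_finLat_mulFin, Complex.ofReal_re]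
    have := inner_finLat_mulFin hh (fun z => W (latPt d h z)) (fun z => W (latPt d h z)) g
    rw [inner_self_eq_norm_sq_to_K] at this
    have e : ‖finLat hh (mulFin (fun z => (W (latPt d h z) : ℂ)) g)‖ ^ 2 =
        h ^ d * ∑ z ∈ g.support, W (latPt d h z) * W (latPt d h z) * ‖g z‖ ^ 2 := by
      rw [RCLike.ofReal_eq_complex_ofReal] at this
      exact_mod_cast this
    rw [e, mul_left_comm, Finset.mul_sum]
    refine mul_le_mul_of_nonneg_left (Finset.sum_le_sum fun z _ => ?_) (by positivity)
    rw [← mul_assoc, ← mul_assoc]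
    exact mul_le_mul_of_nonneg_right (mul_le_mul_of_nonneg_right (H.le_sq _)
      (by linarith [hW (latPt d h z)])) (by positivity)
  · refine norm_finLat_le hh fun z => ?_
    rw [mulFin_apply, mulFin_apply, norm_mul, norm_mul, Complex.norm_real, Complex.norm_real,
      Real.norm_of_nonneg (sq_nonneg _), Real.norm_of_nonneg (by linarith [hW (latPt d h z)]),
      ← mul_assoc]
    gcongr
    exact H.sq_le _
  · rw [inner_g, Complex.ofReal_im]
  · rw [inner_g, Complex.ofReal_re]
    positivity
  · rw [inner_g, inner_g', Complex.ofReal_re, Complex.ofReal_re, mul_left_comm c, Finset.mul_sum _ _ c]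
    refine mul_le_mul_of_nonneg_left (Finset.sum_le_sum fun z _ => ?_) (by positivity)
    rw [← mul_assoc]
    exact mul_le_mul_of_nonneg_right (H.sq_le _) (by positivity)

end DiscreteEstimate

section ContinuousEstimate

variable {d : ℕ}

lemma contDiff_fderiv_apply_const {E : Type*} [NormedAddCommGroup E] [NormedSpace ℝ E]
    {g : Euc d → E} (hg : ContDiff ℝ (⊤ : ℕ∞) g) (e : Euc d) :
    ContDiff ℝ (⊤ : ℕ∞) fun x => fderiv ℝ g x e :=
  (hg.fderiv_right (m := (⊤ : ℕ∞)) (by simp)).clm_apply contDiff_const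

lemma continuous_lapl {g : Euc d → ℂ} (hg : ContDiff ℝ (⊤ : ℕ∞) g) : Continuous (lapl d g) :=
  continuous_finsetSum _ fun _ _ =>
    (contDiff_fderiv_apply_const (contDiff_fderiv_apply_const hg _) _).continuous

/-- Green's identity. -/
lemma integral_mul_neg_lapl {F g : Euc d → ℂ} (hF : ContDiff ℝ (⊤ : ℕ∞) F)
    (hFc : HasCompactSupport F) (hg : ContDiff ℝ (⊤ : ℕ∞) g) :
    ∫ x, F x * -lapl d g x = ∑ j : Fin d, ∫ x,
      fderiv ℝ F x (EuclideanSpace.single j 1) * fderiv ℝ g x (EuclideanSpace.single j 1) := by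
  have hInt : ∀ {A B : Euc d → ℂ}, ContDiff ℝ (⊤ : ℕ∞) A → ContDiff ℝ (⊤ : ℕ∞) B →
      HasCompactSupport A → Integrable fun x => A x * B x := fun hA hB hAc =>
    (hA.continuous.mul hB.continuous).integrable_of_hasCompactSupport hAc.mul_right
  have e : ∀ j : Fin d, ∫ x, fderiv ℝ F x (EuclideanSpace.single j 1) *
      fderiv ℝ g x (EuclideanSpace.single j 1) =
      -∫ x, F x * fderiv ℝ (fun y => fderiv ℝ g y (EuclideanSpace.single j (1 : ℝ))) x
        (EuclideanSpace.single j (1 : ℝ)) := fun j => by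
    have hg1 := contDiff_fderiv_apply_const hg (EuclideanSpace.single j (1 : ℝ))
    have hg2 := contDiff_fderiv_apply_const hg1 (EuclideanSpace.single j (1 : ℝ))
    have hF1 := contDiff_fderiv_apply_const hF (EuclideanSpace.single j (1 : ℝ))
    rw [integral_mul_fderiv_eq_neg_fderiv_mul_of_integrable
      (hInt hF1 hg1 (hFc.fderiv_apply ℝ _)) (hInt hF hg2 hFc) (hInt hF hg1 hFc)
      (fun x _ => hF.differentiable (by simp) x) (fun x _ => hg1.differentiable (by simp) x),
      neg_neg]
  simp only [e]
  rw [Finset.sum_neg_distrib, ← integral_finsetSum]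
  · rw [← integral_neg]
    refine integral_congr_ae (Filter.Eventually.of_forall fun x => ?_)
    simp only [lapl, mul_neg, Finset.mul_sum]
  · intro j _
    exact hInt hF (contDiff_fderiv_apply_const (contDiff_fderiv_apply_const hg _) _) hFc

lemma fderiv_conj_apply {g : Euc d → ℂ} (hg : ContDiff ℝ (⊤ : ℕ∞) g) (x e : Euc d) :
    fderiv ℝ (fun y => conj (g y)) x e = conj (fderiv ℝ g x e) := by
  have h1 := (hg.differentiable (by simp) x).hasFDerivAt.star
  exact congrArg (fun L : Euc d →L[ℝ] ℂ => L e) h1.fderiv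

lemma contDiff_conj_comp {g : Euc d → ℂ} (hg : ContDiff ℝ (⊤ : ℕ∞) g) :
    ContDiff ℝ (⊤ : ℕ∞) fun y => conj (g y) :=
  Complex.conjCLE.contDiff.comp hg

lemma contDiff_sq_mul_conj {θ : Euc d → ℝ} {g : Euc d → ℂ} (hθ : ContDiff ℝ (⊤ : ℕ∞) θ)
    (hg : ContDiff ℝ (⊤ : ℕ∞) g) :
    ContDiff ℝ (⊤ : ℕ∞) fun x => ((θ x ^ 2 : ℝ) : ℂ) * conj (g x) :=
  (Complex.ofRealCLM.contDiff.comp (hθ.pow 2)).mul (contDiff_conj_comp hg)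

lemma re_fderiv_sq_mul_conj_mul_ge {θ : Euc d → ℝ} {g : Euc d → ℂ}
    (hθ : ContDiff ℝ (⊤ : ℕ∞) θ) (hg : ContDiff ℝ (⊤ : ℕ∞) g) (x e : Euc d) :
    -((fderiv ℝ θ x e) ^ 2 * ‖g x‖ ^ 2) ≤
      (fderiv ℝ (fun x => ((θ x ^ 2 : ℝ) : ℂ) * conj (g x)) x e * fderiv ℝ g x e).re := by
  have h1 : HasFDerivAt (fun x => ((θ x ^ 2 : ℝ) : ℂ))
      (Complex.ofRealCLM ∘L ((2 • θ x ^ (2 - 1)) • fderiv ℝ θ x)) x :=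
    Complex.ofRealCLM.hasFDerivAt.comp x ((hθ.differentiable (by simp) x).hasFDerivAt.pow 2)
  have h2 : HasFDerivAt (fun y => conj (g y)) (fderiv ℝ (fun y => conj (g y)) x) x :=
    ((contDiff_conj_comp hg).differentiable (by simp) x).hasFDerivAt
  have h3 : fderiv ℝ (fun x => ((θ x ^ 2 : ℝ) : ℂ) * conj (g x)) x e =
      ((θ x ^ 2 : ℝ) : ℂ) * conj (fderiv ℝ g x e) +
        conj (g x) * ((2 * θ x * fderiv ℝ θ x e : ℝ) : ℂ) := by
    have h4 : HasFDerivAt (fun x => ((θ x ^ 2 : ℝ) : ℂ) * conj (g x)) _ x := h1.mul h2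
    rw [h4.fderiv, ← fderiv_conj_apply hg]
    simp
  rw [h3]
  set t := fderiv ℝ θ x e
  set z := fderiv ℝ g x e
  rw [Complex.sq_norm, Complex.normSq_apply]
  have e1 : ((((θ x ^ 2 : ℝ) : ℂ) * conj z + conj (g x) * ((2 * θ x * t : ℝ) : ℂ)) * z).re =
      (t * (g x).re + θ x * z.re) ^ 2 + (t * (g x).im + θ x * z.im) ^ 2 -
        t ^ 2 * ((g x).re * (g x).re + (g x).im * (g x).im) := by
    simp only [Complex.mul_re, Complex.add_re, Complex.add_im, Complex.mul_im, Complex.conj_re,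
      Complex.conj_im, Complex.ofReal_re, Complex.ofReal_im]
    ring
  rw [e1]
  nlinarith [sq_nonneg (t * (g x).re + θ x * z.re), sq_nonneg (t * (g x).im + θ x * z.im)]

/-- Localised energy inequality. -/
lemma re_integral_sq_mul_conj_mul_neg_lapl_ge {θ : Euc d → ℝ} {g : Euc d → ℂ}
    (hθ : ContDiff ℝ (⊤ : ℕ∞) θ) (hg : ContDiff ℝ (⊤ : ℕ∞) g)
    (hc : HasCompactSupport fun x => ((θ x ^ 2 : ℝ) : ℂ) * conj (g x))
    (hi : ∀ j : Fin d, Integrable fun x =>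
      (fderiv ℝ θ x (EuclideanSpace.single j 1)) ^ 2 * ‖g x‖ ^ 2) :
    -∑ j : Fin d, ∫ x, (fderiv ℝ θ x (EuclideanSpace.single j 1)) ^ 2 * ‖g x‖ ^ 2 ≤
      (∫ x, ((θ x ^ 2 : ℝ) : ℂ) * conj (g x) * -lapl d g x).re := by
  have hF := contDiff_sq_mul_conj hθ hg
  rw [integral_mul_neg_lapl hF hc hg, Complex.re_sum, ← Finset.sum_neg_distrib]
  refine Finset.sum_le_sum fun j _ => ?_
  have hInt : Integrable fun x => fderiv ℝ (fun x => ((θ x ^ 2 : ℝ) : ℂ) * conj (g x)) x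
      (EuclideanSpace.single j 1) * fderiv ℝ g x (EuclideanSpace.single j 1) :=
    ((contDiff_fderiv_apply_const hF _).continuous.mul
      (contDiff_fderiv_apply_const hg _).continuous).integrable_of_hasCompactSupport
      (hc.fderiv_apply ℝ _).mul_right
  have hre := integral_re hInt
  simp only [RCLike.re_to_complex] at hre
  rw [← hre, ← integral_neg]
  exact integral_mono (hi j).neg hInt.re fun x => re_fderiv_sq_mul_conj_mul_ge hθ hg x _

lemma inner_toLp_toLp {f g : Euc d → ℂ} (hf : MemLp f 2) (hg : MemLp g 2) :
    ⟪(hf.toLp f : L2 d), hg.toLp g⟫_ℂ = ∫ x, conj (f x) * g x := by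
  rw [L2.inner_def]
  refine integral_congr_ae ?_
  filter_upwards [hf.coeFn_toLp, hg.coeFn_toLp] with x h1 h2
  rw [h1, h2, RCLike.inner_apply, mul_comm]

lemma inner_toLp_mul {a b : Euc d → ℝ} {u : Euc d → ℂ}
    (ha : MemLp (fun x => (a x : ℂ) * u x) 2) (hb : MemLp (fun x => (b x : ℂ) * u x) 2) :
    ⟪(ha.toLp _ : L2 d), hb.toLp _⟫_ℂ = ((∫ x, a x * b x * ‖u x‖ ^ 2 : ℝ) : ℂ) := by
  rw [inner_toLp_toLp, ← integral_complex_ofReal]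
  refine integral_congr_ae (Filter.Eventually.of_forall fun x => ?_)
  simp only
  push_cast
  rw [← Complex.conj_mul', map_mul, Complex.conj_ofReal]
  ring

lemma toLp_schwartz_eq (u : SchwartzMap (Euc d) ℂ) :
    (u.toLp 2 volume : L2 d) = (u.memLp 2 volume).toLp u := rfl

lemma inner_schwartz_negLap_self (u : SchwartzMap (Euc d) ℂ) :
    (⟪(u.toLp 2 volume : L2 d), (negLap u).toLp 2 volume⟫_ℂ).im = 0 ∧
      0 ≤ (⟪(u.toLp 2 volume : L2 d), (negLap u).toLp 2 volume⟫_ℂ).re := by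
  have h1 := SchwartzMap.inner_toL2_toL2_eq u (negLap u) (μ := (volume : Measure (Euc d)))
  rw [← SchwartzMap.integral_inner_fourier_fourier] at h1
  have h2 : ∀ x, ⟪𝓕 u x, 𝓕 (negLap u) x⟫_ℂ = ((contSymbol x * ‖𝓕 u x‖ ^ 2 : ℝ) : ℂ) := fun x => by
    rw [fourier_negLap, RCLike.inner_apply]
    push_cast
    rw [← Complex.mul_conj']
    ring
  simp only [h2] at h1
  rw [integral_complex_ofReal] at h1
  rw [h1]
  exact ⟨Complex.ofReal_im _, (Complex.ofReal_re _).symm ▸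
    integral_nonneg fun x => mul_nonneg (contSymbol_nonneg x) (by positivity)⟩

lemma IsSqrtWeight.abs_fderiv_le {W θ : Euc d → ℝ} {c C : ℝ} (H : IsSqrtWeight W θ c C)
    (x e : Euc d) : |fderiv ℝ θ x e| ≤ C * θ x * ‖e‖ := by
  have h1 : ‖fderiv ℝ θ x‖ ≤ C * θ x := by
    refine norm_fderiv_le_of_lip' ℝ (mul_nonneg H.nonneg (H.pos x).le) ?_
    filter_upwards [Metric.ball_mem_nhds x one_pos] with y hy
    have := H.abs_sub_le x y (by rw [dist_comm]; exact (Metric.mem_ball.1 hy).le)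
    rw [Real.norm_eq_abs, abs_sub_comm, ← dist_eq_norm, dist_comm]
    linarith
  exact ((fderiv ℝ θ x).le_opNorm e).trans (by gcongr)

lemma integrable_mul_norm_sq {a : Euc d → ℝ} {u : Euc d → ℂ} (ha : Continuous a)
    (hc : Continuous u) (hu : HasCompactSupport u) : Integrable fun x => a x * ‖u x‖ ^ 2 := by
  refine (ha.mul (hc.norm.pow 2)).integrable_of_hasCompactSupport (hu.mono fun x hx => ?_)
  simp only [Function.mem_support] at hx ⊢
  contrapose! hx
  simp [hx]

lemma memLp_mul_of_hasCompactSupport {a : Euc d → ℝ} {u : Euc d → ℂ} (ha : Continuous a)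
    (hc : Continuous u) (hu : HasCompactSupport u) :
    MemLp (fun x => (a x : ℂ) * u x) 2 volume :=
  ((Complex.continuous_ofReal.comp ha).mul hc).memLp_of_hasCompactSupport hu.mul_left

lemma hasCompactSupport_mul_conj (a : Euc d → ℂ) {u : Euc d → ℂ} (hu : HasCompactSupport u) :
    HasCompactSupport fun x => a x * conj (u x) := by
  refine hu.mono fun x hx => ?_
  simp only [Function.mem_support] at hx ⊢
  contrapose! hx
  simp [hx]

lemma inner_toLp_mul_negLap_ge {W θ : Euc d → ℝ} {c C : ℝ} (H : IsSqrtWeight W θ c C)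
    (u : SchwartzMap (Euc d) ℂ) (hu : HasCompactSupport u)
    (hq : MemLp (fun x : Euc d => ((θ x ^ 2 : ℝ) : ℂ) * u x) 2 volume) :
    -(d * C ^ 2 * ∫ x, θ x ^ 2 * ‖u x‖ ^ 2) ≤
      (⟪(hq.toLp _ : L2 d), (negLap u).toLp 2 volume⟫_ℂ).re := by
  have hInt : ∀ {a : Euc d → ℝ}, Continuous a → Integrable (fun x => a x * ‖u x‖ ^ 2) :=
    fun {a} ha => integrable_mul_norm_sq ha u.continuous hu
  have hθ2 : Continuous fun x => θ x ^ 2 := H.smooth.continuous.pow 2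
  rw [toLp_schwartz_eq, inner_toLp_toLp hq]
  have hcs : HasCompactSupport fun x => ((θ x ^ 2 : ℝ) : ℂ) * conj (u x) :=
    hasCompactSupport_mul_conj _ hu
  have hd : ∀ j : Fin d, Continuous fun x =>
      (fderiv ℝ θ x (EuclideanSpace.single j 1)) ^ 2 := fun j =>
    (contDiff_fderiv_apply_const H.smooth _).continuous.pow 2
  have h2 := re_integral_sq_mul_conj_mul_neg_lapl_ge H.smooth (u.smooth _) hcs
    fun j => hInt (hd j)
  have h3 : ∑ j : Fin d, ∫ x, (fderiv ℝ θ x (EuclideanSpace.single j 1)) ^ 2 * ‖u x‖ ^ 2 ≤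
      ∑ j : Fin d, ∫ x, C ^ 2 * (θ x ^ 2 * ‖u x‖ ^ 2) := by
    refine Finset.sum_le_sum fun j _ => integral_mono (hInt (hd j))
      ((hInt hθ2).const_mul _) fun x => ?_
    have h4 := H.abs_fderiv_le x (EuclideanSpace.single j 1)
    have h5 : ‖(EuclideanSpace.single j (1 : ℝ) : Euc d)‖ = 1 := by simp
    rw [h5, mul_one] at h4
    have h6 := pow_le_pow_left₀ (abs_nonneg _) h4 2
    rw [sq_abs, mul_pow] at h6
    simp only
    rw [← mul_assoc]
    exact mul_le_mul_of_nonneg_right h6 (by positivity)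
  rw [Finset.sum_const, Finset.card_univ, Fintype.card_fin, nsmul_eq_mul, integral_const_mul,
    ← mul_assoc] at h3
  have e1 : ∫ x, conj (((θ x ^ 2 : ℝ) : ℂ) * u x) * negLap u x =
      ∫ x, ((θ x ^ 2 : ℝ) : ℂ) * conj (u x) * -lapl d u x := by
    refine integral_congr_ae (Filter.Eventually.of_forall fun x => ?_)
    simp only [negLap_apply, map_mul, Complex.conj_ofReal]
  rw [e1]
  linarith

/-- Separation estimate for the continuum Schrödinger operator on test functions. -/
lemma IsSqrtWeight.toLp_le {W θ : Euc d → ℝ} {c C : ℝ} (H : IsSqrtWeight W θ c C)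
    (hWc : Continuous W) (hW : ∀ x, 1 ≤ W x) {ν : ℂ} (hν : ν.im ≠ 0) (u : SchwartzMap (Euc d) ℂ)
    (hu : HasCompactSupport u) (hw : MemLp (fun x : Euc d => (W x : ℂ) * u x) 2 volume) {k : L2 d}
    (hk : k = (negLap u).toLp 2 volume + hw.toLp _ - ν • u.toLp 2 volume) :
    ‖(u.toLp 2 volume : L2 d)‖ ≤ graphConst c (d * C ^ 2) ν * ‖k‖ ∧
      ‖((negLap u).toLp 2 volume : L2 d)‖ ≤ graphConst c (d * C ^ 2) ν * ‖k‖ ∧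
      ‖(hw.toLp _ : L2 d)‖ ≤ graphConst c (d * C ^ 2) ν * ‖k‖ := by
  have hc0 : 0 < c := by linarith [H.one_le]
  have hInt : ∀ {a : Euc d → ℝ}, Continuous a → Integrable (fun x => a x * ‖u x‖ ^ 2) :=
    fun {a} ha => integrable_mul_norm_sq ha u.continuous hu
  have hθ2 : Continuous fun x => θ x ^ 2 := H.smooth.continuous.pow 2
  have hq : MemLp (fun x : Euc d => ((θ x ^ 2 : ℝ) : ℂ) * u x) 2 volume :=
    memLp_mul_of_hasCompactSupport hθ2 u.continuous hu
  have h1 : MemLp (fun x : Euc d => ((1 : ℝ) : ℂ) * u x) 2 volume :=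
    memLp_mul_of_hasCompactSupport continuous_const u.continuous hu
  have hu1 : (u.toLp 2 volume : L2 d) = h1.toLp _ := by
    rw [toLp_schwartz_eq]
    exact MemLp.toLp_congr _ _ (Filter.Eventually.of_forall fun x => by simp)
  have hsym := inner_schwartz_negLap_self u
  have hqy := inner_toLp_mul_negLap_ge H u hu hq
  have exw : ⟪(u.toLp 2 volume : L2 d), hw.toLp _⟫_ℂ = ((∫ x, W x * ‖u x‖ ^ 2 : ℝ) : ℂ) := by
    rw [hu1, inner_toLp_mul (a := fun _ => 1) h1 hw]
    simp only [one_mul]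
  have eqx : ⟪(hq.toLp _ : L2 d), u.toLp 2 volume⟫_ℂ = ((∫ x, θ x ^ 2 * ‖u x‖ ^ 2 : ℝ) : ℂ) := by
    rw [hu1, inner_toLp_mul (a := fun x => θ x ^ 2) (b := fun _ => 1) hq h1]
    simp only [mul_one]
  have eqw : ⟪(hq.toLp _ : L2 d), hw.toLp _⟫_ℂ = ((∫ x, θ x ^ 2 * W x * ‖u x‖ ^ 2 : ℝ) : ℂ) :=
    inner_toLp_mul (a := fun x => θ x ^ 2) hq hw
  have eww : ‖(hw.toLp _ : L2 d)‖ ^ 2 = ∫ x, W x * W x * ‖u x‖ ^ 2 := by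
    have e1 := inner_toLp_mul hw hw
    rw [inner_self_eq_norm_sq_to_K, RCLike.ofReal_eq_complex_ofReal] at e1
    exact_mod_cast e1
  have hqle : ‖(hq.toLp _ : L2 d)‖ ≤ c * ‖(hw.toLp _ : L2 d)‖ := by
    refine Lp.norm_le_mul_norm_of_ae_le_mul ?_
    filter_upwards [hw.coeFn_toLp, hq.coeFn_toLp] with x e1 e2
    rw [e1, e2, norm_mul, norm_mul, Complex.norm_real, Complex.norm_real,
      Real.norm_of_nonneg (sq_nonneg _), Real.norm_of_nonneg (by linarith [hW x]), ← mul_assoc]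
    exact mul_le_mul_of_nonneg_right (H.sq_le _) (norm_nonneg _)
  have i1 : c⁻¹ * ∫ x, W x * W x * ‖u x‖ ^ 2 ≤ ∫ x, θ x ^ 2 * W x * ‖u x‖ ^ 2 := by
    rw [← integral_const_mul]
    refine integral_mono ((hInt (hWc.mul hWc)).const_mul _) (hInt (hθ2.mul hWc)) fun x => ?_
    simp only
    rw [← mul_assoc, ← mul_assoc]
    exact mul_le_mul_of_nonneg_right (mul_le_mul_of_nonneg_right (H.le_sq _)
      (by linarith [hW x])) (by positivity)
  have i2 : ∫ x, θ x ^ 2 * ‖u x‖ ^ 2 ≤ c * ∫ x, W x * ‖u x‖ ^ 2 := by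
    rw [← integral_const_mul]
    refine integral_mono (hInt hθ2) ((hInt hWc).const_mul _) fun x => ?_
    simp only
    rw [← mul_assoc]
    exact mul_le_mul_of_nonneg_right (H.sq_le _) (by positivity)
  have i3 : 0 ≤ ∫ x, θ x ^ 2 * ‖u x‖ ^ 2 := integral_nonneg fun x => by positivity
  rw [hk]
  generalize (hw.toLp _ : L2 d) = w at *
  generalize (hq.toLp _ : L2 d) = q at *
  generalize (u.toLp 2 volume : L2 d) = x at *
  generalize ((negLap u).toLp 2 volume : L2 d) = y at *
  refine norm_le_graphConst_mul (q := q) H.one_le (by positivity) hν hsym.1 hsym.2 ?_ ?_ ?_ hqle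
    ?_ ?_ ?_
  · rwa [eqx, Complex.ofReal_re]
  · rw [exw, Complex.ofReal_im]
  · rwa [eqw, Complex.ofReal_re, eww]
  · rw [eqx, Complex.ofReal_im]
  · rwa [eqx, Complex.ofReal_re]
  · rwa [eqx, exw, Complex.ofReal_re, Complex.ofReal_re]

end ContinuousEstimate

section PotentialConsistency

variable {d : ℕ} {h : ℝ} {φ : SchwartzMap (Euc d) ℂ} {Ph : L2 d →L[ℂ] l2h d h}

lemma exists_sum_one_add_abs_sub_le :
    ∃ B : ℝ, 0 ≤ B ∧ ∀ (t : ℝ) (S : Finset ℤ), ∑ n ∈ S, ((1 + |t - n|) ^ 2)⁻¹ ≤ B := by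
  have hs : Summable fun k : ℤ => ((1 + |(k : ℝ)|) ^ 2)⁻¹ := by
    have h1 : Summable fun n : ℕ => ((1 + (n : ℝ)) ^ 2)⁻¹ := by
      have := (summable_nat_add_iff 1).2 (Real.summable_nat_pow_inv.2 (one_lt_two))
      refine this.congr fun n => ?_
      push_cast
      rw [add_comm]
    refine Summable.of_nat_of_neg ?_ ?_ <;> simpa using h1
  refine ⟨4 * ∑' k : ℤ, ((1 + |(k : ℝ)|) ^ 2)⁻¹,
    mul_nonneg (by norm_num) (tsum_nonneg fun k => by positivity), fun t S => ?_⟩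
  have h2 : ∀ n : ℤ, ((1 + |t - n|) ^ 2)⁻¹ ≤ 4 * ((1 + |((n - ⌊t⌋ : ℤ) : ℝ)|) ^ 2)⁻¹ := fun n => by
    have h3 : |((n - ⌊t⌋ : ℤ) : ℝ)| ≤ |t - n| + 1 := by
      push_cast
      have e : (n : ℝ) - ⌊t⌋ = -(t - n) + (t - ⌊t⌋) := by ring
      rw [e]
      refine (abs_add_le _ _).trans ?_
      rw [abs_neg, abs_of_nonneg (sub_nonneg.2 (Int.floor_le t))]
      linarith [Int.lt_floor_add_one t]
    rw [show (4 : ℝ) = ((2 : ℝ) ^ 2) by norm_num, ← div_eq_mul_inv, inv_eq_one_div,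
      div_le_div_iff₀ (by positivity) (by positivity), one_mul, ← mul_pow]
    refine pow_le_pow_left₀ (by positivity) ?_ 2
    linarith [abs_nonneg (t - n)]
  calc ∑ n ∈ S, ((1 + |t - n|) ^ 2)⁻¹
      ≤ ∑ n ∈ S, 4 * ((1 + |((n - ⌊t⌋ : ℤ) : ℝ)|) ^ 2)⁻¹ := Finset.sum_le_sum fun n _ => h2 n
    _ = 4 * ∑ n ∈ S, ((1 + |((n - ⌊t⌋ : ℤ) : ℝ)|) ^ 2)⁻¹ := by rw [Finset.mul_sum]
    _ ≤ 4 * ∑' n : ℤ, ((1 + |((n - ⌊t⌋ : ℤ) : ℝ)|) ^ 2)⁻¹ := by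
        have hs' : Summable fun n : ℤ => ((1 + |((n - ⌊t⌋ : ℤ) : ℝ)|) ^ 2)⁻¹ :=
          (Equiv.subRight ⌊t⌋).summable_iff.2 hs
        gcongr
        exact hs'.sum_le_tsum _ fun n _ => by positivity
    _ = 4 * ∑' k : ℤ, ((1 + |(k : ℝ)|) ^ 2)⁻¹ := by
        congr 1
        exact (Equiv.subRight ⌊t⌋).tsum_eq fun k : ℤ => ((1 + |(k : ℝ)|) ^ 2)⁻¹

lemma latVec_apply (n : Zd d) (j : Fin d) : latVec d n j = n j := rfl

lemma inv_smul_sub_latPt (hh : 0 < h) (x : Euc d) (z : Zd d) :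
    h⁻¹ • (x - latPt d h z) = h⁻¹ • x - latVec d z := by
  ext j
  simp only [PiLp.smul_apply, PiLp.sub_apply, latPt_apply, latVec_apply, smul_eq_mul]
  field_simp

/-- Integer translates of a Schwartz function, with a linear weight, have uniformly bounded sum. -/
lemma exists_sum_translates_le (φ : SchwartzMap (Euc d) ℂ) :
    ∃ B : ℝ, 0 ≤ B ∧ ∀ (y : Euc d) (S : Finset (Zd d)),
      ∑ z ∈ S, (1 + ‖y - latVec d z‖) * ‖φ (y - latVec d z)‖ ≤ B := by
  obtain ⟨B, hB, hB'⟩ := exists_sum_one_add_abs_sub_le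
  set m := 2 * d + 1
  set C := 2 ^ m * (Finset.Iic (m, 0)).sup (fun m => SchwartzMap.seminorm ℝ m.1 m.2) φ with hC
  have hC0 : ∀ y : Euc d, (1 + ‖y‖) ^ m * ‖φ y‖ ≤ C := fun y => by
    have := SchwartzMap.one_add_le_sup_seminorm_apply (𝕜 := ℝ) (m := (m, 0)) le_rfl le_rfl φ y
    rwa [norm_iteratedFDeriv_zero] at this
  have hC' : 0 ≤ C := le_trans (by positivity) (hC0 0)
  have hψ : ∀ y : Euc d, (1 + ‖y‖) * ‖φ y‖ ≤ C * ∏ j, ((1 + |y j|) ^ 2)⁻¹ := fun y => by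
    have h1 : ∏ j, (1 + |y j|) ^ 2 ≤ (1 + ‖y‖) ^ (2 * d) := by
      calc ∏ j, (1 + |y j|) ^ 2 ≤ ∏ _j : Fin d, (1 + ‖y‖) ^ 2 := by
            refine Finset.prod_le_prod (fun j _ => by positivity) fun j _ => ?_
            have := PiLp.norm_apply_le y j
            rw [Real.norm_eq_abs] at this
            gcongr
        _ = _ := by simp [← pow_mul]
    rw [Finset.prod_inv_distrib, ← div_eq_mul_inv, le_div_iff₀ (by positivity)]
    calc (1 + ‖y‖) * ‖φ y‖ * ∏ j, (1 + |y j|) ^ 2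
        ≤ (1 + ‖y‖) * ‖φ y‖ * (1 + ‖y‖) ^ (2 * d) := by gcongr
      _ = (1 + ‖y‖) ^ m * ‖φ y‖ := by ring
      _ ≤ C := hC0 y
  refine ⟨C * B ^ d, by positivity, fun y S => ?_⟩
  have hS : S ⊆ Fintype.piFinset fun j => S.image fun z => z j := fun z hz =>
    Fintype.mem_piFinset.2 fun j => Finset.mem_image_of_mem _ hz
  calc ∑ z ∈ S, (1 + ‖y - latVec d z‖) * ‖φ (y - latVec d z)‖
      ≤ ∑ z ∈ S, C * ∏ j, ((1 + |y j - z j|) ^ 2)⁻¹ := Finset.sum_le_sum fun z _ => hψ _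
    _ = C * ∑ z ∈ S, ∏ j, ((1 + |y j - z j|) ^ 2)⁻¹ := by rw [Finset.mul_sum]
    _ ≤ C * ∑ z ∈ Fintype.piFinset fun j => S.image fun z => z j,
          ∏ j, ((1 + |y j - z j|) ^ 2)⁻¹ := by
        refine mul_le_mul_of_nonneg_left ?_ hC'
        exact Finset.sum_le_sum_of_subset_of_nonneg hS fun z _ _ =>
          Finset.prod_nonneg fun j _ => by positivity
    _ = C * ∏ j, ∑ n ∈ S.image fun z => z j, ((1 + |y j - n|) ^ 2)⁻¹ := by
        rw [Finset.prod_univ_sum]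
    _ ≤ C * ∏ _j : Fin d, B := by
        refine mul_le_mul_of_nonneg_left (Finset.prod_le_prod (fun j _ => ?_) fun j _ => ?_) hC'
        · exact Finset.sum_nonneg fun n _ => by positivity
        · exact hB' _ _
    _ = C * B ^ d := by simp

lemma le_mul_of_forall_weighted {X B a b : ℝ} (hB : 0 ≤ B) (ha : 0 ≤ a) (hb : 0 ≤ b)
    (hX : ∀ t > 0, X ≤ (t * (B * a ^ 2) + t⁻¹ * (B * b ^ 2)) / 2) : X ≤ B * a * b := by
  have h1 : ∀ η > 0, X ≤ B * (a + η) * (b + η) := fun η hη => by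
    have e1 : (b + η) / (a + η) * (B * a ^ 2) ≤ B * (a + η) * (b + η) := by
      rw [div_mul_eq_mul_div, div_le_iff₀ (by positivity)]
      have : a ^ 2 ≤ (a + η) ^ 2 := by gcongr; linarith
      nlinarith [mul_le_mul_of_nonneg_left this (mul_nonneg hB (by positivity : 0 ≤ b + η))]
    have e2 : (a + η) / (b + η) * (B * b ^ 2) ≤ B * (a + η) * (b + η) := by
      rw [div_mul_eq_mul_div, div_le_iff₀ (by positivity)]
      have : b ^ 2 ≤ (b + η) ^ 2 := by gcongr; linarith
      nlinarith [mul_le_mul_of_nonneg_left this (mul_nonneg hB (by positivity : 0 ≤ a + η))]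
    have := hX ((b + η) / (a + η)) (by positivity)
    rw [inv_div] at this
    linarith
  have h2 : Filter.Tendsto (fun η : ℝ => B * (a + η) * (b + η)) (nhdsWithin 0 (Set.Ioi 0))
      (nhds (B * (a + 0) * (b + 0))) :=
    (Continuous.tendsto (by fun_prop) 0).mono_left nhdsWithin_le_nhds
  rw [add_zero, add_zero] at h2
  exact ge_of_tendsto h2 (eventually_nhdsWithin_of_forall h1)

lemma exists_abs_sub_le_add_mul_dist {F : Euc d → ℝ} (hF : UniformContinuous F)
    (h0 : ∀ x, 0 ≤ F x) (h1 : ∀ x, F x ≤ 1) {ε : ℝ} (hε : 0 < ε) :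
    ∃ L : ℝ, 0 ≤ L ∧ ∀ x y, |F x - F y| ≤ ε + L * dist x y := by
  obtain ⟨δ, hδ, hδ'⟩ := Metric.uniformContinuous_iff.1 hF ε hε
  refine ⟨δ⁻¹, by positivity, fun x y => ?_⟩
  rcases lt_or_ge (dist x y) δ with hxy | hxy
  · have := hδ' hxy
    rw [Real.dist_eq] at this
    have : 0 ≤ δ⁻¹ * dist x y := by positivity
    linarith
  · have e1 : |F x - F y| ≤ 1 := by
      rw [abs_le]; constructor <;> linarith [h0 x, h0 y, h1 x, h1 y]
    have e2 : 1 ≤ δ⁻¹ * dist x y := by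
      rw [inv_mul_eq_div, one_le_div hδ]; exact hxy
    linarith

/-- Multiplication almost commutes with sampling. -/
lemma exists_norm_inner_mulFin_sub_le (φ : SchwartzMap (Euc d) ℂ) :
    ∃ B : ℝ, 0 ≤ B ∧ ∀ (F : Euc d → ℝ) (ε L h : ℝ) (hh : 0 < h) (Ph : L2 d →L[ℂ] l2h d h),
      IsProjOp d h φ Ph → 0 ≤ ε → 0 ≤ L → (∀ x y, |F x - F y| ≤ ε + L * dist x y) →
      ∀ (p : Zd d →₀ ℂ) (w v : L2 d), (v =ᵐ[volume] fun x => (F x : ℂ) * w x) →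
      ‖⟪finLat hh (mulFin (fun z => (F (latPt d h z) : ℂ)) p), Ph w⟫_ℂ -
        ⟪finLat hh p, Ph v⟫_ℂ‖ ≤ (ε + L * h) * (B * ‖finLat hh p‖ * ‖w‖) := by
  obtain ⟨B₁, hB₁, hsum⟩ := exists_sum_translates_le φ
  set ψ : Euc d → ℝ := fun y => (1 + ‖y‖) * ‖φ y‖ with hψ
  have hψ0 : ∀ y, 0 ≤ ψ y := fun y => by positivity
  have hψc : Continuous ψ := (continuous_const.add continuous_norm).mul φ.continuous.norm
  have hψi : Integrable ψ := by
    have h1 := (φ.integrable_pow_mul volume 0).add (φ.integrable_pow_mul volume 1)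
    refine h1.congr (Filter.Eventually.of_forall fun y => ?_)
    simp only [Pi.add_apply, hψ]
    ring
  have hψB : ∀ y, ψ y ≤ B₁ := fun y => by
    have h1 := hsum y {0}
    have h2 : latVec d 0 = 0 := by ext j; simp [latVec_apply]
    simpa [h2] using h1
  set B := max B₁ (∫ y, ψ y)
  have hB : 0 ≤ B := hB₁.trans (le_max_left _ _)
  refine ⟨B, hB, fun F ε L h hh Ph hP hε hL hF p w v hv => ?_⟩
  set Ψ : Zd d → Euc d → ℝ := fun z x => ψ (h⁻¹ • (x - latPt d h z)) with hΨ
  have hΨc : ∀ z, Continuous (Ψ z) := fun z => hψc.comp (by fun_prop)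
  have hΨi : ∀ z, Integrable (Ψ z) := fun z =>
    (hψi.comp_smul (inv_ne_zero hh.ne')).comp_sub_right (latPt d h z)
  have hw2 : ∀ f : L2 d, Integrable fun x => ‖f x‖ ^ 2 := fun f =>
    (memLp_two_iff_integrable_sq_norm (Lp.aestronglyMeasurable f)).1 (Lp.memLp f)
  have hΨf2 : ∀ z (f : L2 d), Integrable fun x => Ψ z x * ‖f x‖ ^ 2 := fun z f =>
    (hw2 f).bdd_mul (hΨc z).aestronglyMeasurable (c := B₁)
      (Filter.Eventually.of_forall fun x => by
        rw [Real.norm_of_nonneg (hψ0 _)]; exact hψB _)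
  have hΨf : ∀ z (f : L2 d), Integrable fun x => Ψ z x * ‖f x‖ := fun z f => by
    refine ((hΨi z).add (hΨf2 z f)).mono'
      ((hΨc z).aestronglyMeasurable.mul (Lp.aestronglyMeasurable f).norm)
      (Filter.Eventually.of_forall fun x => ?_)
    have e0 : 0 ≤ Ψ z x := hψ0 _
    rw [Real.norm_of_nonneg (by positivity), Pi.add_apply]
    nlinarith [mul_nonneg e0 (sq_nonneg (‖f x‖ - 1)), mul_nonneg e0 (sq_nonneg (‖f x‖ + 1))]
  have hφf : ∀ z (f : L2 d), Integrable fun x => conj (φ (h⁻¹ • (x - latPt d h z))) * f x :=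
    fun z f => by
      refine (hΨf z f).mono' (AEStronglyMeasurable.mul (Continuous.aestronglyMeasurable
        (Complex.continuous_conj.comp (φ.continuous.comp (by fun_prop))))
        (Lp.aestronglyMeasurable f)) (Filter.Eventually.of_forall fun x => ?_)
      rw [norm_mul, RCLike.norm_conj]
      gcongr
      simp only [hΨ, hψ]
      exact le_mul_of_one_le_left (norm_nonneg _) (le_add_of_nonneg_right (norm_nonneg _))
  set ω := ε + L * h
  have hω : 0 ≤ ω := by positivity
  have hterm : ∀ z, ‖(F (latPt d h z) : ℂ) *
      (∫ x, conj (φ (h⁻¹ • (x - latPt d h z))) * w x) -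
      ∫ x, conj (φ (h⁻¹ • (x - latPt d h z))) * v x‖ ≤ ω * ∫ x, Ψ z x * ‖w x‖ := fun z => by
    rw [← integral_const_mul, ← integral_sub ((hφf z w).const_mul _) (hφf z v),
      ← integral_const_mul]
    refine norm_integral_le_of_norm_le ((hΨf z w).const_mul _) ?_
    filter_upwards [hv] with x hx
    rw [hx]
    have e1 : (F (latPt d h z) : ℂ) * (conj (φ (h⁻¹ • (x - latPt d h z))) * w x) -
        conj (φ (h⁻¹ • (x - latPt d h z))) * ((F x : ℂ) * w x) =
        conj (φ (h⁻¹ • (x - latPt d h z))) * ((F (latPt d h z) - F x : ℝ) : ℂ) * w x := by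
      push_cast; ring
    rw [e1, norm_mul, norm_mul, RCLike.norm_conj, Complex.norm_real, Real.norm_eq_abs,
      ← mul_assoc]
    refine mul_le_mul_of_nonneg_right ?_ (norm_nonneg _)
    have e2 : dist (latPt d h z) x = h * ‖h⁻¹ • (x - latPt d h z)‖ := by
      rw [norm_smul, norm_inv, Real.norm_of_nonneg hh.le, dist_comm, dist_eq_norm]
      field_simp
    have e3 := hF (latPt d h z) x
    rw [e2] at e3
    have e4 : 0 ≤ ‖h⁻¹ • (x - latPt d h z)‖ := norm_nonneg _
    change _ ≤ ω * ((1 + ‖h⁻¹ • (x - latPt d h z)‖) * ‖φ (h⁻¹ • (x - latPt d h z))‖)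
    rw [mul_comm ‖φ _‖, ← mul_assoc]
    refine mul_le_mul_of_nonneg_right ?_ (norm_nonneg _)
    refine e3.trans ?_
    change _ ≤ (ε + L * h) * _
    nlinarith [mul_nonneg hε e4, mul_nonneg hL hh.le]
  have hdiff : ⟪finLat hh (mulFin (fun z => (F (latPt d h z) : ℂ)) p), Ph w⟫_ℂ -
      ⟪finLat hh p, Ph v⟫_ℂ = ∑ z ∈ p.support, conj (p z) * ((F (latPt d h z) : ℂ) *
      (∫ x, conj (φ (h⁻¹ • (x - latPt d h z))) * w x) -
      ∫ x, conj (φ (h⁻¹ • (x - latPt d h z))) * v x) := by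
    rw [inner_finLat_tsum, tsum_eq_sum (s := p.support), inner_finLat, ← mul_sub,
      ← Finset.sum_sub_distrib, Finset.mul_sum]
    · refine Finset.sum_congr rfl fun z _ => ?_
      rw [hP, hP, mulFin_apply, map_mul, Complex.conj_ofReal]
      have : (h : ℂ) ^ d ≠ 0 := pow_ne_zero _ (by exact_mod_cast hh.ne')
      field_simp
    · intro z hz
      simp [mulFin_apply, Finsupp.notMem_support_iff.1 hz]
  have hbound : ∑ z ∈ p.support, ‖p z‖ * ∫ x, Ψ z x * ‖w x‖ ≤
      B * ‖finLat hh p‖ * ‖w‖ := by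
    refine le_mul_of_forall_weighted hB (norm_nonneg _) (norm_nonneg _) fun t ht => ?_
    have hwn : ‖w‖ ^ 2 = ∫ x, ‖w x‖ ^ 2 := by
      have e1 := L2.inner_def (𝕜 := ℂ) w w
      simp only [inner_self_eq_norm_sq_to_K] at e1
      norm_cast at e1
    have s1 : ∀ z, ‖p z‖ * ∫ x, Ψ z x * ‖w x‖ ≤
        (t * (‖p z‖ ^ 2 * ∫ x, Ψ z x) + t⁻¹ * ∫ x, Ψ z x * ‖w x‖ ^ 2) / 2 := fun z => by
      rw [← integral_const_mul, ← integral_const_mul, ← integral_const_mul, ← integral_const_mul,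
        ← integral_add (((hΨi z).const_mul _).const_mul _) ((hΨf2 z w).const_mul _),
        ← integral_div]
      refine integral_mono ((hΨf z w).const_mul _)
        (((((hΨi z).const_mul _).const_mul _).add ((hΨf2 z w).const_mul _)).div_const 2)
        fun x => ?_
      have e0 : 0 ≤ Ψ z x := hψ0 _
      have e1 : 0 ≤ t⁻¹ * (t * ‖p z‖ - ‖w x‖) ^ 2 * Ψ z x := by positivity
      have e2 : t⁻¹ * (t * ‖p z‖ - ‖w x‖) ^ 2 * Ψ z x = t * (‖p z‖ ^ 2 * Ψ z x) +
          t⁻¹ * (Ψ z x * ‖w x‖ ^ 2) - 2 * (‖p z‖ * (Ψ z x * ‖w x‖)) := by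
        field_simp
        ring
      simp only
      linarith
    have s2 : ∀ z, ∫ x, Ψ z x = h ^ d * ∫ y, ψ y := fun z => by
      simp only [hΨ]
      rw [integral_sub_right_eq_self (fun x => ψ (h⁻¹ • x)) (latPt d h z),
        Measure.integral_comp_inv_smul_of_nonneg _ _ hh.le]
      simp
    have s3 : ∑ z ∈ p.support, ∫ x, Ψ z x * ‖w x‖ ^ 2 ≤ B * ‖w‖ ^ 2 := by
      rw [← integral_finsetSum _ fun z _ => hΨf2 z w, hwn, ← integral_const_mul]
      refine integral_mono (integrable_finsetSum _ fun z _ => hΨf2 z w) ((hw2 w).const_mul _)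
        fun x => ?_
      simp only
      rw [← Finset.sum_mul]
      gcongr
      refine le_trans ?_ ((hsum (h⁻¹ • x) p.support).trans (le_max_left _ _))
      simp only [hΨ, hψ, inv_smul_sub_latPt hh, le_refl]
    have s4 : ∑ z ∈ p.support, ‖p z‖ ^ 2 * ∫ x, Ψ z x ≤ B * ‖finLat hh p‖ ^ 2 := by
      simp only [s2]
      rw [← Finset.sum_mul, norm_sq_finLat]
      have : ∫ y, ψ y ≤ B := le_max_right _ _
      calc _ = (∫ y, ψ y) * (h ^ d * ∑ z ∈ p.support, ‖p z‖ ^ 2) := by ring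
        _ ≤ _ := by gcongr
    refine (Finset.sum_le_sum fun z _ => s1 z).trans ?_
    rw [← Finset.sum_div, Finset.sum_add_distrib, ← Finset.mul_sum, ← Finset.mul_sum]
    gcongr
  rw [hdiff]
  refine (norm_sum_le _ _).trans ?_
  calc _ ≤ ∑ z ∈ p.support, ω * (‖p z‖ * ∫ x, Ψ z x * ‖w x‖) := by
        refine Finset.sum_le_sum fun z _ => ?_
        rw [norm_mul, RCLike.norm_conj, mul_left_comm]
        exact mul_le_mul_of_nonneg_left (hterm z) (norm_nonneg _)
    _ ≤ _ := by
        rw [← Finset.mul_sum]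
        exact mul_le_mul_of_nonneg_left hbound hω

end PotentialConsistency

section Mollification

variable {d : ℕ} {F : Type*} [NormedAddCommGroup F] [NormedSpace ℝ F]

/-- The convolution of `w` with the real kernel `η`. -/
def mollify (η : Euc d → ℝ) (w : Euc d → F) : Euc d → F :=
  convolution η w (ContinuousLinearMap.lsmul ℝ ℝ) volume

lemma mollify_apply (η : Euc d → ℝ) (w : Euc d → F) (x : Euc d) :
    mollify η w x = ∫ t, η (x - t) • w t := by
  rw [mollify, convolution_eq_swap]
  rfl

lemma integrable_mollify_integrand {η : Euc d → ℝ} {w : Euc d → F} (hη : Continuous η)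
    (hc : HasCompactSupport η) (hw : LocallyIntegrable w) (x : Euc d) :
    Integrable fun t => η (x - t) • w t :=
  (hc.convolutionExists_left (ContinuousLinearMap.lsmul ℝ ℝ) hη hw x).integrable_swap

lemma fderiv_mollify_apply {η : Euc d → ℝ} {w : Euc d → F} (hη : ContDiff ℝ 1 η)
    (hc : HasCompactSupport η) (hw : LocallyIntegrable w) (x e : Euc d) :
    fderiv ℝ (mollify η w) x e = mollify (fun t => fderiv ℝ η t e) w x := by
  have h1 := hc.hasFDerivAt_convolution_left (ContinuousLinearMap.lsmul ℝ ℝ) hη hw x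
  have h2 := (hc.fderiv (𝕜 := ℝ)).convolutionExists_left
    (ContinuousLinearMap.precompL (Euc d) (ContinuousLinearMap.lsmul ℝ ℝ))
    (hη.continuous_fderiv one_ne_zero) hw x
  unfold mollify
  rw [h1.fderiv, convolution_def, ContinuousLinearMap.integral_apply h2, convolution_def]
  rfl

lemma mollify_sum {ι : Type*} (s : Finset ι) {η : ι → Euc d → ℝ} {w : Euc d → F}
    (hη : ∀ i, Continuous (η i)) (hc : ∀ i, HasCompactSupport (η i)) (hw : LocallyIntegrable w)
    (x : Euc d) :
    ∑ i ∈ s, mollify (η i) w x = ∫ t, (∑ i ∈ s, η i (x - t)) • w t := by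
  simp_rw [mollify_apply, Finset.sum_smul]
  exact (integral_finsetSum s fun i _ => integrable_mollify_integrand (hη i) (hc i) hw x).symm

lemma lapl_mollify {η : Euc d → ℝ} {w : Euc d → ℂ} (hη : ContDiff ℝ (⊤ : ℕ∞) η)
    (hc : HasCompactSupport η) (hw : LocallyIntegrable w) (x : Euc d) :
    lapl d (mollify η w) x = ∫ t, (∑ j : Fin d, fderiv ℝ
      (fun y => fderiv ℝ η y (EuclideanSpace.single j 1)) (x - t)
        (EuclideanSpace.single j 1)) • w t := by
  have h1 : ContDiff ℝ 1 η := hη.of_le (by exact_mod_cast le_top)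
  have h2 : ∀ j : Fin d, ContDiff ℝ (⊤ : ℕ∞) fun y => fderiv ℝ η y (EuclideanSpace.single j 1) :=
    fun j => contDiff_fderiv_apply_const hη _
  rw [← mollify_sum Finset.univ
    (fun j => (contDiff_fderiv_apply_const (h2 j) (EuclideanSpace.single j 1)).continuous)
    (fun j => (hc.fderiv_apply ℝ _).fderiv_apply ℝ _) hw x, lapl]
  refine Finset.sum_congr rfl fun j _ => ?_
  simp_rw [fderiv_mollify_apply h1 hc hw]
  exact fderiv_mollify_apply ((h2 j).of_le (by exact_mod_cast le_top)) (hc.fderiv_apply ℝ _) hw x _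

lemma fderiv_comp_const_sub_apply {f : Euc d → ℝ} (hf : Differentiable ℝ f) (x y e : Euc d) :
    fderiv ℝ (fun z => f (x - z)) y e = -fderiv ℝ f (x - y) e := by
  have h1 : HasFDerivAt (fun z : Euc d => x - z) (-ContinuousLinearMap.id ℝ (Euc d)) y :=
    (hasFDerivAt_id y).const_sub x
  have h2 := (hf (x - y)).hasFDerivAt.comp y h1
  have h3 : fderiv ℝ (fun z => f (x - z)) y = _ := h2.fderiv
  rw [h3]
  simp

lemma fderiv_ofReal_comp_apply {f : Euc d → ℝ} (hf : Differentiable ℝ f) (y e : Euc d) :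
    fderiv ℝ (fun z => (f z : ℂ)) y e = ((fderiv ℝ f y e : ℝ) : ℂ) := by
  have h2 := (Complex.ofRealCLM.hasFDerivAt (x := f y)).comp y (hf y).hasFDerivAt
  have h3 : fderiv ℝ (fun z => (f z : ℂ)) y = _ := h2.fderiv
  rw [h3]
  simp

lemma lapl_comp_const_sub {η : Euc d → ℝ} (hη : ContDiff ℝ (⊤ : ℕ∞) η) (x y : Euc d) :
    lapl d (fun z => ((η (x - z) : ℝ) : ℂ)) y = ((∑ j : Fin d, fderiv ℝ
      (fun y => fderiv ℝ η y (EuclideanSpace.single j 1)) (x - y)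
        (EuclideanSpace.single j 1) : ℝ) : ℂ) := by
  have hd : ∀ {f : Euc d → ℝ}, ContDiff ℝ (⊤ : ℕ∞) f → Differentiable ℝ f := fun h =>
    h.differentiable (by simp)
  have hs : ∀ {f : Euc d → ℝ}, ContDiff ℝ (⊤ : ℕ∞) f →
      ContDiff ℝ (⊤ : ℕ∞) fun z => f (x - z) := fun h =>
    h.comp (contDiff_const.sub contDiff_id)
  rw [lapl, Complex.ofReal_sum]
  refine Finset.sum_congr rfl fun j _ => ?_
  have h2 : ContDiff ℝ (⊤ : ℕ∞) fun y => fderiv ℝ η y (EuclideanSpace.single j 1) :=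
    contDiff_fderiv_apply_const hη _
  simp_rw [fderiv_ofReal_comp_apply (hd (hs hη)), fderiv_comp_const_sub_apply (hd hη)]
  rw [fderiv_ofReal_comp_apply (hd (hs h2).neg)]
  congr 1
  have h3 : fderiv ℝ (fun z => -fderiv ℝ η (x - z) (EuclideanSpace.single j 1)) y =
      -fderiv ℝ (fun z => fderiv ℝ η (x - z) (EuclideanSpace.single j 1)) y := fderiv_fun_neg
  rw [h3, _root_.neg_apply, fderiv_comp_const_sub_apply (hd h2), neg_neg]

lemma integral_comp_const_sub_eq_one {η : Euc d → ℝ} (h1 : ∫ t, η t = 1) (x : Euc d) :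
    ∫ t, η (x - t) = 1 := by
  rw [integral_sub_left_eq_self η volume x, h1]

lemma sq_mollify_norm_le {η : Euc d → ℝ} {w : Euc d → ℂ} (hη : Continuous η)
    (hc : HasCompactSupport η) (h0 : ∀ t, 0 ≤ η t) (h1 : ∫ t, η t = 1) (hw : MemLp w 2)
    (x : Euc d) :
    mollify η (fun t => ‖w t‖) x ^ 2 ≤ mollify η (fun t => ‖w t‖ ^ 2) x := by
  have i1 := integrable_mollify_integrand hη hc
    (hw.norm.locallyIntegrable (by norm_num)) x
  have i2 := integrable_mollify_integrand hη hc
    ((memLp_two_iff_integrable_sq_norm hw.1).1 hw).locallyIntegrable x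
  have i3 := integrable_mollify_integrand hη hc
    (locallyIntegrable_const (1 : ℝ)) x
  rw [mollify_apply η (fun t => ‖w t‖ ^ 2)]
  have e1 := mollify_apply η (fun t => ‖w t‖) x
  set G := mollify η (fun t => ‖w t‖) x
  have h2 : 0 ≤ ∫ t, η (x - t) * (‖w t‖ - G) ^ 2 :=
    integral_nonneg fun t => mul_nonneg (h0 _) (sq_nonneg _)
  have h3 : ∀ t, η (x - t) * (‖w t‖ - G) ^ 2 = η (x - t) • ‖w t‖ ^ 2 -
      (2 * G) * (η (x - t) • ‖w t‖) + G ^ 2 * (η (x - t) • (1 : ℝ)) := fun t => by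
    simp only [smul_eq_mul]; ring
  simp_rw [h3] at h2
  have i4 : Integrable fun t => η (x - t) • ‖w t‖ ^ 2 - (2 * G) * (η (x - t) • ‖w t‖) :=
    i2.sub (i1.const_mul _)
  rw [integral_add i4 (i3.const_mul _), integral_sub i2 (i1.const_mul _),
    integral_const_mul, integral_const_mul, ← e1] at h2
  simp only [smul_eq_mul, mul_one] at h2
  rw [integral_comp_const_sub_eq_one h1] at h2
  simp only [smul_eq_mul]
  linarith

lemma integrable_mollify_sq {η : Euc d → ℝ} {w : Euc d → ℂ} (hη : Continuous η)
    (hc : HasCompactSupport η) (hw : MemLp w 2) :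
    Integrable (mollify η fun t => ‖w t‖ ^ 2) :=
  (hη.integrable_of_hasCompactSupport hc).integrable_convolution _
    ((memLp_two_iff_integrable_sq_norm hw.1).1 hw)

lemma integral_mollify_sq {η : Euc d → ℝ} {w : Euc d → ℂ} (hη : Continuous η)
    (hc : HasCompactSupport η) (h1 : ∫ t, η t = 1) (hw : MemLp w 2) :
    ∫ x, mollify η (fun t => ‖w t‖ ^ 2) x = ∫ x, ‖w x‖ ^ 2 := by
  unfold mollify
  rw [integral_convolution _ (hη.integrable_of_hasCompactSupport hc)
    ((memLp_two_iff_integrable_sq_norm hw.1).1 hw), h1]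
  simp

lemma norm_mollify_le {η : Euc d → ℝ} (w : Euc d → ℂ) (h0 : ∀ t, 0 ≤ η t) (x : Euc d) :
    ‖mollify η w x‖ ≤ mollify η (fun t => ‖w t‖) x := by
  rw [mollify_apply, mollify_apply]
  refine (norm_integral_le_integral_norm _).trans (le_of_eq ?_)
  refine integral_congr_ae (.of_forall fun t => ?_)
  simp only [norm_smul, Real.norm_eq_abs, abs_of_nonneg (h0 _), smul_eq_mul]

lemma contDiff_mollify {η : Euc d → ℝ} {w : Euc d → ℂ} (hη : ContDiff ℝ (⊤ : ℕ∞) η)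
    (hc : HasCompactSupport η) (hw : LocallyIntegrable w) :
    ContDiff ℝ (⊤ : ℕ∞) (mollify η w) :=
  hc.contDiff_convolution_left _ hη hw

lemma neg_lapl_mollify_eq {W : Euc d → ℝ} {w : Euc d → ℂ} (hW : Continuous W)
    (hw : LocallyIntegrable w)
    (horth : ∀ u : Euc d → ℝ, ContDiff ℝ (⊤ : ℕ∞) u → HasCompactSupport u →
      ∫ x, (-(lapl d (fun z => (u z : ℂ)) x) + (W x : ℂ) * (u x : ℂ)) * w x = 0)
    {η : Euc d → ℝ} (hη : ContDiff ℝ (⊤ : ℕ∞) η) (hc : HasCompactSupport η) (x : Euc d) :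
    Integrable (fun t => (W t * η (x - t)) • w t) ∧
    -lapl d (mollify η w) x = -∫ t, (W t * η (x - t)) • w t := by
  have hcs : ∀ {f : Euc d → ℝ}, HasCompactSupport f → HasCompactSupport fun t => f (x - t) :=
    fun h => h.comp_homeomorph (Homeomorph.subLeft x)
  have hsm : ContDiff ℝ (⊤ : ℕ∞) fun z => η (x - z) := hη.comp (contDiff_const.sub contDiff_id)
  have i1 : Integrable (fun t => (W t * η (x - t)) • w t) :=
    hw.integrable_smul_left_of_hasCompactSupport (hW.mul hsm.continuous) (hcs hc).mul_left
  refine ⟨i1, ?_⟩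
  have h2 : ∀ j : Fin d, ContDiff ℝ (⊤ : ℕ∞) fun y => fderiv ℝ η y (EuclideanSpace.single j 1) :=
    fun j => contDiff_fderiv_apply_const hη _
  have i2 : Integrable (fun t => (∑ j : Fin d, fderiv ℝ
      (fun y => fderiv ℝ η y (EuclideanSpace.single j 1)) (x - t)
        (EuclideanSpace.single j 1)) • w t) := by
    simp_rw [Finset.sum_smul]
    exact integrable_finsetSum _ fun j _ => integrable_mollify_integrand
      (contDiff_fderiv_apply_const (h2 j) (EuclideanSpace.single j 1)).continuous
      ((hc.fderiv_apply ℝ _).fderiv_apply ℝ _) hw x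
  have h := horth _ hsm (hcs hc)
  have h3 : ∀ t, (-(lapl d (fun z => ((η (x - z) : ℝ) : ℂ)) t) +
      (W t : ℂ) * ((η (x - t) : ℝ) : ℂ)) * w t = (W t * η (x - t)) • w t -
      (∑ j : Fin d, fderiv ℝ (fun y => fderiv ℝ η y (EuclideanSpace.single j 1)) (x - t)
        (EuclideanSpace.single j 1)) • w t := fun t => by
    rw [lapl_comp_const_sub hη, Complex.real_smul, Complex.real_smul]
    push_cast
    ring
  simp_rw [h3] at h
  rw [integral_sub i1 i2] at h
  rw [lapl_mollify hη hc hw, sub_eq_zero.1 h]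

lemma re_conj_mollify_mul_neg_lapl_le {W : Euc d → ℝ} {w : Euc d → ℂ} (hW : Continuous W)
    (hW1 : ∀ x, 1 ≤ W x) (hw : LocallyIntegrable w)
    (horth : ∀ u : Euc d → ℝ, ContDiff ℝ (⊤ : ℕ∞) u → HasCompactSupport u →
      ∫ x, (-(lapl d (fun z => (u z : ℂ)) x) + (W x : ℂ) * (u x : ℂ)) * w x = 0)
    {η : Euc d → ℝ} (hη : ContDiff ℝ (⊤ : ℕ∞) η) (hc : HasCompactSupport η) (h0 : ∀ t, 0 ≤ η t)
    {x : Euc d} {κ : ℝ} (hκ0 : 0 ≤ κ) (hκ : ∀ t, η (x - t) ≠ 0 → |W t - W x| ≤ κ) :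
    (conj (mollify η w x) * -lapl d (mollify η w) x).re ≤
      -‖mollify η w x‖ ^ 2 + κ * mollify η (fun t => ‖w t‖) x ^ 2 := by
  obtain ⟨i1, h1⟩ := neg_lapl_mollify_eq hW hw horth hη hc x
  have i2 := integrable_mollify_integrand hη.continuous hc hw x
  have i3 := i2.norm
  have hg := mollify_apply η w x
  have hG := norm_mollify_le w h0 x
  have hGe := mollify_apply η (fun t => ‖w t‖) x
  set g := mollify η w x
  set G := mollify η (fun t => ‖w t‖) x
  have h2 : ∫ t, (W t * η (x - t)) • w t = (W x : ℂ) * g +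
      ∫ t, ((W t - W x) * η (x - t)) • w t := by
    have h3 : ∀ t, ((W t - W x) * η (x - t)) • w t =
        (W t * η (x - t)) • w t - W x • η (x - t) • w t := fun t => by
      rw [sub_mul, sub_smul, mul_smul (W x)]
    simp_rw [h3]
    have i4 : Integrable fun t => W x • η (x - t) • w t := i2.smul (W x)
    rw [integral_sub i1 i4, integral_smul, ← hg, Complex.real_smul]
    ring
  have h4 : ‖∫ t, ((W t - W x) * η (x - t)) • w t‖ ≤ κ * G := by
    rw [hGe, ← integral_const_mul]
    refine norm_integral_le_of_norm_le ?_ (.of_forall fun t => ?_)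
    · refine (i3.const_mul κ).congr (.of_forall fun t => ?_)
      simp only [norm_smul, Real.norm_eq_abs, abs_of_nonneg (h0 _), smul_eq_mul]
    · rw [norm_smul, norm_mul, Real.norm_eq_abs, Real.norm_eq_abs, abs_of_nonneg (h0 _),
        smul_eq_mul, ← mul_assoc]
      refine mul_le_mul_of_nonneg_right ?_ (norm_nonneg _)
      by_cases ht : η (x - t) = 0
      · simp [ht]
      · exact mul_le_mul_of_nonneg_right (hκ t ht) (h0 _)
  rw [h1, h2]
  set e := ∫ t, ((W t - W x) * η (x - t)) • w t
  have h5 : conj g * -((W x : ℂ) * g + e) = ((-(W x * ‖g‖ ^ 2) : ℝ) : ℂ) - conj g * e := by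
    have : conj g * g = ((‖g‖ ^ 2 : ℝ) : ℂ) := by
      rw [mul_comm, Complex.mul_conj, Complex.normSq_eq_norm_sq]
    push_cast at this ⊢
    linear_combination (-(W x : ℂ)) * this
  rw [h5, Complex.sub_re, Complex.ofReal_re]
  have h6 : -(conj g * e).re ≤ ‖g‖ * (κ * G) := by
    refine (neg_le_abs _).trans ((Complex.abs_re_le_norm _).trans ?_)
    rw [norm_mul, Complex.norm_conj]
    exact mul_le_mul_of_nonneg_left h4 (norm_nonneg _)
  have h7 : ‖g‖ * (κ * G) ≤ G * (κ * G) := mul_le_mul_of_nonneg_right hG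
    (mul_nonneg hκ0 ((norm_nonneg _).trans hG))
  nlinarith [mul_le_mul_of_nonneg_right (hW1 x) (sq_nonneg ‖g‖)]

lemma integral_sq_mul_norm_mollify_sq_le {W : Euc d → ℝ} {w : Euc d → ℂ} (hW : Continuous W)
    (hW1 : ∀ x, 1 ≤ W x) (hw : MemLp w 2)
    (horth : ∀ u : Euc d → ℝ, ContDiff ℝ (⊤ : ℕ∞) u → HasCompactSupport u →
      ∫ x, (-(lapl d (fun z => (u z : ℂ)) x) + (W x : ℂ) * (u x : ℂ)) * w x = 0)
    {η : Euc d → ℝ} (hη : ContDiff ℝ (⊤ : ℕ∞) η) (hc : HasCompactSupport η) (h0 : ∀ t, 0 ≤ η t)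
    (h1 : ∫ t, η t = 1) {χ : Euc d → ℝ} (hχ : ContDiff ℝ (⊤ : ℕ∞) χ) (hχc : HasCompactSupport χ)
    (hχ1 : ∀ x, χ x ^ 2 ≤ 1) {b κ : ℝ}
    (hb : ∀ x j, fderiv ℝ χ x (EuclideanSpace.single j 1) ^ 2 ≤ b) (hκ0 : 0 ≤ κ)
    (hκ : ∀ x t, χ x ≠ 0 → η (x - t) ≠ 0 → |W t - W x| ≤ κ) :
    Integrable (fun x => χ x ^ 2 * ‖mollify η w x‖ ^ 2) ∧
    ∫ x, χ x ^ 2 * ‖mollify η w x‖ ^ 2 ≤ (κ + d * b) * ∫ x, ‖w x‖ ^ 2 := by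
  have hwl := hw.locallyIntegrable (by norm_num)
  have hg := contDiff_mollify hη hc hwl
  have hQi := integrable_mollify_sq hη.continuous hc hw
  have hQ := integral_mollify_sq hη.continuous hc h1 hw
  have hgG := norm_mollify_le w h0
  have hGQ := sq_mollify_norm_le hη.continuous hc h0 h1 hw
  have hre := fun x hx => re_conj_mollify_mul_neg_lapl_le hW hW1 hwl horth hη hc h0
    (x := x) hκ0 (fun t => hκ x t hx)
  have hlc := continuous_lapl hg
  set g := mollify η w
  set G := mollify η fun t => ‖w t‖
  set Q := mollify η fun t => ‖w t‖ ^ 2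
  have hgQ : ∀ x, ‖g x‖ ^ 2 ≤ Q x := fun x =>
    (pow_le_pow_left₀ (norm_nonneg _) (hgG x) 2).trans (hGQ x)
  have hχ2 : HasCompactSupport fun x => χ x ^ 2 := by
    simp only [sq]
    exact hχc.mul_left
  have i1 : Integrable (fun x => χ x ^ 2 * ‖g x‖ ^ 2) :=
    ((hχ.continuous.pow 2).mul (hg.continuous.norm.pow 2)).integrable_of_hasCompactSupport
      hχ2.mul_right
  refine ⟨i1, ?_⟩
  have i2 : ∀ j : Fin d, Integrable fun x =>
      (fderiv ℝ χ x (EuclideanSpace.single j 1)) ^ 2 * ‖g x‖ ^ 2 := fun j => by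
    have h3 : HasCompactSupport fun x => fderiv ℝ χ x (EuclideanSpace.single j 1) ^ 2 := by
      simp only [sq]
      exact (hχc.fderiv_apply ℝ (EuclideanSpace.single j 1)).mul_left
    exact (((contDiff_fderiv_apply_const hχ _).continuous.pow 2).mul
      (hg.continuous.norm.pow 2)).integrable_of_hasCompactSupport h3.mul_right
  have hcs : HasCompactSupport fun x => ((χ x ^ 2 : ℝ) : ℂ) * conj (g x) :=
    (hχ2.comp_left (g := ((↑) : ℝ → ℂ)) Complex.ofReal_zero).mul_right
  have henergy := re_integral_sq_mul_conj_mul_neg_lapl_ge hχ hg hcs i2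
  have i3 : Integrable fun x => ((χ x ^ 2 : ℝ) : ℂ) * conj (g x) * -lapl d g x :=
    ((contDiff_sq_mul_conj hχ hg).continuous.mul hlc.neg).integrable_of_hasCompactSupport
      hcs.mul_right
  have h2 : (∫ x, ((χ x ^ 2 : ℝ) : ℂ) * conj (g x) * -lapl d g x).re ≤
      ∫ x, (κ * Q x - χ x ^ 2 * ‖g x‖ ^ 2) := by
    rw [← RCLike.re_eq_complex_re, ← integral_re i3]
    refine integral_mono i3.re ((hQi.const_mul κ).sub i1) fun x => ?_
    simp only [RCLike.re_eq_complex_re]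
    rw [mul_assoc, Complex.re_ofReal_mul]
    by_cases hx : χ x = 0
    · simp only [hx]
      have : 0 ≤ κ * Q x := mul_nonneg hκ0 ((sq_nonneg _).trans (hGQ x))
      simpa using this
    · have h3 := mul_le_mul_of_nonneg_left (hre x hx) (sq_nonneg (χ x))
      have h4 : χ x ^ 2 * (κ * G x ^ 2) ≤ κ * Q x :=
        (mul_le_of_le_one_left (mul_nonneg hκ0 (sq_nonneg _)) (hχ1 x)).trans
          (mul_le_mul_of_nonneg_left (hGQ x) hκ0)
      linarith
  rw [integral_sub (hQi.const_mul κ) i1, integral_const_mul, hQ] at h2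
  have h3 : ∑ j : Fin d, ∫ x, (fderiv ℝ χ x (EuclideanSpace.single j 1)) ^ 2 * ‖g x‖ ^ 2 ≤
      ∑ _j : Fin d, b * ∫ x, ‖w x‖ ^ 2 := by
    refine Finset.sum_le_sum fun j _ => ?_
    rw [← hQ, ← integral_const_mul]
    exact integral_mono (i2 j) (hQi.const_mul b) fun x =>
      mul_le_mul (hb x j) (hgQ x) (sq_nonneg _) ((sq_nonneg _).trans (hb x j))
  rw [Finset.sum_const, Finset.card_univ, Fintype.card_fin, nsmul_eq_mul] at h3
  linarith

lemma exists_contDiffBump_abs_sub_le {W : Euc d → ℝ} (hW : Continuous W) {K : Set (Euc d)}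
    (hK : IsCompact K) {κ : ℝ} (hκ : 0 < κ) :
    ∃ ρ : ContDiffBump (0 : Euc d), ρ.rOut ≤ κ ∧ ρ.rOut ≤ 2 * ρ.rIn ∧
      ∀ x t, x ∈ K → ‖x - t‖ < ρ.rOut → |W t - W x| ≤ κ := by
  have h := hK.uniformContinuousAt_of_continuousAt W (fun a _ => hW.continuousAt)
    (Metric.dist_mem_uniformity hκ)
  obtain ⟨δ, hδ, hδW⟩ := Metric.mem_uniformity_dist.1 h
  have hm : 0 < min δ κ := lt_min hδ hκ
  refine ⟨⟨min δ κ / 2, min δ κ, half_pos hm, half_lt_self hm⟩, min_le_right _ _, ?_, ?_⟩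
  · show min δ κ ≤ 2 * (min δ κ / 2)
    linarith
  · intro x t hx ht
    have h1 := hδW (a := x) (b := t) (by
      rw [dist_eq_norm]; exact ht.trans_le (min_le_left _ _)) hx
    rw [abs_sub_comm]
    exact (le_of_lt h1)

lemma exists_cutoff (d : ℕ) : ∃ (χ : ℕ → Euc d → ℝ) (K : ℝ),
    (∀ n, ContDiff ℝ (⊤ : ℕ∞) (χ n)) ∧ (∀ n, HasCompactSupport (χ n)) ∧
    (∀ n x, χ n x ^ 2 ≤ 1) ∧
    (∀ n x j, fderiv ℝ (χ n) x (EuclideanSpace.single j 1) ^ 2 ≤ (K * ((n : ℝ) + 1)⁻¹) ^ 2) ∧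
    ∀ x, ∀ᶠ n in Filter.atTop, χ n x = 1 := by
  let χ : ContDiffBump (0 : Euc d) := ⟨1, 2, one_pos, one_lt_two⟩
  obtain ⟨K, hK⟩ := (χ.hasCompactSupport.fderiv (𝕜 := ℝ)).exists_bound_of_continuous
    (χ.contDiff.continuous_fderiv (n := 1) one_ne_zero)
  have hpos : ∀ n : ℕ, (0 : ℝ) < ((n : ℝ) + 1)⁻¹ := fun n => by positivity
  refine ⟨fun n x => χ (((n : ℝ) + 1)⁻¹ • x), K, fun n => ?_, fun n => ?_, fun n x => ?_,
    fun n x j => ?_, fun x => ?_⟩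
  · exact χ.contDiff.comp (contDiff_const_smul _)
  · exact χ.hasCompactSupport.comp_homeomorph (Homeomorph.smulOfNeZero _ (hpos n).ne')
  · exact pow_le_one₀ χ.nonneg χ.le_one
  · have h1 := hK (((n : ℝ) + 1)⁻¹ • x)
    have h2 := (fderiv ℝ χ (((n : ℝ) + 1)⁻¹ • x)).le_opNorm (EuclideanSpace.single j 1)
    have h3 : ‖(EuclideanSpace.single j (1 : ℝ) : Euc d)‖ = 1 := by simp
    rw [h3, mul_one] at h2
    rw [fderiv_comp_smul, _root_.smul_apply, smul_eq_mul, ← sq_abs, abs_mul,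
      abs_of_pos (hpos n), mul_comm K]
    exact pow_le_pow_left₀ (by have := hpos n; positivity)
      (mul_le_mul_of_nonneg_left (h2.trans h1) (hpos n).le) 2
  · obtain ⟨N, hN⟩ := exists_nat_ge ‖x‖
    filter_upwards [Filter.eventually_ge_atTop N] with n hn
    apply χ.one_of_mem_closedBall
    rw [mem_closedBall_zero_iff, norm_smul, Real.norm_eq_abs, abs_of_pos (hpos n)]
    show _ ≤ (1 : ℝ)
    rw [inv_mul_le_one₀ (by positivity)]
    have : (N : ℝ) ≤ n := by exact_mod_cast hn
    linarith

lemma ae_eq_zero_of_forall_integral_eq_zero {W : Euc d → ℝ} {w : Euc d → ℂ} (hW : Continuous W)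
    (hW1 : ∀ x, 1 ≤ W x) (hw : MemLp w 2)
    (horth : ∀ u : Euc d → ℝ, ContDiff ℝ (⊤ : ℕ∞) u → HasCompactSupport u →
      ∫ x, (-(lapl d (fun z => (u z : ℂ)) x) + (W x : ℂ) * (u x : ℂ)) * w x = 0) :
    w =ᵐ[volume] 0 := by
  obtain ⟨χ, K, hχ, hχc, hχ1, hχd, hχt⟩ := exists_cutoff d
  have hκ : ∀ n : ℕ, (0 : ℝ) < ((n : ℝ) + 1)⁻¹ := fun n => by positivity
  choose ρ hρ1 hρ2 hρ3 using fun n => exists_contDiffBump_abs_sub_le hW (hχc n) (hκ n)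
  have hlim0 : Filter.Tendsto (fun n : ℕ => ((n : ℝ) + 1)⁻¹) Filter.atTop (nhds 0) := by
    simpa only [one_div] using tendsto_one_div_add_atTop_nhds_zero_nat (𝕜 := ℝ)
  have hρ0 : Filter.Tendsto (fun n => (ρ n).rOut) Filter.atTop (nhds 0) :=
    squeeze_zero (fun n => (ρ n).rOut_pos.le) hρ1 hlim0
  have hwl := hw.locallyIntegrable (by norm_num)
  have hae := ContDiffBump.ae_convolution_tendsto_right_of_locallyIntegrable hρ0
    (.of_forall hρ2) hwl
  set I := ∫ x, ‖w x‖ ^ 2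
  have hmain : ∀ n, Integrable (fun x => χ n x ^ 2 * ‖mollify ((ρ n).normed volume) w x‖ ^ 2) ∧
      ∫ x, χ n x ^ 2 * ‖mollify ((ρ n).normed volume) w x‖ ^ 2 ≤
        (((n : ℝ) + 1)⁻¹ + d * (K * ((n : ℝ) + 1)⁻¹) ^ 2) * I := fun n => by
    refine integral_sq_mul_norm_mollify_sq_le hW hW1 hw horth (ρ n).contDiff_normed
      (ρ n).hasCompactSupport_normed (ρ n).nonneg_normed (ρ n).integral_normed (hχ n) (hχc n)
      (hχ1 n) (hχd n) (hκ n).le fun x t hx ht => ?_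
    refine hρ3 n x t (subset_tsupport _ hx) ?_
    have h1 : x - t ∈ Function.support ((ρ n).normed volume) := ht
    rwa [(ρ n).support_normed_eq, mem_ball_zero_iff] at h1
  have hlim : Filter.Tendsto (fun n : ℕ => ENNReal.ofReal
      ((((n : ℝ) + 1)⁻¹ + d * (K * ((n : ℝ) + 1)⁻¹) ^ 2) * I)) Filter.atTop (nhds 0) := by
    rw [← ENNReal.ofReal_zero]
    apply ENNReal.tendsto_ofReal
    have h1 := (hlim0.add (((hlim0.const_mul K).pow 2).const_mul (d : ℝ))).mul_const I
    simpa using h1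
  have hfat := lintegral_liminf_le' (u := Filter.atTop) (μ := (volume : Measure (Euc d)))
    (f := fun n x => ENNReal.ofReal (χ n x ^ 2 * ‖mollify ((ρ n).normed volume) w x‖ ^ 2))
    fun n => (hmain n).1.1.aemeasurable.ennreal_ofReal
  have hzero : Filter.liminf (fun n => ∫⁻ x, ENNReal.ofReal
      (χ n x ^ 2 * ‖mollify ((ρ n).normed volume) w x‖ ^ 2)) Filter.atTop = 0 := by
    refine Filter.Tendsto.liminf_eq (tendsto_of_tendsto_of_tendsto_of_le_of_le
      tendsto_const_nhds hlim (fun n => zero_le) fun n => ?_)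
    rw [← ofReal_integral_eq_lintegral_ofReal (hmain n).1
      (.of_forall fun x => mul_nonneg (sq_nonneg _) (sq_nonneg _))]
    exact ENNReal.ofReal_le_ofReal (hmain n).2
  rw [hzero] at hfat
  have hlim2 : ∀ᵐ x, Filter.liminf (fun n => ENNReal.ofReal
      (χ n x ^ 2 * ‖mollify ((ρ n).normed volume) w x‖ ^ 2)) Filter.atTop =
        ENNReal.ofReal (‖w x‖ ^ 2) := by
    filter_upwards [hae] with x hx
    refine Filter.Tendsto.liminf_eq (ENNReal.tendsto_ofReal ?_)
    refine ((hx.norm.pow 2)).congr' ?_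
    filter_upwards [hχt x] with n hn
    rw [hn, one_pow, one_mul, mollify]
  rw [lintegral_congr_ae hlim2] at hfat
  have h2 := (lintegral_eq_zero_iff' (hw.1.norm.aemeasurable.pow_const 2).ennreal_ofReal).1
    (le_antisymm hfat zero_le)
  filter_upwards [h2] with x hx
  have h3 : ‖w x‖ ^ 2 ≤ 0 := ENNReal.ofReal_eq_zero.1 hx
  have h4 : ‖w x‖ = 0 := by nlinarith [norm_nonneg (w x)]
  simpa using h4

end Mollification

section Density

lemma norm_le_of_dense_inner_le {E : Type*} [NormedAddCommGroup E] [InnerProductSpace ℂ E]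
    {S : Set E} (hS : Dense S) {v : E} {B : ℝ} (hB : 0 ≤ B)
    (h : ∀ k ∈ S, ‖⟪k, v⟫_ℂ‖ ≤ B * ‖k‖) : ‖v‖ ≤ B := by
  have hcl : IsClosed {k : E | ‖⟪k, v⟫_ℂ‖ ≤ B * ‖k‖} :=
    isClosed_le (by fun_prop) (by fun_prop)
  have h1 : ‖⟪v, v⟫_ℂ‖ ≤ B * ‖v‖ := hcl.closure_subset_iff.2 h (hS v)
  rw [inner_self_eq_norm_sq_to_K, norm_pow, RCLike.norm_ofReal, abs_norm] at h1
  by_contra hlt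
  push Not at hlt
  nlinarith [norm_nonneg v]

lemma Submodule.dense_of_forall_inner_eq_zero {E : Type*} [NormedAddCommGroup E]
    [InnerProductSpace ℂ E] [CompleteSpace E] (K : Submodule ℂ E)
    (h : ∀ w : E, (∀ k ∈ K, ⟪k, w⟫_ℂ = 0) → w = 0) : Dense (K : Set E) := by
  rw [Submodule.dense_iff_topologicalClosure_eq_top, Submodule.topologicalClosure_eq_top_iff,
    Submodule.eq_bot_iff]
  exact fun w hw => h w ((Submodule.mem_orthogonal K w).1 hw)

lemma exists_norm_sub_lt_of_isResolventAt {E : Type*} [NormedAddCommGroup E]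
    [InnerProductSpace ℂ E] [CompleteSpace E] {H : E →ₗ.[ℂ] E}
    (hsym : ∀ x y : H.domain, ⟪H x, (y : E)⟫_ℂ = ⟪(x : E), H y⟫_ℂ) {μ : ℂ} {R : E →L[ℂ] E}
    (hR : IsResolventAt H μ R) (S : Submodule ℂ H.domain) (e C : ℝ)
    (hC : ∀ u ∈ S, ‖(u : E)‖ ≤ C * ‖H u + (e : ℂ) • (u : E)‖)
    (horth : ∀ w : E, (∀ u ∈ S, ⟪H u + (e : ℂ) • (u : E), w⟫_ℂ = 0) → w = 0)
    (f : E) {ε : ℝ} (hε : 0 < ε) : ∃ u ∈ S, ‖H u - μ • (u : E) - f‖ < ε := by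
  let T : H.domain →ₗ[ℂ] E := H.toFun + (e : ℂ) • H.domain.subtype
  have hT : ∀ u : H.domain, T u = H u + (e : ℂ) • (u : E) := fun u => rfl
  have hdense : Dense ((S.map T : Submodule ℂ E) : Set E) :=
    Submodule.dense_of_forall_inner_eq_zero _ fun w hw => horth w fun u hu =>
      hw _ (Submodule.mem_map_of_mem hu)
  obtain ⟨y, hyS, hy⟩ := mem_closure_iff_seq_limit.1 (hdense (f + ((e : ℂ) + μ) • R f))
  choose u huS huy using fun n => Submodule.mem_map.1 (hyS n)
  have hyT : ∀ n, y n = H (u n) + (e : ℂ) • (u n : E) := fun n => (huy n).symm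
  have hcauchy : CauchySeq fun n => (u n : E) := by
    rw [Metric.cauchySeq_iff']
    intro δ hδ
    have hC1 : 0 < |C| + 1 := by positivity
    obtain ⟨N, hN⟩ := Metric.cauchySeq_iff'.1 hy.cauchySeq (δ / (|C| + 1)) (by positivity)
    refine ⟨N, fun n hn => ?_⟩
    have h1 := hC (u n - u N) (S.sub_mem (huS n) (huS N))
    have h2 : H (u n - u N) + (e : ℂ) • ((u n - u N : H.domain) : E) = y n - y N := by
      rw [← hT, map_sub, huy, huy]
    rw [h2, Submodule.coe_sub] at h1
    have h3 := hN n hn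
    rw [dist_eq_norm] at h3 ⊢
    rw [lt_div_iff₀ hC1] at h3
    nlinarith [le_abs_self C, norm_nonneg (y n - y N)]
  obtain ⟨s, hs⟩ := cauchySeq_tendsto_of_complete hcauchy
  have hlim : Filter.Tendsto (fun n => H (u n) - μ • (u n : E)) Filter.atTop
      (nhds (f + ((e : ℂ) + μ) • R f - ((e : ℂ) + μ) • s)) := by
    refine (hy.sub (hs.const_smul ((e : ℂ) + μ))).congr fun n => ?_
    rw [hyT, add_smul]
    abel
  have hRlim : R (f + ((e : ℂ) + μ) • R f - ((e : ℂ) + μ) • s) = s :=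
    tendsto_nhds_unique (((R.continuous.tendsto _).comp hlim).congr fun n => hR.2 (u n)) hs
  rw [map_sub, map_add, map_smul, map_smul] at hRlim
  set t := R f - s with ht
  have ht0 : t = R (-(((e : ℂ) + μ) • t)) := by
    rw [map_neg, map_smul]
    calc R f - s = R f - (R f + ((e : ℂ) + μ) • R (R f) - ((e : ℂ) + μ) • R s) := by rw [hRlim]
      _ = -(((e : ℂ) + μ) • R t) := by rw [ht, map_sub, smul_sub]; abel
  obtain ⟨hd, hdt⟩ := hR.1 (-(((e : ℂ) + μ) • t))
  have htd : t ∈ H.domain := by rw [ht0]; exact hd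
  have hHt : H ⟨t, htd⟩ + (e : ℂ) • t = 0 := by
    have h1 : H ⟨t, htd⟩ = H ⟨R (-(((e : ℂ) + μ) • t)), hd⟩ := by
      congr 1; exact Subtype.ext ht0
    have h2 : H ⟨t, htd⟩ - μ • t = -(((e : ℂ) + μ) • t) :=
      (congrArg₂ (fun a b => a - μ • b) h1 ht0).trans hdt
    rw [sub_eq_iff_eq_add.1 h2, add_smul]
    abel
  have ht1 : t = 0 := horth t fun v _ => by
    have h1 := hsym v ⟨t, htd⟩
    rw [inner_add_left, h1, inner_smul_left, Complex.conj_ofReal, ← inner_smul_right,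
      ← inner_add_right, hHt, inner_zero_right]
  rw [show f + ((e : ℂ) + μ) • R f - ((e : ℂ) + μ) • s = f + ((e : ℂ) + μ) • t by
    rw [ht, smul_sub]; abel, ht1, smul_zero, add_zero] at hlim
  obtain ⟨n, hn⟩ := ((Metric.tendsto_nhds.1 hlim) ε hε).exists
  exact ⟨u n, huS n, by rwa [← dist_eq_norm]⟩

end Density

section DiscreteDensity

variable {d : ℕ} {h : ℝ}

/-- `-Δ_h + W - ν` on finitely supported functions. -/
def discHamFin (h : ℝ) (W : Euc d → ℝ) (ν : ℂ) : (Zd d →₀ ℂ) →ₗ[ℂ] (Zd d →₀ ℂ) where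
  toFun g := discLapFin h g + mulFin (fun z => (W (latPt d h z) : ℂ)) g - ν • g
  map_add' f g := by
    ext z
    simp only [Finsupp.sub_apply, Finsupp.add_apply, Finsupp.smul_apply, discLapFin_apply,
      mulFin_apply, discLap, smul_eq_mul]
    have h1 : ∀ j : Fin d, 2 * (f z + g z) - (f (z + Pi.single j 1) + g (z + Pi.single j 1)) -
        (f (z - Pi.single j 1) + g (z - Pi.single j 1)) =
        (2 * f z - f (z + Pi.single j 1) - f (z - Pi.single j 1)) +
        (2 * g z - g (z + Pi.single j 1) - g (z - Pi.single j 1)) := fun j => by ring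
    simp_rw [h1, Finset.sum_add_distrib]
    ring
  map_smul' c g := by
    ext z
    simp only [Finsupp.sub_apply, Finsupp.add_apply, Finsupp.smul_apply, discLapFin_apply,
      mulFin_apply, discLap, smul_eq_mul, RingHom.id_apply]
    have h1 : ∀ j : Fin d, 2 * (c * g z) - c * g (z + Pi.single j 1) - c * g (z - Pi.single j 1) =
        c * (2 * g z - g (z + Pi.single j 1) - g (z - Pi.single j 1)) := fun j => by ring
    simp_rw [h1, ← Finset.mul_sum]
    ring

lemma finLat_discHamFin (hh : 0 < h) (W : Euc d → ℝ) (ν : ℂ) (g : Zd d →₀ ℂ) :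
    finLat hh (discHamFin h W ν g) = finLat hh (discLapFin h g) +
      finLat hh (mulFin (fun z => (W (latPt d h z) : ℂ)) g) - ν • finLat hh g := by
  rw [← finLat_add, ← finLat_smul, ← finLat_sub]
  rfl

lemma inner_finLat_discHamFin (hh : 0 < h) {V W : Euc d → ℝ} {e : ℝ} (hWV : ∀ x, W x = V x + e)
    (μ : ℂ) (g : Zd d →₀ ℂ) (v : l2h d h) :
    ⟪finLat hh (discHamFin h W (e + conj μ) g), v⟫_ℂ =
      (h ^ d : ℂ) * ∑' z, conj (g z) * (discAct d h V v z - μ * v z) := by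
  have s1 := summable_conj_mul g (discLap h v)
  have s2 := summable_conj_mul g fun z => (W (latPt d h z) : ℂ) * v z
  have s3 := (summable_conj_mul g v).mul_left ((e : ℂ) + μ)
  have e2 : ∑' z, conj (mulFin (fun z => (W (latPt d h z) : ℂ)) g z) * v z =
      ∑' z, conj (g z) * ((W (latPt d h z) : ℂ) * v z) := tsum_congr fun z => by
    rw [mulFin_apply, map_mul, Complex.conj_ofReal]; ring
  rw [finLat_discHamFin, inner_sub_left, inner_add_left, inner_smul_left,
    inner_finLat_discLapFin, inner_finLat_tsum, inner_finLat_tsum, e2, map_add,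
    Complex.conj_ofReal, Complex.conj_conj, mul_left_comm, ← mul_add, ← mul_sub, ← tsum_mul_left,
    ← s1.tsum_add s2, ← (s1.add s2).tsum_sub s3]
  congr 1
  refine tsum_congr fun z => ?_
  rw [discAct_eq, hWV]
  push_cast
  ring

lemma IsDiscreteHam.inner_finLat_discHamFin {V : Euc d → ℝ} {Hh : l2h d h →ₗ.[ℂ] l2h d h}
    (hHh : IsDiscreteHam d h V Hh) (hh : 0 < h) {W : Euc d → ℝ} {e : ℝ}
    (hWV : ∀ x, W x = V x + e) (μ : ℂ) (g : Zd d →₀ ℂ) (y : Hh.domain) :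
    ⟪finLat hh (discHamFin h W (e + conj μ) g), (y : l2h d h)⟫_ℂ =
      ⟪finLat hh g, Hh y - μ • (y : l2h d h)⟫_ℂ := by
  rw [_root_.inner_finLat_discHamFin hh hWV, inner_finLat_tsum]
  congr 1
  refine tsum_congr fun z => ?_
  rw [coeFn_sub_latMeas hh, Pi.sub_apply, coeFn_smul_latMeas hh, Pi.smul_apply, hHh.2, smul_eq_mul]

lemma IsDiscreteHam.dense_range_discHamFin {V : Euc d → ℝ} {Hh : l2h d h →ₗ.[ℂ] l2h d h}
    (hHh : IsDiscreteHam d h V Hh) (hh : 0 < h) {W : Euc d → ℝ} {e : ℝ}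
    (hWV : ∀ x, W x = V x + e) {μ : ℂ} {Rh : l2h d h →L[ℂ] l2h d h}
    (hR : IsResolventAt Hh μ Rh) :
    Dense (Set.range fun g => finLat hh (discHamFin h W (e + conj μ) g)) := by
  let L : (Zd d →₀ ℂ) →ₗ[ℂ] l2h d h :=
    { toFun := finLat hh, map_add' := finLat_add hh, map_smul' := finLat_smul hh }
  have hr : (Set.range fun g => finLat hh (discHamFin h W (e + conj μ) g)) =
      ((L ∘ₗ discHamFin h W (e + conj μ)).range : Set (l2h d h)) := by
    rw [LinearMap.coe_range]
    rfl
  rw [hr]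
  refine Submodule.dense_of_forall_inner_eq_zero _ fun w hw => ?_
  have hpt : discAct d h V w = μ • (w : Zd d → ℂ) := by
    ext z
    have h1 := hw _ (LinearMap.mem_range_self _ (Finsupp.single z 1))
    have h2 := _root_.inner_finLat_discHamFin hh hWV μ (Finsupp.single z 1) w
    rw [tsum_eq_single z (fun z' hz => by simp [Finsupp.single_eq_of_ne hz])] at h2
    have h3 : (h ^ d : ℂ) * (discAct d h V w z - μ * w z) = 0 := by
      rw [← h1]
      refine Eq.trans ?_ h2.symm
      simp
    have h4 : (h ^ d : ℂ) ≠ 0 := pow_ne_zero _ (by exact_mod_cast hh.ne')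
    exact sub_eq_zero.1 ((mul_eq_zero.1 h3).resolve_left h4)
  have hdom : w ∈ Hh.domain := hHh.1 w (by rw [hpt]; exact (Lp.memLp w).const_smul μ)
  have h5 : Hh ⟨w, hdom⟩ = μ • w := ext_latMeas hh fun z => by
    rw [hHh.2, hpt, coeFn_smul_latMeas hh]
  have h6 := hR.2 ⟨w, hdom⟩
  rw [h5, sub_self, map_zero] at h6
  exact h6.symm

end DiscreteDensity

section ContinuousDensity

variable {d : ℕ}

lemma conj_lapl_ofReal {u : Euc d → ℝ} (hu : ContDiff ℝ (⊤ : ℕ∞) u) (x : Euc d) :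
    conj (lapl d (fun z => (u z : ℂ)) x) = lapl d (fun z => (u z : ℂ)) x := by
  have hd : ∀ {f : Euc d → ℝ}, ContDiff ℝ (⊤ : ℕ∞) f → Differentiable ℝ f := fun h =>
    h.differentiable (by simp)
  unfold lapl
  rw [map_sum]
  refine Finset.sum_congr rfl fun j _ => ?_
  simp_rw [fderiv_ofReal_comp_apply (hd hu)]
  rw [fderiv_ofReal_comp_apply (hd (contDiff_fderiv_apply_const hu _)), Complex.conj_ofReal]

lemma IsSchrodingerOp.inner_apply_left {V : Euc d → ℝ} {H : L2 d →ₗ.[ℂ] L2 d}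
    (hH : IsSchrodingerOp d V H) (x y : H.domain) :
    ⟪H x, (y : L2 d)⟫_ℂ = ⟪(x : L2 d), H y⟫_ℂ := by
  have h := LinearPMap.adjoint_isFormalAdjoint hH.1.dense_domain
  rw [LinearPMap.isSelfAdjoint_def.1 hH.1] at h
  exact h x y

lemma IsSchrodingerOp.apply_schwartz {V W : Euc d → ℝ} {H : L2 d →ₗ.[ℂ] L2 d}
    (hH : IsSchrodingerOp d V H) (hV : Continuous V) {e : ℝ} (hWV : ∀ x, W x = V x + e)
    (u : SchwartzMap (Euc d) ℂ) (hu : HasCompactSupport u)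
    (hw : MemLp (fun x : Euc d => (W x : ℂ) * u x) 2 volume) :
    ∃ hdom : (u.toLp 2 volume : L2 d) ∈ H.domain,
      H ⟨u.toLp 2 volume, hdom⟩ + (e : ℂ) • u.toLp 2 volume =
        (negLap u).toLp 2 volume + hw.toLp _ := by
  have hv := memLp_mul_of_hasCompactSupport hV u.continuous hu
  have hl : MemLp (fun x => -lapl d u x) 2 (volume : Measure (Euc d)) :=
    ((negLap u).memLp 2 volume).congr_norm
      (continuous_lapl (u.smooth _)).neg.aestronglyMeasurable
      (.of_forall fun x => by rw [negLap_apply])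
  obtain ⟨hdom, h⟩ := hH.2 u (u.smooth _) hu (u.memLp 2 volume) (hl.add hv)
  refine ⟨hdom, ?_⟩
  have h' : H ⟨u.toLp 2 volume, hdom⟩ = (hl.add hv).toLp _ := h
  rw [h']
  refine Lp.ext ?_
  filter_upwards [Lp.coeFn_add ((hl.add hv).toLp _) ((e : ℂ) • (u.toLp 2 volume : L2 d)),
    Lp.coeFn_smul (e : ℂ) (u.toLp 2 volume : L2 d),
    Lp.coeFn_add ((negLap u).toLp 2 volume : L2 d) (hw.toLp _), (hl.add hv).coeFn_toLp,
    hw.coeFn_toLp, u.coeFn_toLp 2 volume, (negLap u).coeFn_toLp 2 volume] with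
    x h1 h2 h3 h4 h5 h6 h7
  rw [h1, h3, Pi.add_apply, Pi.add_apply, h2, h4, h5, h7, Pi.smul_apply, h6, negLap_apply, hWV,
    Pi.add_apply, smul_eq_mul]
  push_cast
  ring

/-- The range of `-Δ + W` on test functions has trivial orthogonal complement. -/
lemma eq_zero_of_forall_inner_eq_zero {W : Euc d → ℝ} (hW : Continuous W) (hW1 : ∀ x, 1 ≤ W x)
    (w : L2 d)
    (h : ∀ (u : SchwartzMap (Euc d) ℂ), HasCompactSupport u →
      ∀ hw : MemLp (fun x : Euc d => (W x : ℂ) * u x) 2 volume,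
      ⟪((negLap u).toLp 2 volume + hw.toLp _ : L2 d), w⟫_ℂ = 0) : w = 0 := by
  rw [Lp.eq_zero_iff_ae_eq_zero]
  refine ae_eq_zero_of_forall_integral_eq_zero hW hW1 (Lp.memLp w) fun u hu hc => ?_
  have huc : HasCompactSupport fun x => (u x : ℂ) :=
    hc.comp_left (g := ((↑) : ℝ → ℂ)) Complex.ofReal_zero
  have hus : ContDiff ℝ (⊤ : ℕ∞) fun x => (u x : ℂ) := Complex.ofRealCLM.contDiff.comp hu
  let U : SchwartzMap (Euc d) ℂ := huc.toSchwartzMap hus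
  have hU : ∀ x, U x = (u x : ℂ) := fun x => rfl
  have hU' : (⇑U : Euc d → ℂ) = fun x => (u x : ℂ) := rfl
  have hw := memLp_mul_of_hasCompactSupport hW U.continuous huc
  rw [← h U huc hw, L2.inner_def]
  refine integral_congr_ae ?_
  filter_upwards [Lp.coeFn_add ((negLap U).toLp 2 volume : L2 d) (hw.toLp _), hw.coeFn_toLp,
    (negLap U).coeFn_toLp 2 volume] with x h3 h5 h7
  rw [h3, Pi.add_apply, h5, h7, negLap_apply, RCLike.inner_apply, hU', map_add, map_neg,
    conj_lapl_ofReal hu, map_mul, Complex.conj_ofReal, Complex.conj_ofReal, mul_comm]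

lemma norm_toLp_le_norm_negLap_add {W : Euc d → ℝ} (hW : Continuous W) (hW1 : ∀ x, 1 ≤ W x)
    (u : SchwartzMap (Euc d) ℂ) (hu : HasCompactSupport u)
    (hw : MemLp (fun x : Euc d => (W x : ℂ) * u x) 2 volume) :
    ‖(u.toLp 2 volume : L2 d)‖ ≤ ‖((negLap u).toLp 2 volume + hw.toLp _ : L2 d)‖ := by
  have h1 : MemLp (fun x : Euc d => ((1 : ℝ) : ℂ) * u x) 2 volume :=
    memLp_mul_of_hasCompactSupport continuous_const u.continuous hu
  have hu1 : (u.toLp 2 volume : L2 d) = h1.toLp _ := by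
    rw [toLp_schwartz_eq]
    exact MemLp.toLp_congr _ _ (Filter.Eventually.of_forall fun x => by simp)
  have h2 : ‖(u.toLp 2 volume : L2 d)‖ ^ 2 ≤
      (⟪(u.toLp 2 volume : L2 d), hw.toLp _⟫_ℂ).re := by
    rw [norm_sq_toLp_schwartz, hu1, inner_toLp_mul h1 hw, Complex.ofReal_re]
    refine integral_mono ?_ (integrable_mul_norm_sq (continuous_const.mul hW) u.continuous hu)
      fun x => ?_
    · simpa using integrable_mul_norm_sq (continuous_const (y := (1 : ℝ))) u.continuous hu
    · simp only [one_mul]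
      exact le_mul_of_one_le_left (sq_nonneg _) (hW1 x)
  have h3 := (inner_schwartz_negLap_self u).2
  have h4 : ‖(u.toLp 2 volume : L2 d)‖ ^ 2 ≤ ‖(u.toLp 2 volume : L2 d)‖ *
      ‖((negLap u).toLp 2 volume + hw.toLp _ : L2 d)‖ := by
    refine le_trans ?_ (re_inner_le_norm (𝕜 := ℂ) _ _)
    rw [inner_add_right, RCLike.re_eq_complex_re, Complex.add_re]
    linarith
  by_contra hlt
  push Not at hlt
  nlinarith [norm_nonneg ((negLap u).toLp 2 volume + hw.toLp _ : L2 d)]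

lemma IsSchrodingerOp.exists_norm_sub_lt {V W : Euc d → ℝ} {H : L2 d →ₗ.[ℂ] L2 d}
    (hH : IsSchrodingerOp d V H) (hV : Continuous V) {e : ℝ} (hWV : ∀ x, W x = V x + e)
    (hW1 : ∀ x, 1 ≤ W x) {μ : ℂ} {R : L2 d →L[ℂ] L2 d} (hR : IsResolventAt H μ R)
    (f : L2 d) {ε : ℝ} (hε : 0 < ε) :
    ∃ (u : SchwartzMap (Euc d) ℂ) (_ : HasCompactSupport u)
      (hw : MemLp (fun x : Euc d => (W x : ℂ) * u x) 2 volume),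
      R ((negLap u).toLp 2 volume + hw.toLp _ - (e + μ) • u.toLp 2 volume) = u.toLp 2 volume ∧
      ‖(negLap u).toLp 2 volume + hw.toLp _ - (e + μ) • u.toLp 2 volume - f‖ < ε := by
  have hW : Continuous W := by
    rw [show W = _ from funext hWV]; exact hV.add continuous_const
  have hmul := fun (u : SchwartzMap (Euc d) ℂ) (hu : HasCompactSupport u) =>
    memLp_mul_of_hasCompactSupport hW u.continuous hu
  let S : Submodule ℂ H.domain :=
    { carrier := {x | ∃ u : SchwartzMap (Euc d) ℂ, HasCompactSupport u ∧
        (x : L2 d) = u.toLp 2 volume}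
      add_mem' := by
        rintro x y ⟨u, hu, hxu⟩ ⟨v, hv, hyv⟩
        refine ⟨u + v, hu.add hv, ?_⟩
        rw [Submodule.coe_add, hxu, hyv]
        exact ((SchwartzMap.toLpCLM ℂ ℂ 2 (volume : Measure (Euc d))).map_add u v).symm
      zero_mem' := ⟨0, HasCompactSupport.zero,
        ((SchwartzMap.toLpCLM ℂ ℂ 2 (volume : Measure (Euc d))).map_zero).symm⟩
      smul_mem' := by
        rintro c x ⟨u, hu, hxu⟩
        refine ⟨c • u, hu.smul_left (f := fun _ => c), ?_⟩
        rw [Submodule.coe_smul, hxu]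
        exact ((SchwartzMap.toLpCLM ℂ ℂ 2 (volume : Measure (Euc d))).map_smul c u).symm }
  have hact : ∀ (x : H.domain) (u : SchwartzMap (Euc d) ℂ) (hu : HasCompactSupport u),
      (x : L2 d) = u.toLp 2 volume → H x + (e : ℂ) • (x : L2 d) =
        (negLap u).toLp 2 volume + (hmul u hu).toLp _ := fun x u hu hx => by
    obtain ⟨hd, h⟩ := hH.apply_schwartz hV hWV u hu (hmul u hu)
    have : x = ⟨u.toLp 2 volume, hd⟩ := Subtype.ext hx
    rw [this, h]
  obtain ⟨x, ⟨u, hu, hxu⟩, hx⟩ := exists_norm_sub_lt_of_isResolventAt hH.inner_apply_left hR S e 1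
    (by
      rintro x ⟨u, hu, hxu⟩
      rw [hact x u hu hxu, hxu, one_mul]
      exact norm_toLp_le_norm_negLap_add hW hW1 u hu _)
    (fun w hw => eq_zero_of_forall_inner_eq_zero hW hW1 w fun u hu hwu => by
      obtain ⟨hd, h⟩ := hH.apply_schwartz hV hWV u hu hwu
      have := hw ⟨u.toLp 2 volume, hd⟩ ⟨u, hu, rfl⟩
      rwa [h] at this)
    f hε
  have h1 : (negLap u).toLp 2 volume + (hmul u hu).toLp _ - (e + μ) • u.toLp 2 volume =
      H x - μ • (x : L2 d) := by
    rw [← hact x u hu hxu, hxu, add_smul]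
    abel
  refine ⟨u, hu, hmul u hu, ?_, ?_⟩
  · rw [h1, hR.2, hxu]
  · rwa [h1]

end ContinuousDensity

section Assembly

variable {d : ℕ} {h δ : ℝ} {φ : SchwartzMap (Euc d) ℂ} {Ph : L2 d →L[ℂ] l2h d h}

/-- Consistency of the discretisation, tested against finitely supported functions. -/
lemma IsProjOp.norm_inner_discHamFin_sub_le (hP : IsProjOp d h φ Ph)
    (hψ : IsSamplingSymbol (𝓕 ⇑φ) δ) (hh : 0 < h) (h1 : h ≤ 1) {W θ : Euc d → ℝ} {c C : ℝ}
    (Hθ : IsSqrtWeight W θ c C) (hWc : Continuous W) (hW1 : ∀ x, 1 ≤ W x) {ν : ℂ} (hν : ν.im ≠ 0)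
    {B ε L : ℝ} (hB : 0 ≤ B) (hε : 0 ≤ ε) (hL : 0 ≤ L)
    (hF : ∀ (p : Zd d →₀ ℂ) (w v : L2 d),
      (v =ᵐ[volume] fun x => (((W x)⁻¹ : ℝ) : ℂ) * w x) →
      ‖⟪finLat hh (mulFin (fun z => (((W (latPt d h z))⁻¹ : ℝ) : ℂ)) p), Ph w⟫_ℂ -
        ⟪finLat hh p, Ph v⟫_ℂ‖ ≤ (ε + L * h) * (B * ‖finLat hh p‖ * ‖w‖))
    (u : SchwartzMap (Euc d) ℂ) (hu : HasCompactSupport u)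
    (hw : MemLp (fun x : Euc d => (W x : ℂ) * u x) 2 volume) {f : L2 d}
    (hf : f = (negLap u).toLp 2 volume + hw.toLp _ - ν • u.toLp 2 volume) (g : Zd d →₀ ℂ) :
    ‖⟪finLat hh g, Ph f⟫_ℂ - ⟪finLat hh (discHamFin h W (conj ν) g), Ph (u.toLp 2 volume)⟫_ℂ‖ ≤
      (π ^ 2 / δ ^ 2 * h ^ 2 + (ε + L * h) * B) * (graphConst c (d * C ^ 2) ν *
        graphConst c (d * C ^ 2) (conj ν)) * ‖f‖ * ‖finLat hh (discHamFin h W (conj ν) g)‖ := by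
  have hν' : (conj ν).im ≠ 0 := by simpa using hν
  obtain ⟨c1, c2, c3⟩ := Hθ.toLp_le hWc hW1 hν u hu hw hf
  obtain ⟨d1, d2, d3⟩ := Hθ.finLat_le hW1 hh h1 hν' g
  rw [← finLat_discHamFin] at d1 d2 d3
  have e1 := hP.norm_inner_laplacian_sub_le hψ hh u g
  have hW0 : ∀ x, W x ≠ 0 := fun x => (one_pos.trans_le (hW1 x)).ne'
  have e2 := hF (mulFin (fun z => (W (latPt d h z) : ℂ)) g) (hw.toLp _) (u.toLp 2 volume) (by
    filter_upwards [hw.coeFn_toLp, u.coeFn_toLp 2 volume] with x hx1 hx2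
    rw [hx1, hx2, ← mul_assoc, ← Complex.ofReal_mul, inv_mul_cancel₀ (hW0 x), Complex.ofReal_one,
      one_mul])
  have hg : mulFin (fun z => (((W (latPt d h z))⁻¹ : ℝ) : ℂ))
      (mulFin (fun z => (W (latPt d h z) : ℂ)) g) = g := by
    ext z
    rw [mulFin_apply, mulFin_apply, ← mul_assoc, ← Complex.ofReal_mul, inv_mul_cancel₀ (hW0 _),
      Complex.ofReal_one, one_mul]
  rw [hg] at e2
  have hsplit : ⟪finLat hh g, Ph f⟫_ℂ -
      ⟪finLat hh (discHamFin h W (conj ν) g), Ph (u.toLp 2 volume)⟫_ℂ =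
      (⟪finLat hh g, Ph ((negLap u).toLp 2 volume)⟫_ℂ -
        ⟪finLat hh (discLapFin h g), Ph (u.toLp 2 volume)⟫_ℂ) +
      (⟪finLat hh g, Ph (hw.toLp _)⟫_ℂ -
        ⟪finLat hh (mulFin (fun z => (W (latPt d h z) : ℂ)) g), Ph (u.toLp 2 volume)⟫_ℂ) := by
    rw [finLat_discHamFin, hf, map_sub, map_add, map_smul, inner_sub_right, inner_add_right,
      inner_smul_right, inner_sub_left, inner_add_left, inner_smul_left, Complex.conj_conj]
    ring
  rw [hsplit]
  have hK1 := graphConst_pos (c := c) (C := d * C ^ 2) (by positivity) ν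
  have hK2 := graphConst_pos (c := c) (C := d * C ^ 2) (by positivity) (conj ν)
  set K₁ := graphConst c (d * C ^ 2) ν
  set K₂ := graphConst c (d * C ^ 2) (conj ν)
  set k := ‖finLat hh (discHamFin h W (conj ν) g)‖
  have hk : 0 ≤ k := norm_nonneg _
  have hf0 : 0 ≤ ‖f‖ := norm_nonneg _
  have g1 : ‖finLat hh (g + discLapFin h g)‖ ≤ 2 * (K₂ * k) := by
    rw [finLat_add]
    linarith [norm_add_le (finLat hh g) (finLat hh (discLapFin h g))]
  have g2 : ‖(u.toLp 2 volume + (negLap u).toLp 2 volume : L2 d)‖ ≤ 2 * (K₁ * ‖f‖) := by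
    linarith [norm_add_le (u.toLp 2 volume : L2 d) ((negLap u).toLp 2 volume)]
  refine (norm_add_le _ _).trans ((add_le_add e1 e2).trans ?_)
  have f1 : π ^ 2 / (4 * δ ^ 2) * h ^ 2 * ‖finLat hh (g + discLapFin h g)‖ *
      ‖(u.toLp 2 volume + (negLap u).toLp 2 volume : L2 d)‖ ≤
      π ^ 2 / (4 * δ ^ 2) * h ^ 2 * (2 * (K₂ * k)) * (2 * (K₁ * ‖f‖)) := by
    gcongr
  have f2 : (ε + L * h) * (B * ‖finLat hh (mulFin (fun z => (W (latPt d h z) : ℂ)) g)‖ *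
      ‖(hw.toLp _ : L2 d)‖) ≤ (ε + L * h) * (B * (K₂ * k) * (K₁ * ‖f‖)) := by
    gcongr
  refine (add_le_add f1 f2).trans (le_of_eq ?_)
  have := hψ.pos.ne'
  field_simp
  ring

/-- The resolvent difference on the image of a test function. -/
lemma IsProjOp.norm_adjoint_resolvent_sub_le (hP : IsProjOp d h φ Ph)
    (hψ : IsSamplingSymbol (𝓕 ⇑φ) δ) (hh : 0 < h) (h1 : h ≤ 1) {V W θ : Euc d → ℝ} {c C : ℝ}
    (Hθ : IsSqrtWeight W θ c C) (hWc : Continuous W) (hW1 : ∀ x, 1 ≤ W x) {e : ℝ}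
    (hWV : ∀ x, W x = V x + e) {μ : ℂ} (hμ : μ.im ≠ 0)
    {B ε L : ℝ} (hB : 0 ≤ B) (hε : 0 ≤ ε) (hL : 0 ≤ L)
    (hF : ∀ (p : Zd d →₀ ℂ) (w v : L2 d),
      (v =ᵐ[volume] fun x => (((W x)⁻¹ : ℝ) : ℂ) * w x) →
      ‖⟪finLat hh (mulFin (fun z => (((W (latPt d h z))⁻¹ : ℝ) : ℂ)) p), Ph w⟫_ℂ -
        ⟪finLat hh p, Ph v⟫_ℂ‖ ≤ (ε + L * h) * (B * ‖finLat hh p‖ * ‖w‖))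
    {Hh : l2h d h →ₗ.[ℂ] l2h d h} (hHh : IsDiscreteHam d h V Hh) {Rh : l2h d h →L[ℂ] l2h d h}
    (hRh : IsResolventAt Hh μ Rh)
    (u : SchwartzMap (Euc d) ℂ) (hu : HasCompactSupport u)
    (hw : MemLp (fun x : Euc d => (W x : ℂ) * u x) 2 volume) {f : L2 d}
    (hf : f = (negLap u).toLp 2 volume + hw.toLp _ - (e + μ) • u.toLp 2 volume) :
    ‖ContinuousLinearMap.adjoint Ph (Rh (Ph f)) - u.toLp 2 volume‖ ≤
      ((π ^ 2 / δ ^ 2 * h ^ 2 + (ε + L * h) * B) * (graphConst c (d * C ^ 2) (e + μ) *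
        graphConst c (d * C ^ 2) (conj (e + μ))) +
        h ^ 2 / (4 * π ^ 2 * δ ^ 2) * graphConst c (d * C ^ 2) (e + μ)) * ‖f‖ := by
  have hν : ((e : ℂ) + μ).im ≠ 0 := by simpa using hμ
  have hconj : conj ((e : ℂ) + μ) = e + conj μ := by rw [map_add, Complex.conj_ofReal]
  have hK1 := graphConst_pos (c := c) (C := d * C ^ 2) (by positivity) (e + μ)
  have hK2 := graphConst_pos (c := c) (C := d * C ^ 2) (by positivity) (conj (e + μ))
  have hcons := hP.norm_inner_discHamFin_sub_le hψ hh h1 Hθ hWc hW1 hν hB hε hL hF u hu hw hf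
  obtain ⟨-, c2, -⟩ := Hθ.toLp_le hWc hW1 hν u hu hw hf
  have hJ := hP.norm_adjoint_comp_sub_le hψ hh u
  have hdense := hHh.dense_range_discHamFin hh hWV hRh
  obtain ⟨hd, hy⟩ := hRh.1 (Ph f)
  have hv : ‖Rh (Ph f) - Ph (u.toLp 2 volume)‖ ≤
      (π ^ 2 / δ ^ 2 * h ^ 2 + (ε + L * h) * B) * (graphConst c (d * C ^ 2) (e + μ) *
        graphConst c (d * C ^ 2) (conj (e + μ))) * ‖f‖ := by
    refine norm_le_of_dense_inner_le hdense (by positivity) ?_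
    rintro _ ⟨g, rfl⟩
    have h2 := hHh.inner_finLat_discHamFin hh hWV μ g ⟨Rh (Ph f), hd⟩
    rw [hy] at h2
    have h3 := hcons g
    rw [hconj, ← h2, ← inner_sub_right] at h3
    rw [hconj]
    exact h3
  have h4 : ContinuousLinearMap.adjoint Ph (Rh (Ph f)) - u.toLp 2 volume =
      ContinuousLinearMap.adjoint Ph (Rh (Ph f) - Ph (u.toLp 2 volume)) +
        (ContinuousLinearMap.adjoint Ph (Ph (u.toLp 2 volume)) - u.toLp 2 volume) := by
    rw [map_sub]; abel
  rw [h4, add_mul]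
  refine (norm_add_le _ _).trans (add_le_add ((hP.norm_adjoint_apply_le hψ hh _).trans hv)
    (hJ.trans ?_))
  rw [mul_assoc (h ^ 2 / (4 * π ^ 2 * δ ^ 2))]
  gcongr

/-- Operator norm bound for the resolvent difference. -/
lemma IsProjOp.opNorm_resolvent_sub_le (hP : IsProjOp d h φ Ph)
    (hψ : IsSamplingSymbol (𝓕 ⇑φ) δ) (hh : 0 < h) (h1 : h ≤ 1) {V W θ : Euc d → ℝ} {c C : ℝ}
    (Hθ : IsSqrtWeight W θ c C) (hVc : Continuous V) (hW1 : ∀ x, 1 ≤ W x) {e : ℝ}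
    (hWV : ∀ x, W x = V x + e) {μ : ℂ} (hμ : μ.im ≠ 0)
    {B ε L : ℝ} (hB : 0 ≤ B) (hε : 0 ≤ ε) (hL : 0 ≤ L)
    (hF : ∀ (p : Zd d →₀ ℂ) (w v : L2 d),
      (v =ᵐ[volume] fun x => (((W x)⁻¹ : ℝ) : ℂ) * w x) →
      ‖⟪finLat hh (mulFin (fun z => (((W (latPt d h z))⁻¹ : ℝ) : ℂ)) p), Ph w⟫_ℂ -
        ⟪finLat hh p, Ph v⟫_ℂ‖ ≤ (ε + L * h) * (B * ‖finLat hh p‖ * ‖w‖))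
    {H : L2 d →ₗ.[ℂ] L2 d} (hH : IsSchrodingerOp d V H) {R : L2 d →L[ℂ] L2 d}
    (hR : IsResolventAt H μ R)
    {Hh : l2h d h →ₗ.[ℂ] l2h d h} (hHh : IsDiscreteHam d h V Hh) {Rh : l2h d h →L[ℂ] l2h d h}
    (hRh : IsResolventAt Hh μ Rh) :
    ‖(ContinuousLinearMap.adjoint Ph).comp (Rh.comp Ph) - R‖ ≤
      (π ^ 2 / δ ^ 2 * h ^ 2 + (ε + L * h) * B) * (graphConst c (d * C ^ 2) (e + μ) *
        graphConst c (d * C ^ 2) (conj (e + μ))) +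
        h ^ 2 / (4 * π ^ 2 * δ ^ 2) * graphConst c (d * C ^ 2) (e + μ) := by
  have hWc : Continuous W := by
    rw [show W = _ from funext hWV]; exact hVc.add continuous_const
  have hK1 := graphConst_pos (c := c) (C := d * C ^ 2) (by positivity) (e + μ)
  have hK2 := graphConst_pos (c := c) (C := d * C ^ 2) (by positivity) (conj (e + μ))
  refine ContinuousLinearMap.opNorm_le_bound _ (by positivity) fun f => ?_
  have hclosed := isClosed_le
    ((ContinuousLinearMap.adjoint Ph).comp (Rh.comp Ph) - R).continuous.norm
    (continuous_const (y := (π ^ 2 / δ ^ 2 * h ^ 2 + (ε + L * h) * B) *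
      (graphConst c (d * C ^ 2) (e + μ) * graphConst c (d * C ^ 2) (conj (e + μ))) +
        h ^ 2 / (4 * π ^ 2 * δ ^ 2) * graphConst c (d * C ^ 2) (e + μ)) |>.mul continuous_norm)
  refine hclosed.closure_subset (Metric.mem_closure_iff.2 fun r hr => ?_)
  obtain ⟨u, hu, hw, hRu, hdist⟩ := hH.exists_norm_sub_lt hVc hWV hW1 hR f hr
  obtain ⟨g, hg⟩ : ∃ g : L2 d, g = (negLap u).toLp 2 volume + hw.toLp _ -
      ((e : ℂ) + μ) • u.toLp 2 volume := ⟨_, rfl⟩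
  rw [← hg] at hRu hdist
  refine ⟨g, ?_, by rw [dist_comm, dist_eq_norm]; exact hdist⟩
  have key := hP.norm_adjoint_resolvent_sub_le hψ hh h1 Hθ hWc hW1 hWV hμ hB hε hL
    hF hHh hRh u hu hw hg
  rw [← hRu] at key
  exact key

lemma uniformContinuous_inv_add_one {X : Type*} [PseudoMetricSpace X] {a : X → ℝ}
    (ha : ∀ x, 0 < a x) (hu : UniformContinuous fun x => (a x)⁻¹) :
    UniformContinuous fun x => (a x + 1)⁻¹ := by
  rw [Metric.uniformContinuous_iff] at hu ⊢
  intro ε hε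
  obtain ⟨δ, hδ, h⟩ := hu ε hε
  refine ⟨δ, hδ, fun x y hxy => (?_ : _ ≤ _).trans_lt (h hxy)⟩
  have hx := ha x
  have hy := ha y
  rw [Real.dist_eq, Real.dist_eq, inv_sub_inv (by positivity) (by positivity),
    inv_sub_inv hx.ne' hy.ne', abs_div, abs_div, abs_of_pos (mul_pos hx hy),
    abs_of_pos (mul_pos (add_pos hx one_pos) (add_pos hy one_pos)), add_sub_add_right_eq_sub]
  gcongr <;> linarith

lemma exists_forall_error_lt (a b : ℝ) {B K₁ K₂ ε : ℝ} (hB : 0 ≤ B) (hK₁ : 0 < K₁)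
    (hK₂ : 0 < K₂) (hε : 0 < ε) :
    ∃ η : ℝ, 0 < η ∧ ∀ L : ℝ, ∃ h₀ > (0 : ℝ), ∀ h : ℝ, 0 < h → h < h₀ →
      (a * h ^ 2 + (η + L * h) * B) * (K₁ * K₂) + h ^ 2 / b * K₁ < ε := by
  obtain ⟨η, hη, hηε⟩ : ∃ η : ℝ, 0 < η ∧ η * B * (K₁ * K₂) < ε := by
    refine ⟨ε / (B * (K₁ * K₂) + 1), by positivity, ?_⟩
    rw [mul_assoc, div_mul_eq_mul_div, div_lt_iff₀ (by positivity)]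
    linarith
  refine ⟨η, hη, fun L => ?_⟩
  have hcont : Continuous fun h : ℝ => (a * h ^ 2 + (η + L * h) * B) * (K₁ * K₂) +
      h ^ 2 / b * K₁ := by fun_prop
  obtain ⟨h₀, hh₀, hsmall⟩ := Metric.eventually_nhds_iff.1
    ((hcont.tendsto' 0 (η * B * (K₁ * K₂)) (by simp)).eventually (gt_mem_nhds hηε))
  refine ⟨h₀, hh₀, fun h hh hlt => hsmall ?_⟩
  rwa [Real.dist_eq, sub_zero, abs_of_pos hh]

end Assembly

/-- Theorem 1 of the paper.  Suppose Assumptions (V) and (φ) hold.  Then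
for any `μ ∈ ℂ \ ℝ`, `‖P_h*(H_h − μ)⁻¹P_h − (H − μ)⁻¹‖_{B(L²(ℝ^d))} → 0` as `h → 0`. -/
theorem norm_resolvent_convergence
    (d : ℕ) (φ : SchwartzMap (Euc d) ℂ)
    -- Assumption (φ)
    (hφ1 : ∀ ξ : Euc d, ∑' n : Zd d, ‖𝓕 ⇑φ (ξ + latVec d n)‖ ^ 2 = 1)
    (hφ2 : tsupport (𝓕 ⇑φ) ⊆ {ξ : Euc d | ∀ j, ξ j ∈ Set.Ioo (-1 : ℝ) 1})
    -- Assumption (V)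
    (V : Euc d → ℝ) (hVcont : Continuous V) (hVbdd : BddBelow (Set.range V))
    (M : ℝ) (hM : 0 < M) (hVM : ∀ x, 0 < V x + M)
    (hVu : UniformContinuous fun x => (V x + M)⁻¹)
    (c₁ : ℝ) (hc₁ : 0 < c₁)
    (hVcomp : ∀ x y : Euc d, dist x y ≤ 1 →
      c₁⁻¹ * (V x + M) ≤ V y + M ∧ V y + M ≤ c₁ * (V x + M))
    -- the self-adjoint operator `H = −Δ + V` and its resolvent at `μ ∉ ℝ`
    (H : L2 d →ₗ.[ℂ] L2 d) (hH : IsSchrodingerOp d V H)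
    (μ : ℂ) (hμ : μ.im ≠ 0)
    (R : L2 d →L[ℂ] L2 d) (hR : IsResolventAt H μ R) :
    ∀ ε > (0 : ℝ), ∃ h₀ > (0 : ℝ), ∀ h : ℝ, 0 < h → h < h₀ →
      ∀ Ph : L2 d →L[ℂ] l2h d h, IsProjOp d h φ Ph →
      ∀ Hh : l2h d h →ₗ.[ℂ] l2h d h, IsDiscreteHam d h V Hh →
      ∀ Rh : l2h d h →L[ℂ] l2h d h, IsResolventAt Hh μ Rh →
        ‖(ContinuousLinearMap.adjoint Ph).comp (Rh.comp Ph) - R‖ ≤ ε := by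
  intro ε hε
  obtain ⟨W, hWV⟩ : ∃ W : Euc d → ℝ, ∀ x, W x = V x + (M + 1) := ⟨_, fun _ => rfl⟩
  have hW1 : ∀ x, 1 ≤ W x := fun x => by
    have := hVM x
    rw [hWV]
    linarith
  have hWc : Continuous W := by
    rw [funext hWV]
    exact hVcont.add continuous_const
  have hcomp : ∀ x y, dist x y ≤ 1 → W y ≤ max c₁ 1 * W x := fun x y hxy => by
    have h1 := (hVcomp x y hxy).2
    have h2 := mul_le_mul_of_nonneg_right (le_max_left c₁ 1) (hVM x).le
    have h3 := le_max_right c₁ 1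
    rw [hWV, hWV]
    linarith
  obtain ⟨θ, c, C, Hθ⟩ := exists_isSqrtWeight hWc (fun x => one_pos.trans_le (hW1 x)) hcomp
  obtain ⟨δ, hψ⟩ := exists_isSamplingSymbol hφ1 hφ2
  obtain ⟨B, hB, hBF⟩ := exists_norm_inner_mulFin_sub_le φ
  have hu : UniformContinuous fun x => (W x)⁻¹ := by
    simpa only [hWV, add_assoc] using uniformContinuous_inv_add_one hVM hVu
  obtain ⟨η, hη, hsmall⟩ := exists_forall_error_lt (π ^ 2 / δ ^ 2) (4 * π ^ 2 * δ ^ 2) hB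
    (graphConst_pos (c := c) (C := d * C ^ 2) (by positivity) (((M + 1 : ℝ) : ℂ) + μ))
    (graphConst_pos (c := c) (C := d * C ^ 2) (by positivity) (conj (((M + 1 : ℝ) : ℂ) + μ))) hε
  obtain ⟨L, hL, hLF⟩ := exists_abs_sub_le_add_mul_dist hu
    (fun x => inv_nonneg.2 (zero_le_one.trans (hW1 x))) (fun x => inv_le_one_of_one_le₀ (hW1 x)) hη
  obtain ⟨h₀, hh₀, hbound⟩ := hsmall L
  refine ⟨min h₀ 1, lt_min hh₀ one_pos, fun h hh hlt Ph hP Hh hHh Rh hRh => ?_⟩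
  exact (hP.opNorm_resolvent_sub_le hψ hh (hlt.le.trans (min_le_right _ _)) Hθ hVcont hW1 hWV hμ
    hB hη.le hL (hBF (fun x => (W x)⁻¹) η L h hh Ph hP hη.le hL hLF) hH hR hHh hRh).trans
    (hbound h hh (hlt.trans_le (min_le_left _ _))).le
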